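/- arXiv:math/0502079 — 4 statements merged into one kernel-verified Lean document; each statement's English description precedes it below -/
import Mathlib

section
/- There exists a constant c > 0 depending only on the dimension n such that the following holds. Let x₀ ∈ ℝⁿ, t₀ ∈ ℝ, R > 0, T > 0, M > 0, and let u be a smooth positive solution of the heat equation on Q_{R,T} := (closed ball B(x₀,R)) × [t₀ − T, t₀] ⊂ ℝⁿ × ℝ with u ≤ M on Q_{R,T}. Then for every (x,t) ∈ B(x₀, R/2) × [t₀ − T/2, t₀], one has |∇u(x,t)|/u(x,t) ≤ c (1/R + 1/√T) (1 + ln(M/u(x,t))). (This is the Euclidean, curvature-zero case of Theorem 1.1, estimate (1.4).) -/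
open Metric Set

/-- Spatial gradient of a function on Euclidean space. -/
noncomputable def sgrad {n : ℕ} (f : EuclideanSpace ℝ (Fin n) → ℝ)
    (x : EuclideanSpace ℝ (Fin n)) : EuclideanSpace ℝ (Fin n) :=
  gradient f x

/-- Spatial Laplacian: sum of the second partial derivatives. -/
noncomputable def slap {n : ℕ} (f : EuclideanSpace ℝ (Fin n) → ℝ)
    (x : EuclideanSpace ℝ (Fin n)) : ℝ :=
  ∑ i : Fin n, fderiv ℝ (fun y => fderiv ℝ f y (EuclideanSpace.single i 1)) x
    (EuclideanSpace.single i 1)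

/-- `u(x,t)` is a (smooth) solution of the heat equation on `Q`. -/
def IsHeatSolutionOn {n : ℕ} (u : EuclideanSpace ℝ (Fin n) → ℝ → ℝ)
    (Q : Set (EuclideanSpace ℝ (Fin n) × ℝ)) : Prop :=
  ContDiffOn ℝ (⊤ : ℕ∞) (fun p : EuclideanSpace ℝ (Fin n) × ℝ => u p.1 p.2) Q ∧
  ∀ p ∈ Q, deriv (fun s => u p.1 s) p.2 = slap (fun y => u y p.2) p.1

open scoped ContDiff


section DirDeriv

variable {X : Type*} [NormedAddCommGroup X] [NormedSpace ℝ X]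

/-- Derivative of `F` in the constant direction `a`, as a function of the base point. -/
noncomputable def dirDeriv (a : X) (F : X → ℝ) : X → ℝ := fun p => fderiv ℝ F p a

variable {O : Set X} {F G : X → ℝ} {a b p : X}

lemma ContDiffOn.differentiableAt_of_isOpen (hO : IsOpen O) (hF : ContDiffOn ℝ ∞ F O)
    (hp : p ∈ O) : DifferentiableAt ℝ F p :=
  (hF.contDiffAt (hO.mem_nhds hp)).differentiableAt (by simp)

lemma ContDiffOn.dirDeriv (hO : IsOpen O) (hF : ContDiffOn ℝ ∞ F O) (a : X) :
    ContDiffOn ℝ ∞ (dirDeriv a F) O :=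
  (hF.fderiv_of_isOpen hO (m := ∞) (by simp)).clm_apply contDiffOn_const

lemma dirDeriv_congr (hO : IsOpen O) (h : EqOn F G O) (hp : p ∈ O) :
    dirDeriv a F p = dirDeriv a G p := by
  have : F =ᶠ[nhds p] G := Filter.eventuallyEq_of_mem (hO.mem_nhds hp) h
  simp only [dirDeriv, this.fderiv_eq]

lemma dirDeriv_comm (hO : IsOpen O) (hF : ContDiffOn ℝ ∞ F O) (hp : p ∈ O) :
    dirDeriv a (dirDeriv b F) p = dirDeriv b (dirDeriv a F) p := by
  have hd : DifferentiableAt ℝ (fderiv ℝ F) p :=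
    ((hF.fderiv_of_isOpen hO (m := ∞) (by simp)).contDiffAt
      (hO.mem_nhds hp)).differentiableAt (by simp)
  have hs : IsSymmSndFDerivAt ℝ F p :=
    (hF.contDiffAt (hO.mem_nhds hp)).isSymmSndFDerivAt
      (by
        rw [minSmoothness_of_isRCLikeNormedField]
        exact WithTop.coe_le_coe.2 (le_top : (2 : ℕ∞) ≤ ⊤))
  have key : ∀ c d : X, dirDeriv c (dirDeriv d F) p = fderiv ℝ (fderiv ℝ F) p c d := by
    intro c d
    have := hd.hasFDerivAt.clm_apply (hasFDerivAt_const d p)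
    change fderiv ℝ (fun q => fderiv ℝ F q d) p c = _
    rw [this.fderiv]
    simp
  rw [key, key]
  exact hs a b

lemma dirDeriv_mul (hF : DifferentiableAt ℝ F p) (hG : DifferentiableAt ℝ G p) :
    dirDeriv a (fun q => F q * G q) p = dirDeriv a F p * G p + F p * dirDeriv a G p := by
  simp only [dirDeriv]
  rw [fderiv_fun_mul hF hG]
  simp
  ring

lemma dirDeriv_add (hF : DifferentiableAt ℝ F p) (hG : DifferentiableAt ℝ G p) :
    dirDeriv a (fun q => F q + G q) p = dirDeriv a F p + dirDeriv a G p := by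
  simp only [dirDeriv]
  rw [fderiv_fun_add hF hG]
  simp

lemma dirDeriv_sub (hF : DifferentiableAt ℝ F p) (hG : DifferentiableAt ℝ G p) :
    dirDeriv a (fun q => F q - G q) p = dirDeriv a F p - dirDeriv a G p := by
  simp only [dirDeriv]
  rw [fderiv_fun_sub hF hG]
  simp

lemma dirDeriv_sum {ι : Type*} (s : Finset ι) {F : ι → X → ℝ}
    (hF : ∀ i ∈ s, DifferentiableAt ℝ (F i) p) :
    dirDeriv a (fun q => ∑ i ∈ s, F i q) p = ∑ i ∈ s, dirDeriv a (F i) p := by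
  simp only [dirDeriv]
  rw [fderiv_fun_sum hF]
  simp

lemma dirDeriv_comp {φ : ℝ → ℝ} {φ' : ℝ} (hφ : HasDerivAt φ φ' (F p))
    (hF : DifferentiableAt ℝ F p) :
    dirDeriv a (fun q => φ (F q)) p = φ' * dirDeriv a F p := by
  have := hφ.comp_hasFDerivAt p hF.hasFDerivAt
  simp only [dirDeriv]
  rw [show (fun q => φ (F q)) = φ ∘ F from rfl, this.fderiv]
  simp

lemma dirDeriv_dirDeriv_mul (hO : IsOpen O) (hF : ContDiffOn ℝ ∞ F O)
    (hG : ContDiffOn ℝ ∞ G O) (hp : p ∈ O) :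
    dirDeriv a (dirDeriv a (fun q => F q * G q)) p =
      dirDeriv a (dirDeriv a F) p * G p + 2 * (dirDeriv a F p * dirDeriv a G p) +
        F p * dirDeriv a (dirDeriv a G) p := by
  have dF := fun {q} (hq : q ∈ O) => hF.differentiableAt_of_isOpen hO hq
  have dG := fun {q} (hq : q ∈ O) => hG.differentiableAt_of_isOpen hO hq
  have ddF := (hF.dirDeriv hO a).differentiableAt_of_isOpen hO hp
  have ddG := (hG.dirDeriv hO a).differentiableAt_of_isOpen hO hp
  rw [dirDeriv_congr hO (fun q hq => dirDeriv_mul (dF hq) (dG hq)) hp,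
    dirDeriv_add (ddF.fun_mul (dG hp)) ((dF hp).fun_mul ddG), dirDeriv_mul ddF (dG hp),
    dirDeriv_mul (dF hp) ddG]
  ring

lemma hasDerivAt_comp_line {s : ℝ} (hF : DifferentiableAt ℝ F (p + s • a)) :
    HasDerivAt (fun s : ℝ => F (p + s • a)) (dirDeriv a F (p + s • a)) s := by
  have h : HasDerivAt (fun s : ℝ => p + s • a) a s := by
    simpa using ((hasDerivAt_id s).smul_const a).const_add p
  exact hF.hasFDerivAt.comp_hasDerivAt s h

/-- First and second order necessary conditions at a maximum along a line. -/
lemma dirDeriv_of_isLocalMax_line (hO : IsOpen O) (hF : ContDiffOn ℝ ∞ F O) (hp : p ∈ O)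
    (hmax : IsLocalMax (fun s : ℝ => F (p + s • a)) 0) :
    dirDeriv a F p = 0 ∧ dirDeriv a (dirDeriv a F) p ≤ 0 := by
  have hcont : Continuous (fun s : ℝ => p + s • a) := by fun_prop
  have hnear : ∀ᶠ s in nhds (0 : ℝ), p + s • a ∈ O :=
    hcont.continuousAt.eventually_mem (by simpa using hO.mem_nhds hp)
  have hderiv : deriv (fun s : ℝ => F (p + s • a)) =ᶠ[nhds 0]
      fun s => dirDeriv a F (p + s • a) := by
    filter_upwards [hnear] with s hs
    exact (hasDerivAt_comp_line (hF.differentiableAt_of_isOpen hO hs)).deriv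
  have h1 : dirDeriv a F p = 0 := by
    have := hmax.deriv_eq_zero
    rw [hderiv.eq_of_nhds] at this
    simpa using this
  have h2 : deriv (deriv (fun s : ℝ => F (p + s • a))) 0 = dirDeriv a (dirDeriv a F) p := by
    rw [hderiv.deriv_eq]
    have := (hasDerivAt_comp_line (F := dirDeriv a F) (a := a) (p := p) (s := 0)
      ((hF.dirDeriv hO a).differentiableAt_of_isOpen hO (by simpa using hp))).deriv
    simpa using this
  refine ⟨h1, ?_⟩
  by_contra! hpos
  rw [← h2] at hpos
  have hmin : IsLocalMin (fun s : ℝ => F (p + s • a)) 0 := by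
    refine isLocalMin_of_deriv_deriv_pos hpos ?_ ?_
    · exact hmax.deriv_eq_zero
    · exact (hasDerivAt_comp_line
        (hF.differentiableAt_of_isOpen hO (by simpa using hp))).continuousAt
  have hconst : (fun s : ℝ => F (p + s • a)) =ᶠ[nhds 0] fun _ => F (p + (0 : ℝ) • a) := by
    filter_upwards [hmin, hmax] with s h h'
    exact le_antisymm h' h
  have h3 := hconst.deriv.deriv_eq
  simp at h3
  simp [h3] at hpos

end DirDeriv

section HeatEvolution

variable {n : ℕ}

/-- The `i`-th spatial coordinate direction in space-time. -/
noncomputable def spaceDir (i : Fin n) : EuclideanSpace ℝ (Fin n) × ℝ :=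
  (EuclideanSpace.single i 1, 0)

/-- The time direction in space-time. -/
def timeDir : EuclideanSpace ℝ (Fin n) × ℝ := (0, 1)

/-- Squared norm of the spatial gradient. -/
noncomputable def gradSq (V : EuclideanSpace ℝ (Fin n) × ℝ → ℝ) :
    EuclideanSpace ℝ (Fin n) × ℝ → ℝ :=
  fun p => ∑ j, dirDeriv (spaceDir j) V p * dirDeriv (spaceDir j) V p

variable {O : Set (EuclideanSpace ℝ (Fin n) × ℝ)} {V : EuclideanSpace ℝ (Fin n) × ℝ → ℝ}
  {p : EuclideanSpace ℝ (Fin n) × ℝ}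

lemma gradSq_nonneg : 0 ≤ gradSq V p :=
  Finset.sum_nonneg fun _ _ => mul_self_nonneg _

lemma ContDiffOn.gradSq (hO : IsOpen O) (hV : ContDiffOn ℝ ∞ V O) :
    ContDiffOn ℝ ∞ (gradSq V) O :=
  ContDiffOn.sum fun _ _ => (hV.dirDeriv hO _).mul (hV.dirDeriv hO _)

lemma dirDeriv_gradSq (hO : IsOpen O) (hV : ContDiffOn ℝ ∞ V O) (hp : p ∈ O)
    (a : EuclideanSpace ℝ (Fin n) × ℝ) :
    dirDeriv a (gradSq V) p =
      ∑ j, 2 * (dirDeriv (spaceDir j) V p * dirDeriv a (dirDeriv (spaceDir j) V) p) := by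
  have d := fun j => (hV.dirDeriv hO (spaceDir j)).differentiableAt_of_isOpen hO hp
  unfold gradSq
  rw [dirDeriv_sum _ fun j _ => (d j).fun_mul (d j)]
  refine Finset.sum_congr rfl fun j _ => ?_
  rw [dirDeriv_mul (d j) (d j)]
  ring

lemma dirDeriv_dirDeriv_gradSq_ge (hO : IsOpen O) (hV : ContDiffOn ℝ ∞ V O) (hp : p ∈ O)
    (a : EuclideanSpace ℝ (Fin n) × ℝ) :
    ∑ j, 2 * (dirDeriv (spaceDir j) V p * dirDeriv a (dirDeriv a (dirDeriv (spaceDir j) V)) p)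
      ≤ dirDeriv a (dirDeriv a (gradSq V)) p := by
  have c := fun j => hV.dirDeriv hO (spaceDir j)
  unfold gradSq
  have d := fun j {q} (hq : q ∈ O) => (c j).differentiableAt_of_isOpen hO hq
  rw [dirDeriv_congr hO (fun q hq => dirDeriv_sum _ fun j _ => (d j hq).fun_mul (d j hq)) hp,
    dirDeriv_sum _ fun j _ =>
      ((((c j).mul (c j)).dirDeriv hO a).differentiableAt_of_isOpen hO hp)]
  refine Finset.sum_le_sum fun j _ => ?_
  rw [dirDeriv_dirDeriv_mul (a := a) hO (c j) (c j) hp]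
  nlinarith [mul_self_nonneg (dirDeriv a (dirDeriv (spaceDir j) V) p)]

/-- Bochner-type inequality for the squared gradient of a solution of
`∂ₜV = ΔV - (exp V - 1)|∇V|²`. -/
lemma gradSq_evolution (hO : IsOpen O) (hV : ContDiffOn ℝ ∞ V O)
    (hpde : ∀ p ∈ O, dirDeriv timeDir V p =
      ∑ i, dirDeriv (spaceDir i) (dirDeriv (spaceDir i) V) p
        - (Real.exp (V p) - 1) * gradSq V p) (hp : p ∈ O) :
    dirDeriv timeDir (gradSq V) p
        - ∑ i, dirDeriv (spaceDir i) (dirDeriv (spaceDir i) (gradSq V)) p ≤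
      -(2 * Real.exp (V p) * gradSq V p ^ 2)
        - 2 * (Real.exp (V p) - 1) *
          ∑ j, dirDeriv (spaceDir j) V p * dirDeriv (spaceDir j) (gradSq V) p := by
  have dV := hV.differentiableAt_of_isOpen hO hp
  have dw := (hV.gradSq hO).differentiableAt_of_isOpen hO hp
  have dE : DifferentiableAt ℝ (fun q => Real.exp (V q) - 1) p := dV.exp.sub_const 1
  have hE : ∀ a, dirDeriv a (fun q => Real.exp (V q) - 1) p
      = Real.exp (V p) * dirDeriv a V p := fun a =>
    dirDeriv_comp (φ := fun y => Real.exp y - 1) ((Real.hasDerivAt_exp (V p)).sub_const 1) dV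
  have c2 := fun i : Fin n => (hV.dirDeriv hO (spaceDir i)).dirDeriv hO (spaceDir i)
  have d2 := fun i : Fin n => (c2 i).differentiableAt_of_isOpen hO hp
  have hswap : ∀ i j : Fin n,
      dirDeriv (spaceDir j) (dirDeriv (spaceDir i) (dirDeriv (spaceDir i) V)) p =
        dirDeriv (spaceDir i) (dirDeriv (spaceDir i) (dirDeriv (spaceDir j) V)) p := by
    intro i j
    rw [dirDeriv_comm hO (hV.dirDeriv hO (spaceDir i)) hp]
    exact dirDeriv_congr hO (fun q hq => dirDeriv_comm hO hV hq) hp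
  have htime : ∀ j : Fin n, dirDeriv timeDir (dirDeriv (spaceDir j) V) p =
      ∑ i, dirDeriv (spaceDir i) (dirDeriv (spaceDir i) (dirDeriv (spaceDir j) V)) p
        - (Real.exp (V p) * dirDeriv (spaceDir j) V p * gradSq V p
          + (Real.exp (V p) - 1) * dirDeriv (spaceDir j) (gradSq V) p) := by
    intro j
    rw [dirDeriv_comm hO hV hp, dirDeriv_congr hO hpde hp,
      dirDeriv_sub (DifferentiableAt.fun_sum fun i _ => d2 i) (dE.fun_mul dw),
      dirDeriv_sum _ fun i _ => d2 i, dirDeriv_mul dE dw, hE]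
    congr 1
    exact Finset.sum_congr rfl fun i _ => hswap i j
  have hlap : ∑ j, 2 * (dirDeriv (spaceDir j) V p *
        ∑ i, dirDeriv (spaceDir i) (dirDeriv (spaceDir i) (dirDeriv (spaceDir j) V)) p) ≤
      ∑ i, dirDeriv (spaceDir i) (dirDeriv (spaceDir i) (gradSq V)) p := by
    refine le_trans (le_of_eq ?_)
      (Finset.sum_le_sum fun i _ => dirDeriv_dirDeriv_gradSq_ge hO hV hp (spaceDir i))
    rw [Finset.sum_comm]
    simp only [Finset.mul_sum]
  have hw : ∑ j, dirDeriv (spaceDir j) V p * dirDeriv (spaceDir j) V p = gradSq V p := rfl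
  have hsum : dirDeriv timeDir (gradSq V) p =
      ∑ j, 2 * (dirDeriv (spaceDir j) V p *
        ∑ i, dirDeriv (spaceDir i) (dirDeriv (spaceDir i) (dirDeriv (spaceDir j) V)) p)
      - 2 * Real.exp (V p) * gradSq V p *
        (∑ j, dirDeriv (spaceDir j) V p * dirDeriv (spaceDir j) V p)
      - 2 * (Real.exp (V p) - 1) *
          ∑ j, dirDeriv (spaceDir j) V p * dirDeriv (spaceDir j) (gradSq V) p := by
    rw [dirDeriv_gradSq hO hV hp, Finset.mul_sum _ _ (2 * Real.exp (V p) * gradSq V p),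
      Finset.mul_sum _ _ (2 * (Real.exp (V p) - 1)), ← Finset.sum_sub_distrib,
      ← Finset.sum_sub_distrib]
    refine Finset.sum_congr rfl fun j _ => ?_
    rw [htime]
    ring
  rw [hsum, hw]
  nlinarith [hlap]

end HeatEvolution

section Cutoff

variable {n : ℕ}

/-- Spatial cutoff profile `1 - |x - x₀|²/r²`, as a function on space-time. -/
noncomputable def paraboloid (x₀ : EuclideanSpace ℝ (Fin n)) (r : ℝ) :
    EuclideanSpace ℝ (Fin n) × ℝ → ℝ :=
  fun p => 1 - ‖p.1 - x₀‖ ^ 2 / r ^ 2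

/-- The affine function of time vanishing at `s₀` with slope `1/T`. -/
noncomputable def timeRamp (n : ℕ) (s₀ T : ℝ) : EuclideanSpace ℝ (Fin n) × ℝ → ℝ :=
  fun p => (p.2 - s₀) / T

/-- Space-time cutoff. -/
noncomputable def cutoff (x₀ : EuclideanSpace ℝ (Fin n)) (r s₀ T : ℝ) :
    EuclideanSpace ℝ (Fin n) × ℝ → ℝ :=
  fun p => paraboloid x₀ r p * paraboloid x₀ r p * timeRamp n s₀ T p

variable (x₀ : EuclideanSpace ℝ (Fin n)) (r s₀ T : ℝ) (p : EuclideanSpace ℝ (Fin n) × ℝ)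

lemma contDiff_paraboloid : ContDiff ℝ ∞ (paraboloid x₀ r) :=
  contDiff_const.sub (((contDiff_fst.sub contDiff_const).norm_sq ℝ).div_const _)

lemma contDiff_timeRamp : ContDiff ℝ ∞ (timeRamp n s₀ T) :=
  (contDiff_snd.sub contDiff_const).div_const _

lemma contDiff_cutoff : ContDiff ℝ ∞ (cutoff x₀ r s₀ T) :=
  ((contDiff_paraboloid x₀ r).mul (contDiff_paraboloid x₀ r)).mul (contDiff_timeRamp s₀ T)

lemma dirDeriv_paraboloid (a : EuclideanSpace ℝ (Fin n) × ℝ) :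
    dirDeriv a (paraboloid x₀ r) p = -2 * inner ℝ (p.1 - x₀) a.1 / r ^ 2 := by
  have h : HasFDerivAt (fun q : EuclideanSpace ℝ (Fin n) × ℝ => ‖q.1 - x₀‖ ^ 2) _ p :=
    (hasFDerivAt_fst.sub_const x₀).norm_sq
  have h2 := (h.mul_const (r ^ 2)⁻¹).const_sub 1
  unfold dirDeriv paraboloid
  simp only [div_eq_mul_inv]
  rw [h2.fderiv]
  simp [inner_sub_left]
  ring

lemma dirDeriv_space_paraboloid (i : Fin n) :
    dirDeriv (spaceDir i) (paraboloid x₀ r) p = -2 * (p.1 - x₀) i / r ^ 2 := by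
  rw [dirDeriv_paraboloid]
  simp [spaceDir, EuclideanSpace.inner_single_right]

lemma dirDeriv_time_paraboloid : dirDeriv timeDir (paraboloid x₀ r) p = 0 := by
  rw [dirDeriv_paraboloid]
  simp [timeDir]

lemma dirDeriv_dirDeriv_paraboloid (i : Fin n) :
    dirDeriv (spaceDir i) (dirDeriv (spaceDir i) (paraboloid x₀ r)) p = -2 / r ^ 2 := by
  have h : dirDeriv (spaceDir i) (paraboloid x₀ r) =
      fun q => (-2 / r ^ 2) * (q.1 i - x₀ i) := by
    funext q
    rw [dirDeriv_space_paraboloid]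
    simp
    ring
  have hd : HasFDerivAt (fun q : EuclideanSpace ℝ (Fin n) × ℝ => q.1 i)
      ((EuclideanSpace.proj i).comp (ContinuousLinearMap.fst ℝ _ ℝ)) p :=
    ((EuclideanSpace.proj (𝕜 := ℝ) i).comp
      (ContinuousLinearMap.fst ℝ (EuclideanSpace ℝ (Fin n)) ℝ)).hasFDerivAt
  have h2 := (hd.sub_const (x₀ i)).const_mul (-2 / r ^ 2)
  rw [h]
  unfold dirDeriv
  rw [h2.fderiv]
  simp [spaceDir]

lemma dirDeriv_timeRamp (a : EuclideanSpace ℝ (Fin n) × ℝ) :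
    dirDeriv a (timeRamp n s₀ T) p = a.2 / T := by
  have h := ((hasFDerivAt_snd (𝕜 := ℝ) (p := p)).sub_const s₀).mul_const T⁻¹
  unfold dirDeriv timeRamp
  simp only [div_eq_mul_inv]
  rw [h.fderiv]
  simp [mul_comm]

lemma dirDeriv_space_cutoff (i : Fin n) :
    dirDeriv (spaceDir i) (cutoff x₀ r s₀ T) p =
      2 * paraboloid x₀ r p * timeRamp n s₀ T p * dirDeriv (spaceDir i) (paraboloid x₀ r) p := by
  have d1 := (contDiff_paraboloid x₀ r).contDiffAt (x := p) |>.differentiableAt (by simp)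
  have d2 := (contDiff_timeRamp (n := n) s₀ T).contDiffAt (x := p) |>.differentiableAt (by simp)
  unfold cutoff
  rw [dirDeriv_mul (d1.fun_mul d1) d2, dirDeriv_mul d1 d1, dirDeriv_timeRamp]
  simp [spaceDir]
  ring

lemma dirDeriv_time_cutoff :
    dirDeriv timeDir (cutoff x₀ r s₀ T) p = paraboloid x₀ r p ^ 2 / T := by
  have d1 := (contDiff_paraboloid x₀ r).contDiffAt (x := p) |>.differentiableAt (by simp)
  have d2 := (contDiff_timeRamp (n := n) s₀ T).contDiffAt (x := p) |>.differentiableAt (by simp)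
  unfold cutoff
  rw [dirDeriv_mul (d1.fun_mul d1) d2, dirDeriv_mul d1 d1, dirDeriv_timeRamp,
    dirDeriv_time_paraboloid]
  simp [timeDir]
  ring

lemma dirDeriv_dirDeriv_cutoff (i : Fin n) :
    dirDeriv (spaceDir i) (dirDeriv (spaceDir i) (cutoff x₀ r s₀ T)) p =
      timeRamp n s₀ T p * (2 * dirDeriv (spaceDir i) (paraboloid x₀ r) p ^ 2 -
        4 * paraboloid x₀ r p / r ^ 2) := by
  have c1 := (contDiff_paraboloid x₀ r).contDiffOn (s := univ)
  have c2 := (contDiff_timeRamp (n := n) s₀ T).contDiffOn (s := univ)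
  have h0 : dirDeriv (spaceDir i) (timeRamp n s₀ T) = fun _ => 0 := by
    funext q
    simp [dirDeriv_timeRamp, spaceDir]
  have h1 : dirDeriv (spaceDir i) (fun _ => (0 : ℝ)) p = 0 := by simp [dirDeriv]
  unfold cutoff
  rw [dirDeriv_dirDeriv_mul isOpen_univ (c1.mul c1) c2 (mem_univ p),
    dirDeriv_dirDeriv_mul isOpen_univ c1 c1 (mem_univ p), h0, h1,
    dirDeriv_dirDeriv_paraboloid]
  ring

lemma sum_sq_dirDeriv_paraboloid :
    ∑ i, dirDeriv (spaceDir i) (paraboloid x₀ r) p ^ 2 = 4 * ‖p.1 - x₀‖ ^ 2 / r ^ 4 := by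
  simp only [dirDeriv_space_paraboloid]
  rw [EuclideanSpace.norm_sq_eq, Finset.mul_sum, Finset.sum_div]
  refine Finset.sum_congr rfl fun i _ => ?_
  rw [Real.norm_eq_abs, sq_abs]
  ring

end Cutoff

section MaximumPrinciple

variable {n : ℕ} {O : Set (EuclideanSpace ℝ (Fin n) × ℝ)}
  {V : EuclideanSpace ℝ (Fin n) × ℝ → ℝ} {p : EuclideanSpace ℝ (Fin n) × ℝ}
  {x₀ : EuclideanSpace ℝ (Fin n)} {r s₀ T : ℝ}

/-- Bound for the localized squared gradient at a point where the first and second order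
conditions for a maximum hold. -/
lemma cutoff_mul_gradSq_le_of_critical (hr : 0 < r) (hT : 0 < T)
    (hO : IsOpen O) (hV : ContDiffOn ℝ ∞ V O)
    (hV0 : ∀ p ∈ O, 0 ≤ V p)
    (hpde : ∀ p ∈ O, dirDeriv timeDir V p =
      ∑ i, dirDeriv (spaceDir i) (dirDeriv (spaceDir i) V) p
        - (Real.exp (V p) - 1) * gradSq V p) (hp : p ∈ O)
    (hρ : 0 < paraboloid x₀ r p) (hτ : 0 < timeRamp n s₀ T p) (hτ1 : timeRamp n s₀ T p ≤ 1)
    (hw : 0 < gradSq V p)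
    (htime : 0 ≤ dirDeriv timeDir (fun q => cutoff x₀ r s₀ T q * gradSq V q) p)
    (hspace : ∀ i, dirDeriv (spaceDir i) (fun q => cutoff x₀ r s₀ T q * gradSq V q) p = 0 ∧
      dirDeriv (spaceDir i)
        (dirDeriv (spaceDir i) (fun q => cutoff x₀ r s₀ T q * gradSq V q)) p ≤ 0) :
    cutoff x₀ r s₀ T p * gradSq V p ≤ (4 * n + 40) / r ^ 2 + 1 / T := by
  have cη := (contDiff_cutoff x₀ r s₀ T).contDiffOn (s := O)
  have cw := hV.gradSq hO
  have dη := cη.differentiableAt_of_isOpen hO hp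
  have dw := cw.differentiableAt_of_isOpen hO hp
  have hev := gradSq_evolution hO hV hpde hp
  have hE : 1 ≤ Real.exp (V p) := Real.one_le_exp (hV0 p hp)
  rw [dirDeriv_mul dη dw, dirDeriv_time_cutoff] at htime
  have hcrit : ∀ i, paraboloid x₀ r p * dirDeriv (spaceDir i) (gradSq V) p =
      -2 * dirDeriv (spaceDir i) (paraboloid x₀ r) p * gradSq V p := by
    intro i
    have h := (hspace i).1
    rw [dirDeriv_mul dη dw, dirDeriv_space_cutoff] at h
    unfold cutoff at h
    have h' : (paraboloid x₀ r p * timeRamp n s₀ T p) *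
        (paraboloid x₀ r p * dirDeriv (spaceDir i) (gradSq V) p +
        2 * dirDeriv (spaceDir i) (paraboloid x₀ r) p * gradSq V p) = 0 := by linarith
    rcases mul_eq_zero.1 h' with h0 | h0
    · exact absurd h0 (mul_pos hρ hτ).ne'
    · linarith
  have hlap : ∑ i, (timeRamp n s₀ T p * (-6 * dirDeriv (spaceDir i) (paraboloid x₀ r) p ^ 2 -
        4 * paraboloid x₀ r p / r ^ 2) * gradSq V p + cutoff x₀ r s₀ T p *
          dirDeriv (spaceDir i) (dirDeriv (spaceDir i) (gradSq V)) p) ≤ 0 := by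
    refine Finset.sum_nonpos fun i _ => ?_
    have h := (hspace i).2
    rw [dirDeriv_dirDeriv_mul hO cη cw hp, dirDeriv_dirDeriv_cutoff, dirDeriv_space_cutoff] at h
    have h2 : 2 * paraboloid x₀ r p * timeRamp n s₀ T p *
        dirDeriv (spaceDir i) (paraboloid x₀ r) p * dirDeriv (spaceDir i) (gradSq V) p =
        2 * timeRamp n s₀ T p * dirDeriv (spaceDir i) (paraboloid x₀ r) p *
        (paraboloid x₀ r p * dirDeriv (spaceDir i) (gradSq V) p) := by ring
    rw [h2, hcrit i] at h
    linarith
  set ρ := paraboloid x₀ r p with hρdef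
  set τ := timeRamp n s₀ T p with hτdef
  set w := gradSq V p with hwdef
  set E := Real.exp (V p) with hEdef
  have hη : cutoff x₀ r s₀ T p = ρ * ρ * τ := rfl
  set S := ∑ i, dirDeriv (spaceDir i) (paraboloid x₀ r) p ^ 2 with hS
  have hρ1 : ρ ≤ 1 := by
    rw [hρdef]; unfold paraboloid; linarith [show 0 ≤ ‖p.1 - x₀‖ ^ 2 / r ^ 2 by positivity]
  have hS0 : 0 ≤ S := Finset.sum_nonneg fun _ _ => sq_nonneg _
  have hS4 : S ≤ 4 / r ^ 2 := by
    rw [hS, sum_sq_dirDeriv_paraboloid]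
    have h1 : ‖p.1 - x₀‖ ^ 2 / r ^ 2 ≤ 1 := by
      rw [hρdef] at hρ; unfold paraboloid at hρ; linarith
    calc 4 * ‖p.1 - x₀‖ ^ 2 / r ^ 4 = 4 / r ^ 2 * (‖p.1 - x₀‖ ^ 2 / r ^ 2) := by
          field_simp
      _ ≤ 4 / r ^ 2 := mul_le_of_le_one_right (by positivity) h1
  -- the mixed term, rewritten with the first order condition and split by Young's inequality
  have hmixed : -(ρ * ∑ j, dirDeriv (spaceDir j) V p * dirDeriv (spaceDir j) (gradSq V) p) * (2 * ρ)
      ≤ w * (ρ * ρ * w + 4 * S) := by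
    have e1 : -(ρ * ∑ j, dirDeriv (spaceDir j) V p * dirDeriv (spaceDir j) (gradSq V) p) * (2 * ρ)
        = ∑ j, w * (4 * ρ * dirDeriv (spaceDir j) V p *
          dirDeriv (spaceDir j) (paraboloid x₀ r) p) := by
      rw [Finset.mul_sum, ← Finset.sum_neg_distrib, Finset.sum_mul]
      refine Finset.sum_congr rfl fun j _ => ?_
      linear_combination (-2 * ρ * dirDeriv (spaceDir j) V p) * hcrit j
    have e2 : w * (ρ * ρ * w + 4 * S) = ∑ j, w * (ρ * ρ *
        (dirDeriv (spaceDir j) V p * dirDeriv (spaceDir j) V p) +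
          4 * dirDeriv (spaceDir j) (paraboloid x₀ r) p ^ 2) := by
      rw [← Finset.mul_sum, Finset.sum_add_distrib, ← Finset.mul_sum, ← Finset.mul_sum]
      rfl
    rw [e1, e2]
    refine Finset.sum_le_sum fun j _ => mul_le_mul_of_nonneg_left ?_ hw.le
    nlinarith [sq_nonneg (ρ * dirDeriv (spaceDir j) V p -
      2 * dirDeriv (spaceDir j) (paraboloid x₀ r) p)]
  have hlap' : τ * (-6 * S - 4 * n * ρ / r ^ 2) * w + ρ * ρ * τ *
      ∑ i, dirDeriv (spaceDir i) (dirDeriv (spaceDir i) (gradSq V)) p ≤ 0 := by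
    convert hlap using 1
    rw [Finset.sum_add_distrib, ← Finset.mul_sum, ← Finset.sum_mul, ← Finset.mul_sum,
      Finset.sum_sub_distrib, ← Finset.mul_sum, hη]
    simp
    left; left; ring
  have hητ : 0 < ρ * ρ * τ := by positivity
  have hev' := mul_le_mul_of_nonneg_left hev hητ.le
  have hmixed' := mul_le_mul_of_nonneg_left hmixed
    (mul_nonneg (sub_nonneg.2 hE) hτ.le)
  rw [hη] at htime ⊢
  have key : 0 ≤ w * (ρ ^ 2 / T + τ * (6 * S + 4 * n * ρ / r ^ 2) - 2 * E * (ρ * ρ * τ * w)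
      + (E - 1) * τ * (ρ * ρ * w + 4 * S)) := by
    linarith
  have key' := nonneg_of_mul_nonneg_right key hw
  have b1 : ρ ^ 2 / T ≤ 1 / T := by
    gcongr
    nlinarith
  have b2 : τ * S ≤ 4 / r ^ 2 := (mul_le_of_le_one_left hS0 hτ1).trans hS4
  have b3 : τ * (4 * n * ρ / r ^ 2) ≤ 4 * n / r ^ 2 := by
    refine (mul_le_of_le_one_left (by positivity) hτ1).trans ?_
    exact div_le_div_of_nonneg_right (mul_le_of_le_one_right (by positivity) hρ1) (by positivity)
  have b4 : (E - 1) * (τ * S) ≤ (E - 1) * (4 / r ^ 2) :=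
    mul_le_mul_of_nonneg_left b2 (sub_nonneg.2 hE)
  have i1 : 0 ≤ 1 / T := by positivity
  have i2 : 0 ≤ 4 * n / r ^ 2 := by positivity
  have i3 : 0 ≤ 4 / r ^ 2 := by positivity
  have e : (4 * n + 40) / r ^ 2 = 4 * n / r ^ 2 + 10 * (4 / r ^ 2) := by ring
  rw [e]
  have h1 : (E + 1) * (ρ * ρ * τ * w) ≤
      1 / T + 4 * n / r ^ 2 + 6 * (4 / r ^ 2) + 4 * ((E - 1) * (4 / r ^ 2)) := by
    linarith
  have h2 : (E + 1) * (ρ * ρ * τ * w) ≤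
      (E + 1) * (4 * n / r ^ 2 + 10 * (4 / r ^ 2) + 1 / T) := by
    have := mul_nonneg (by linarith : 0 ≤ E) i1
    have := mul_nonneg (by linarith : 0 ≤ E) i2
    have := mul_nonneg (by linarith : 0 ≤ E) i3
    linarith
  exact le_of_mul_le_mul_left h2 (by linarith)

/-- Localized gradient bound for nonnegative solutions of `∂ₜV = ΔV - (exp V - 1)|∇V|²`. -/
theorem cutoff_mul_gradSq_le {t₁ : ℝ} (hr : 0 < r) (hT : 0 < T) (ht₁ : t₁ ≤ s₀ + T)
    (hO : IsOpen O) (hsub : closedBall x₀ r ×ˢ Icc s₀ t₁ ⊆ O) (hV : ContDiffOn ℝ ∞ V O)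
    (hV0 : ∀ p ∈ O, 0 ≤ V p)
    (hpde : ∀ p ∈ O, dirDeriv timeDir V p =
      ∑ i, dirDeriv (spaceDir i) (dirDeriv (spaceDir i) V) p
        - (Real.exp (V p) - 1) * gradSq V p) (hp : p ∈ closedBall x₀ r ×ˢ Icc s₀ t₁) :
    cutoff x₀ r s₀ T p * gradSq V p ≤ (4 * n + 40) / r ^ 2 + 1 / T := by
  set Q := closedBall x₀ r ×ˢ Icc s₀ t₁
  have hQc : IsCompact Q := (isCompact_closedBall x₀ r).prod isCompact_Icc
  have cG : ContDiffOn ℝ ∞ (fun q => cutoff x₀ r s₀ T q * gradSq V q) O :=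
    (contDiff_cutoff x₀ r s₀ T).contDiffOn.mul (hV.gradSq hO)
  obtain ⟨q, hq, hmax⟩ := hQc.exists_isMaxOn ⟨p, hp⟩ (cG.continuousOn.mono hsub)
  refine (hmax hp).trans ?_
  simp only
  rcases le_or_gt (cutoff x₀ r s₀ T q * gradSq V q) 0 with hle | hpos
  · exact hle.trans (by positivity)
  obtain ⟨hqx, hqs, hqt⟩ := hq
  have hqx' : ‖q.1 - x₀‖ ≤ r := by simpa [dist_eq_norm] using hqx
  have hw0 : 0 ≤ gradSq V q := gradSq_nonneg
  have hw : 0 < gradSq V q := hw0.lt_of_ne fun h => by simp [← h] at hpos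
  have hη : 0 < cutoff x₀ r s₀ T q := pos_of_mul_pos_left hpos hw0
  have hτ0 : 0 ≤ timeRamp n s₀ T q := div_nonneg (by linarith) hT.le
  have hτ : 0 < timeRamp n s₀ T q := hτ0.lt_of_ne fun h => by
    simp [cutoff, ← h] at hη
  have hs : s₀ < q.2 := by
    unfold timeRamp at hτ
    have := (div_pos_iff_of_pos_right hT).1 hτ
    linarith
  have hτ1 : timeRamp n s₀ T q ≤ 1 := (div_le_one hT).2 (by linarith)
  have hρ0 : 0 ≤ paraboloid x₀ r q := by
    unfold paraboloid
    rw [sub_nonneg, div_le_one (by positivity)]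
    gcongr
  have hρ : 0 < paraboloid x₀ r q := hρ0.lt_of_ne fun h => by
    simp [cutoff, ← h] at hη
  have hlt : ‖q.1 - x₀‖ < r := by
    unfold paraboloid at hρ
    rw [sub_pos, div_lt_one (by positivity)] at hρ
    exact lt_of_pow_lt_pow_left₀ 2 hr.le hρ
  have hqO : q ∈ O := hsub ⟨hqx, hqs, hqt⟩
  refine cutoff_mul_gradSq_le_of_critical hr hT hO hV hV0 hpde hqO hρ hτ hτ1 hw ?_ ?_
  · have hcone : ((0, s₀ - q.2) : EuclideanSpace ℝ (Fin n) × ℝ) ∈ posTangentConeAt Q q := by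
      refine mem_posTangentConeAt_of_segment_subset ?_
      refine Convex.segment_subset ((convex_closedBall x₀ r).prod (convex_Icc s₀ t₁))
        ⟨hqx, hqs, hqt⟩ ⟨by simpa using hqx, ?_⟩
      simp only [Prod.snd_add, add_sub_cancel, mem_Icc, le_refl, true_and]
      linarith
    have hder := ((cG.differentiableAt_of_isOpen hO hqO).hasFDerivAt.hasFDerivWithinAt (s := Q))
    have h := hmax.localize.hasFDerivWithinAt_nonpos hder hcone
    have e : ((0, s₀ - q.2) : EuclideanSpace ℝ (Fin n) × ℝ) = (s₀ - q.2) • timeDir := by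
      simp [timeDir]
    rw [e, map_smul, smul_eq_mul] at h
    exact nonneg_of_mul_nonpos_right h (by linarith)
  · intro i
    refine dirDeriv_of_isLocalMax_line hO cG hqO ?_
    have hcont : Continuous (fun s : ℝ => (q + s • spaceDir i).1) := by fun_prop
    have hnear : ∀ᶠ s in nhds (0 : ℝ), (q + s • spaceDir i).1 ∈ ball x₀ r :=
      hcont.continuousAt.eventually_mem (isOpen_ball.mem_nhds (by
        simpa [dist_eq_norm] using hlt))
    filter_upwards [hnear] with s hs
    have hmem : q + s • spaceDir i ∈ Q :=
      ⟨ball_subset_closedBall hs, by simpa [spaceDir] using ⟨hqs, hqt⟩⟩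
    simpa using hmax hmem

end MaximumPrinciple

section LogTransform

variable {n : ℕ} {O : Set (EuclideanSpace ℝ (Fin n) × ℝ)}
  {U : EuclideanSpace ℝ (Fin n) × ℝ → ℝ} {p : EuclideanSpace ℝ (Fin n) × ℝ} {M : ℝ}

/-- The transformation `log (1 + log (M / U))`. -/
noncomputable def logTransform (M : ℝ) (U : EuclideanSpace ℝ (Fin n) × ℝ → ℝ) :
    EuclideanSpace ℝ (Fin n) × ℝ → ℝ :=
  fun q => Real.log (1 + (Real.log M - Real.log (U q)))

lemma one_le_one_add_log_sub {y : ℝ} (hy : 0 < y) (hyM : y ≤ M) :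
    1 ≤ 1 + (Real.log M - Real.log y) := by
  linarith [Real.log_le_log hy hyM]

lemma hasDerivAt_log_one_add_log_sub {y : ℝ} (hy : 0 < y) (hyM : y ≤ M) :
    HasDerivAt (fun y => Real.log (1 + (Real.log M - Real.log y)))
      (-(y * (1 + (Real.log M - Real.log y)))⁻¹) y := by
  have h1 := one_le_one_add_log_sub hy hyM
  have h := (((Real.hasDerivAt_log hy.ne').const_sub (Real.log M)).const_add 1).log
    (by linarith)
  convert h using 1
  field_simp

lemma hasDerivAt_deriv_log_one_add_log_sub {y : ℝ} (hy : 0 < y) (hyM : y ≤ M) :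
    HasDerivAt (fun y => -(y * (1 + (Real.log M - Real.log y)))⁻¹)
      ((Real.log M - Real.log y) / (y * (1 + (Real.log M - Real.log y))) ^ 2) y := by
  have h1 := one_le_one_add_log_sub hy hyM
  have h0 : y * (1 + (Real.log M - Real.log y)) ≠ 0 := by positivity
  have h := (((hasDerivAt_id' y).fun_mul
    (((Real.hasDerivAt_log hy.ne').const_sub (Real.log M)).const_add 1)).fun_inv h0).fun_neg
  refine h.congr_deriv ?_
  rw [mul_neg, mul_inv_cancel₀ hy.ne']
  ring

lemma contDiffOn_logTransform (hU : ContDiffOn ℝ ∞ U O) (hpos : ∀ p ∈ O, 0 < U p ∧ U p ≤ M) :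
    ContDiffOn ℝ ∞ (logTransform M U) O := by
  refine ContDiffOn.log (contDiffOn_const.add (contDiffOn_const.sub
    (hU.log fun q hq => (hpos q hq).1.ne'))) fun q hq => ?_
  have := one_le_one_add_log_sub (hpos q hq).1 (hpos q hq).2
  linarith

lemma exp_logTransform (hpos : ∀ p ∈ O, 0 < U p ∧ U p ≤ M) (hp : p ∈ O) :
    Real.exp (logTransform M U p) = 1 + (Real.log M - Real.log (U p)) := by
  have := one_le_one_add_log_sub (hpos p hp).1 (hpos p hp).2
  exact Real.exp_log (by linarith)

lemma dirDeriv_logTransform (hO : IsOpen O) (hU : ContDiffOn ℝ ∞ U O)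
    (hpos : ∀ p ∈ O, 0 < U p ∧ U p ≤ M) (hp : p ∈ O) (a : EuclideanSpace ℝ (Fin n) × ℝ) :
    dirDeriv a (logTransform M U) p =
      -(U p * (1 + (Real.log M - Real.log (U p))))⁻¹ * dirDeriv a U p :=
  dirDeriv_comp (hasDerivAt_log_one_add_log_sub (hpos p hp).1 (hpos p hp).2)
    (hU.differentiableAt_of_isOpen hO hp)

lemma gradSq_logTransform (hO : IsOpen O) (hU : ContDiffOn ℝ ∞ U O)
    (hpos : ∀ p ∈ O, 0 < U p ∧ U p ≤ M) (hp : p ∈ O) :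
    gradSq (logTransform M U) p =
      gradSq U p / (U p * (1 + (Real.log M - Real.log (U p)))) ^ 2 := by
  unfold gradSq
  rw [Finset.sum_div]
  refine Finset.sum_congr rfl fun j _ => ?_
  rw [dirDeriv_logTransform hO hU hpos hp, div_eq_mul_inv, ← inv_pow]
  ring

lemma dirDeriv_dirDeriv_logTransform (hO : IsOpen O) (hU : ContDiffOn ℝ ∞ U O)
    (hpos : ∀ p ∈ O, 0 < U p ∧ U p ≤ M) (hp : p ∈ O) (a : EuclideanSpace ℝ (Fin n) × ℝ) :
    dirDeriv a (dirDeriv a (logTransform M U)) p =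
      (Real.log M - Real.log (U p)) / (U p * (1 + (Real.log M - Real.log (U p)))) ^ 2 *
        (dirDeriv a U p * dirDeriv a U p) -
      (U p * (1 + (Real.log M - Real.log (U p))))⁻¹ * dirDeriv a (dirDeriv a U) p := by
  have dU := hU.differentiableAt_of_isOpen hO hp
  have hφ := hasDerivAt_deriv_log_one_add_log_sub (hpos p hp).1 (hpos p hp).2
  rw [dirDeriv_congr hO (fun q hq => dirDeriv_logTransform hO hU hpos hq a) hp,
    dirDeriv_mul (F := fun q => -(U q * (1 + (Real.log M - Real.log (U q))))⁻¹)
      (hφ.differentiableAt.comp p dU)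
      ((hU.dirDeriv hO a).differentiableAt_of_isOpen hO hp),
    dirDeriv_comp hφ dU]
  ring

/-- If `U` solves the heat equation, then `V = log (1 + log (M / U))` solves
`∂ₜV = ΔV - (exp V - 1)|∇V|²`. -/
lemma logTransform_pde (hO : IsOpen O) (hU : ContDiffOn ℝ ∞ U O)
    (hpos : ∀ p ∈ O, 0 < U p ∧ U p ≤ M)
    (hheat : ∀ p ∈ O, dirDeriv timeDir U p =
      ∑ i, dirDeriv (spaceDir i) (dirDeriv (spaceDir i) U) p) (hp : p ∈ O) :
    dirDeriv timeDir (logTransform M U) p =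
      ∑ i, dirDeriv (spaceDir i) (dirDeriv (spaceDir i) (logTransform M U)) p
        - (Real.exp (logTransform M U p) - 1) * gradSq (logTransform M U) p := by
  rw [exp_logTransform hpos hp, gradSq_logTransform hO hU hpos hp,
    dirDeriv_logTransform hO hU hpos hp, hheat p hp]
  simp only [dirDeriv_dirDeriv_logTransform hO hU hpos hp]
  rw [Finset.sum_sub_distrib, ← Finset.mul_sum, ← Finset.mul_sum]
  unfold gradSq
  ring

end LogTransform

section HeatSolution

variable {n : ℕ} {O : Set (EuclideanSpace ℝ (Fin n) × ℝ)}
  {u : EuclideanSpace ℝ (Fin n) → ℝ → ℝ} {x : EuclideanSpace ℝ (Fin n)} {t : ℝ}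

lemma fderiv_slice {U : EuclideanSpace ℝ (Fin n) × ℝ → ℝ} (h : DifferentiableAt ℝ U (x, t))
    (v : EuclideanSpace ℝ (Fin n)) :
    fderiv ℝ (fun y => U (y, t)) x v = dirDeriv (v, 0) U (x, t) := by
  have h1 : HasFDerivAt (fun y => U (y, t)) _ x :=
    h.hasFDerivAt.comp x (hasFDerivAt_prodMk_left x t)
  rw [h1.fderiv]
  simp [dirDeriv]

lemma deriv_slice {U : EuclideanSpace ℝ (Fin n) × ℝ → ℝ} (h : DifferentiableAt ℝ U (x, t)) :
    deriv (fun s => U (x, s)) t = dirDeriv timeDir U (x, t) := by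
  have h1 : HasDerivAt (fun s => U (x, s)) (fderiv ℝ U (x, t) (0, 1)) t :=
    h.hasFDerivAt.comp_hasDerivAt t ((hasDerivAt_const t x).prodMk (hasDerivAt_id t))
  exact h1.deriv

lemma slap_slice {U : EuclideanSpace ℝ (Fin n) × ℝ → ℝ} (hO : IsOpen O)
    (hU : ContDiffOn ℝ ∞ U O) (hp : (x, t) ∈ O) :
    slap (fun y => U (y, t)) x =
      ∑ i, dirDeriv (spaceDir i) (dirDeriv (spaceDir i) U) (x, t) := by
  refine Finset.sum_congr rfl fun i _ => ?_
  have hnear : ∀ᶠ y in nhds x, (y, t) ∈ O :=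
    (Continuous.prodMk_left t).continuousAt.eventually_mem (hO.mem_nhds hp)
  have he : (fun y => fderiv ℝ (fun z => U (z, t)) y (EuclideanSpace.single i 1)) =ᶠ[nhds x]
      fun y => dirDeriv (spaceDir i) U (y, t) := by
    filter_upwards [hnear] with y hy
    exact fderiv_slice (hU.differentiableAt_of_isOpen hO hy) _
  rw [he.fderiv_eq]
  exact fderiv_slice ((hU.dirDeriv hO _).differentiableAt_of_isOpen hO hp) _

lemma norm_sq_sgrad (f : EuclideanSpace ℝ (Fin n) → ℝ) (x : EuclideanSpace ℝ (Fin n)) :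
    ‖sgrad f x‖ ^ 2 = ∑ i, fderiv ℝ f x (EuclideanSpace.single i 1) ^ 2 := by
  rw [EuclideanSpace.norm_sq_eq]
  refine Finset.sum_congr rfl fun i _ => ?_
  rw [Real.norm_eq_abs, sq_abs]
  congr 1
  have : inner ℝ (sgrad f x) (EuclideanSpace.single i 1) =
      fderiv ℝ f x (EuclideanSpace.single i 1) := by
    simp [sgrad, gradient]
  rw [← this, EuclideanSpace.inner_single_right]
  simp

lemma norm_sgrad (f : EuclideanSpace ℝ (Fin n) → ℝ) (x : EuclideanSpace ℝ (Fin n)) :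
    ‖sgrad f x‖ = ‖fderiv ℝ f x‖ :=
  LinearIsometryEquiv.norm_map _ _

lemma norm_sq_sgrad_slice {U : EuclideanSpace ℝ (Fin n) × ℝ → ℝ}
    (h : DifferentiableAt ℝ U (x, t)) :
    ‖sgrad (fun y => U (y, t)) x‖ ^ 2 = gradSq U (x, t) := by
  rw [norm_sq_sgrad]
  refine Finset.sum_congr rfl fun i _ => ?_
  rw [fderiv_slice h, sq]
  rfl

variable {x₀ : EuclideanSpace ℝ (Fin n)} {t₀ R T M : ℝ}

lemma one_div_le_cutoff (hR : 0 < R) (hT : 0 < T)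
    (hx : x ∈ closedBall x₀ (R / 2)) (ht : t₀ - T / 2 ≤ t) :
    1 / 13 ≤ cutoff x₀ (3 * R / 4) (t₀ - 3 * T / 4) T (x, t) := by
  have hρ : 5 / 9 ≤ paraboloid x₀ (3 * R / 4) (x, t) := by
    have hx' : ‖x - x₀‖ ≤ R / 2 := by simpa [dist_eq_norm] using hx
    have : ‖x - x₀‖ ^ 2 / (3 * R / 4) ^ 2 ≤ 4 / 9 := by
      rw [div_le_iff₀ (by positivity)]
      nlinarith [norm_nonneg (x - x₀)]
    simp only [paraboloid]
    linarith
  have hτ : 1 / 4 ≤ timeRamp n (t₀ - 3 * T / 4) T (x, t) := by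
    simp only [timeRamp]
    rw [le_div_iff₀ hT]
    linarith
  unfold cutoff
  calc (1 / 13 : ℝ) ≤ 5 / 9 * (5 / 9) * (1 / 4) := by norm_num
    _ ≤ _ := by gcongr

lemma le_sq_of_cutoff_bound {w : ℝ} (hR : 0 < R) (hT : 0 < T)
    (h1 : 1 / 13 * w ≤ (4 * n + 40) / (3 * R / 4) ^ 2 + 1 / T) :
    w ≤ (13 * (8 * n + 80) * (1 / R + 1 / Real.sqrt T)) ^ 2 := by
  have hn : (0 : ℝ) ≤ n := n.cast_nonneg
  have hT' : 0 < Real.sqrt T := Real.sqrt_pos.2 hT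
  have hK : 1 / R ^ 2 + 1 / T ≤ (1 / R + 1 / Real.sqrt T) ^ 2 := by
    have e : (1 / R + 1 / Real.sqrt T) ^ 2 =
        1 / R ^ 2 + 1 / Real.sqrt T ^ 2 + 2 * (1 / R * (1 / Real.sqrt T)) := by ring
    rw [e, Real.sq_sqrt hT.le]
    have : 0 ≤ 1 / R * (1 / Real.sqrt T) := by positivity
    linarith
  have h2 : (4 * n + 40) / (3 * R / 4) ^ 2 ≤ (8 * n + 80) * (1 / R ^ 2) := by
    rw [show (4 * (n : ℝ) + 40) / (3 * R / 4) ^ 2 = (16 / 9) * (4 * n + 40) * (1 / R ^ 2) by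
      field_simp; norm_num]
    gcongr
    linarith
  have h3 : 1 / T ≤ (8 * n + 80) * (1 / T) :=
    le_mul_of_one_le_left (by positivity) (by linarith)
  have h4 : w ≤ 13 * (8 * n + 80) * (1 / R ^ 2 + 1 / T) := by linarith
  rw [mul_pow]
  refine h4.trans (mul_le_mul ?_ hK (by positivity) (by positivity))
  exact le_self_pow₀ (by linarith) (by norm_num)

/-- The gradient estimate strictly before the final time. -/
lemma sharp_gradient_estimate_of_lt (hR : 0 < R) (hT : 0 < T)
    (hu : IsHeatSolutionOn u (closedBall x₀ R ×ˢ Icc (t₀ - T) t₀))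
    (hpos : ∀ p ∈ closedBall x₀ R ×ˢ Icc (t₀ - T) t₀, 0 < u p.1 p.2 ∧ u p.1 p.2 ≤ M)
    (hx : x ∈ closedBall x₀ (R / 2)) (ht : t₀ - T / 2 ≤ t) (htt : t < t₀) :
    ‖sgrad (fun y => u y t) x‖ / u x t ≤
      (13 * (8 * n + 80)) * (1 / R + 1 / Real.sqrt T) * (1 + Real.log (M / u x t)) := by
  obtain ⟨U, hUdef⟩ : ∃ U : EuclideanSpace ℝ (Fin n) × ℝ → ℝ, U = fun p => u p.1 p.2 := ⟨_, rfl⟩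
  obtain ⟨O, hOdef⟩ : ∃ O : Set (EuclideanSpace ℝ (Fin n) × ℝ),
    O = ball x₀ R ×ˢ Ioo (t₀ - T) t₀ := ⟨_, rfl⟩
  have hUu : ∀ y s, u y s = U (y, s) := fun y s => by rw [hUdef]
  have hO : IsOpen O := hOdef ▸ isOpen_ball.prod isOpen_Ioo
  have hOQ : O ⊆ closedBall x₀ R ×ˢ Icc (t₀ - T) t₀ :=
    hOdef ▸ prod_mono ball_subset_closedBall Ioo_subset_Icc_self
  have hU : ContDiffOn ℝ ∞ U O := hUdef ▸ hu.1.mono hOQ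
  have hposO : ∀ p ∈ O, 0 < U p ∧ U p ≤ M := fun p hp => hUdef ▸ hpos p (hOQ hp)
  have hheat : ∀ p ∈ O, dirDeriv timeDir U p =
      ∑ i, dirDeriv (spaceDir i) (dirDeriv (spaceDir i) U) p := by
    rintro ⟨y, s⟩ hp
    rw [← slap_slice hO hU hp, ← deriv_slice (hU.differentiableAt_of_isOpen hO hp)]
    simpa only [hUu] using hu.2 _ (hOQ hp)
  have hsub : closedBall x₀ (3 * R / 4) ×ˢ Icc (t₀ - 3 * T / 4) t ⊆ O := by
    rw [hOdef]
    refine prod_mono (closedBall_subset_ball (by linarith)) fun s hs => ⟨?_, ?_⟩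
    · linarith [hs.1]
    · linarith [hs.2]
  have hxQ : (x, t) ∈ closedBall x₀ (3 * R / 4) ×ˢ Icc (t₀ - 3 * T / 4) t :=
    ⟨closedBall_subset_closedBall (by linarith) hx, by linarith, le_refl _⟩
  have hxO := hsub hxQ
  have hV0 : ∀ p ∈ O, 0 ≤ logTransform M U p := fun p hp =>
    Real.log_nonneg (one_le_one_add_log_sub (hposO p hp).1 (hposO p hp).2)
  have hmain := cutoff_mul_gradSq_le (T := T) (by linarith) hT (by linarith) hO hsub
    (contDiffOn_logTransform hU hposO) hV0 (fun p hp => logTransform_pde hO hU hposO hheat hp) hxQ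
  have hwle := le_sq_of_cutoff_bound hR hT
    ((mul_le_mul_of_nonneg_right (one_div_le_cutoff hR hT hx ht) gradSq_nonneg).trans hmain)
  obtain ⟨hu0, huM⟩ := hposO _ hxO
  have hh := one_le_one_add_log_sub hu0 huM
  have hh0 : 0 < 1 + (Real.log M - Real.log (U (x, t))) := by linarith
  have hgrad := norm_sq_sgrad_slice (hU.differentiableAt_of_isOpen hO hxO)
  simp only [hUu]
  rw [Real.log_div (hu0.trans_le huM).ne' hu0.ne']
  rw [gradSq_logTransform hO hU hposO hxO, ← hgrad, ← div_pow] at hwle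
  have hle := (pow_le_pow_iff_left₀ (by positivity) (by positivity) two_ne_zero).1 hwle
  rwa [← div_div, div_le_iff₀ hh0] at hle

/-- The spatial gradient of a smooth function on a cylinder is continuous in time up to the
final time. -/
lemma continuousOn_norm_sgrad (hR : 0 < R) (hT : 0 < T)
    (hu : ContDiffOn ℝ ∞ (fun p : EuclideanSpace ℝ (Fin n) × ℝ => u p.1 p.2)
      (closedBall x₀ R ×ˢ Icc (t₀ - T) t₀)) (hx : x ∈ ball x₀ R) :
    ContinuousOn (fun t => ‖sgrad (fun y => u y t) x‖) (Icc (t₀ - T) t₀) := by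
  set U : EuclideanSpace ℝ (Fin n) × ℝ → ℝ := fun p => u p.1 p.2 with hUdef
  set Q := closedBall x₀ R ×ˢ Icc (t₀ - T) t₀
  have hQ : UniqueDiffOn ℝ Q := by
    refine uniqueDiffOn_convex ((convex_closedBall x₀ R).prod (convex_Icc _ _)) ?_
    rw [interior_prod_eq, interior_Icc]
    exact ⟨(x₀, t₀ - T / 2), ball_subset_interior_closedBall (mem_ball_self hR),
      by linarith, by linarith⟩
  have hcont := hu.continuousOn_fderivWithin hQ (by simp)
  have hmaps : MapsTo (fun t : ℝ => (x, t)) (Icc (t₀ - T) t₀) Q := fun t ht =>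
    ⟨ball_subset_closedBall hx, ht⟩
  have hcomp : ContinuousOn (fun t : ℝ => fderivWithin ℝ U Q (x, t)) (Icc (t₀ - T) t₀) :=
    hcont.comp (by fun_prop) hmaps
  have hc : ContinuousOn (fun t : ℝ => ‖(fderivWithin ℝ U Q (x, t)).comp
      (ContinuousLinearMap.inl ℝ (EuclideanSpace ℝ (Fin n)) ℝ)‖) (Icc (t₀ - T) t₀) :=
    (hcomp.clm_comp continuousOn_const).norm
  refine hc.congr fun t ht => ?_
  simp only [norm_sgrad]
  congr 1
  have hd : HasFDerivWithinAt U (fderivWithin ℝ U Q (x, t)) Q (x, t) :=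
    (hu.differentiableOn (by simp) _ (hmaps ht)).hasFDerivWithinAt
  have h1 : HasFDerivWithinAt (fun y => U (y, t)) _ (closedBall x₀ R) x :=
    hd.comp (f := fun y => (y, t)) x (hasFDerivAt_prodMk_left x t).hasFDerivWithinAt
      fun y hy => ⟨hy, ht⟩
  exact (h1.hasFDerivAt (closedBall_mem_nhds_of_mem hx)).fderiv

end HeatSolution

/-- Euclidean case of estimate (1.4) of Theorem 1.1. -/
theorem sharp_gradient_estimate_heat (n : ℕ) (hn : 1 ≤ n) :
    ∃ c : ℝ, 0 < c ∧
      ∀ (x₀ : EuclideanSpace ℝ (Fin n)) (t₀ R T M : ℝ), 0 < R → 0 < T → 0 < M →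
      ∀ u : EuclideanSpace ℝ (Fin n) → ℝ → ℝ,
        IsHeatSolutionOn u (closedBall x₀ R ×ˢ Icc (t₀ - T) t₀) →
        (∀ p ∈ closedBall x₀ R ×ˢ Icc (t₀ - T) t₀, 0 < u p.1 p.2 ∧ u p.1 p.2 ≤ M) →
        ∀ x ∈ closedBall x₀ (R / 2), ∀ t ∈ Icc (t₀ - T / 2) t₀,
          ‖sgrad (fun y => u y t) x‖ / u x t ≤
            c * (1 / R + 1 / Real.sqrt T) * (1 + Real.log (M / u x t)) := by
  refine ⟨13 * (8 * n + 80), by positivity, ?_⟩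
  intro x₀ t₀ R T M hR hT hM u hu hpos x hx t ht
  rcases ht.2.lt_or_eq with htt | rfl
  · exact sharp_gradient_estimate_of_lt hR hT hu hpos hx ht.1 htt
  have hxR : x ∈ ball x₀ R := closedBall_subset_ball (by linarith) hx
  have hmaps : MapsTo (fun s : ℝ => (x, s)) (Icc (t - T) t) (closedBall x₀ R ×ˢ Icc (t - T) t) :=
    fun s hs => ⟨ball_subset_closedBall hxR, hs⟩
  have hposx : ∀ s ∈ Icc (t - T) t, 0 < u x s := fun s hs => (hpos _ (hmaps hs)).1
  have hcu : ContinuousOn (fun s => u x s) (Icc (t - T) t) :=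
    hu.1.continuousOn.comp (f := fun s : ℝ => (x, s)) (by fun_prop) hmaps
  have hcl : ContinuousOn (fun s => ‖sgrad (fun y => u y s) x‖ / u x s) (Icc (t - T) t) :=
    (continuousOn_norm_sgrad hR hT hu.1 hxR).div hcu fun s hs => (hposx s hs).ne'
  have hcr : ContinuousOn (fun s => (13 * (8 * (n : ℝ) + 80)) * (1 / R + 1 / Real.sqrt T) *
      (1 + Real.log (M / u x s))) (Icc (t - T) t) :=
    continuousOn_const.mul (continuousOn_const.add
      ((continuousOn_const.div hcu fun s hs => (hposx s hs).ne').log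
        fun s hs => (div_pos hM (hposx s hs)).ne'))
  have hsub : Ioo (t - T / 2) t ⊆ Icc (t - T) t := fun s hs => ⟨by linarith [hs.1], hs.2.le⟩
  have hmem : t ∈ Icc (t - T) t := ⟨by linarith, le_refl t⟩
  have hclos : t ∈ closure (Ioo (t - T / 2) t) := by
    rw [closure_Ioo (by linarith)]
    exact ⟨by linarith, le_refl t⟩
  have : (nhdsWithin t (Ioo (t - T / 2) t)).NeBot := mem_closure_iff_nhdsWithin_neBot.1 hclos
  refine le_of_tendsto_of_tendsto ((hcl t hmem).mono hsub) ((hcr t hmem).mono hsub) ?_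
  filter_upwards [self_mem_nhdsWithin] with s hs
  exact sharp_gradient_estimate_of_lt hR hT hu hpos hx hs.1.le hs.2
end

section
/- There exist constants c₁, c₂ > 0 depending only on the dimension n such that the following holds. Let u be a smooth positive solution of the heat equation on ℝⁿ × (0, ∞). Then for every x ∈ ℝⁿ and every t > 0, one has |∇u(x,t)|/u(x,t) ≤ c₁ t^{-1/2} (c₂ + ln(u(x,2t)/u(x,t))). (This is the Euclidean case of Theorem 1.1, estimate (1.5); note that no boundedness of u is assumed.) -/
open Metric Set

open MeasureTheory Filter Topology

lemma hasDerivAt_max_zero_pow (k : ℕ) (c : ℝ) :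
    HasDerivAt (fun c : ℝ => max c 0 ^ (k + 2)) ((k + 2) * max c 0 ^ (k + 1)) c := by
  rcases lt_trichotomy c 0 with hc | rfl | hc
  · have h : (fun c : ℝ => max c 0 ^ (k + 2)) =ᶠ[𝓝 c] fun _ => 0 := by
      filter_upwards [Iio_mem_nhds hc] with d hd
      simp [max_eq_right (mem_Iio.1 hd).le]
    simpa [max_eq_right hc.le] using (hasDerivAt_const c (0 : ℝ)).congr_of_eventuallyEq h
  · rw [hasDerivAt_iff_isLittleO]
    have h1 : (fun c : ℝ => c ^ (k + 2)) =o[𝓝 0] fun c => c := by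
      simpa using Asymptotics.isLittleO_pow_pow (𝕜 := ℝ) (show 1 < k + 2 by omega)
    refine Asymptotics.IsBigO.trans_isLittleO ?_ (by simpa using h1)
    refine Asymptotics.IsBigO.of_bound 1 (Eventually.of_forall fun d => ?_)
    simp only [max_self, ne_eq, Nat.add_eq_zero_iff, OfNat.ofNat_ne_zero, and_false,
      not_false_eq_true, zero_pow, sub_zero, one_mul, one_ne_zero, mul_zero, smul_zero]
    rw [norm_pow, norm_pow]
    refine pow_le_pow_left₀ (norm_nonneg _) ?_ _
    rcases le_total d 0 with h | h <;> simp [h]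
  · have h : (fun c : ℝ => max c 0 ^ (k + 2)) =ᶠ[𝓝 c] fun c => c ^ (k + 2) := by
      filter_upwards [Ioi_mem_nhds hc] with d hd
      simp [max_eq_left (mem_Ioi.1 hd).le]
    have := (hasDerivAt_pow (k + 2) c).congr_of_eventuallyEq h
    simpa [max_eq_left hc.le] using this

/-- The heat kernel at squared distance `r` and time `σ`, up to the constant `(4 * π) ^ (n / 2)`. -/
noncomputable def heatK (n : ℕ) (r σ : ℝ) : ℝ :=
  Real.exp (-(n / 2 : ℝ) * Real.log σ - r / (4 * σ))

/-- The heat kernel multiplied by a compactly supported cutoff; it is subcaloric backwards in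
time. -/
noncomputable def cutK (n : ℕ) (ρ r σ : ℝ) : ℝ :=
  heatK n r σ * max (1 - ρ * (r + 2 * n * σ)) 0 ^ 3

/-- First derivative of `cutK` in `r`. -/
noncomputable def cutKr (n : ℕ) (ρ r σ : ℝ) : ℝ :=
  heatK n r σ * (-(1 / (4 * σ)) * max (1 - ρ * (r + 2 * n * σ)) 0 ^ 3
    - 3 * ρ * max (1 - ρ * (r + 2 * n * σ)) 0 ^ 2)

/-- Second derivative of `cutK` in `r`. -/
noncomputable def cutKrr (n : ℕ) (ρ r σ : ℝ) : ℝ :=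
  heatK n r σ * (1 / (16 * σ ^ 2) * max (1 - ρ * (r + 2 * n * σ)) 0 ^ 3
    + 3 * ρ / (2 * σ) * max (1 - ρ * (r + 2 * n * σ)) 0 ^ 2
    + 6 * ρ ^ 2 * max (1 - ρ * (r + 2 * n * σ)) 0)

/-- Derivative of `cutK` in `σ`. -/
noncomputable def cutKs (n : ℕ) (ρ r σ : ℝ) : ℝ :=
  heatK n r σ * ((-(n / (2 * σ)) + r / (4 * σ ^ 2)) * max (1 - ρ * (r + 2 * n * σ)) 0 ^ 3
    - 6 * n * ρ * max (1 - ρ * (r + 2 * n * σ)) 0 ^ 2)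

lemma heatK_pos (n : ℕ) (r σ : ℝ) : 0 < heatK n r σ := Real.exp_pos _

lemma hasDerivAt_heatK_r (n : ℕ) (r σ : ℝ) :
    HasDerivAt (fun r => heatK n r σ) (heatK n r σ * (-(1 / (4 * σ)))) r := by
  unfold heatK
  exact (((hasDerivAt_id r).div_const (4 * σ)).const_sub _).exp

lemma hasDerivAt_heatK_s (n : ℕ) (r : ℝ) {σ : ℝ} (hσ : 0 < σ) :
    HasDerivAt (fun σ => heatK n r σ) (heatK n r σ * (-(n / (2 * σ)) + r / (4 * σ ^ 2))) σ := by
  unfold heatK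
  have h1 := (Real.hasDerivAt_log hσ.ne').const_mul (-(n / 2 : ℝ))
  have h2 := (hasDerivAt_const σ r).div ((hasDerivAt_id σ).const_mul 4) (by simpa using hσ.ne')
  refine (h1.sub h2).exp.congr_deriv ?_
  simp only [Pi.sub_apply, Pi.div_apply, id]
  field_simp
  ring

lemma hasDerivAt_cutK_r (n : ℕ) (ρ r σ : ℝ) :
    HasDerivAt (fun r => cutK n ρ r σ) (cutKr n ρ r σ) r := by
  unfold cutK
  have hq : HasDerivAt (fun r : ℝ => 1 - ρ * (r + 2 * n * σ)) (-(ρ * 1)) r :=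
    ((((hasDerivAt_id r).add_const _).const_mul ρ).const_sub 1)
  have h := (hasDerivAt_heatK_r n r σ).mul ((hasDerivAt_max_zero_pow 1 _).comp r hq)
  refine h.congr_deriv ?_
  unfold cutKr
  simp only [Function.comp]
  norm_num
  ring

lemma hasDerivAt_cutKr_r (n : ℕ) (ρ r : ℝ) {σ : ℝ} (hσ : 0 < σ) :
    HasDerivAt (fun r => cutKr n ρ r σ) (cutKrr n ρ r σ) r := by
  unfold cutKr
  have hq : HasDerivAt (fun r : ℝ => 1 - ρ * (r + 2 * n * σ)) (-(ρ * 1)) r :=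
    ((((hasDerivAt_id r).add_const _).const_mul ρ).const_sub 1)
  have h := (hasDerivAt_heatK_r n r σ).mul
    ((((hasDerivAt_max_zero_pow 1 _).comp r hq).const_mul (-(1 / (4 * σ)))).sub
      (((hasDerivAt_max_zero_pow 0 _).comp r hq).const_mul (3 * ρ)))
  refine h.congr_deriv ?_
  unfold cutKrr
  simp only [Function.comp, Pi.sub_apply]
  norm_num
  field_simp
  ring

lemma hasDerivAt_cutK_s (n : ℕ) (ρ r : ℝ) {σ : ℝ} (hσ : 0 < σ) :
    HasDerivAt (fun σ => cutK n ρ r σ) (cutKs n ρ r σ) σ := by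
  unfold cutK
  have hq : HasDerivAt (fun σ : ℝ => 1 - ρ * (r + 2 * n * σ)) (-(ρ * (2 * n * 1))) σ :=
    (((((hasDerivAt_id σ).const_mul (2 * (n : ℝ))).const_add r).const_mul ρ).const_sub 1)
  have h := (hasDerivAt_heatK_s n r hσ).mul ((hasDerivAt_max_zero_pow 1 _).comp σ hq)
  refine h.congr_deriv ?_
  unfold cutKs
  simp only [Function.comp]
  norm_num
  ring

lemma cutK_heat_defect (n : ℕ) (ρ r : ℝ) {σ : ℝ} (hσ : 0 < σ) :
    4 * r * cutKrr n ρ r σ + 2 * n * cutKr n ρ r σ - cutKs n ρ r σ =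
      heatK n r σ * (6 * ρ * r / σ * max (1 - ρ * (r + 2 * n * σ)) 0 ^ 2
        + 24 * r * ρ ^ 2 * max (1 - ρ * (r + 2 * n * σ)) 0) := by
  unfold cutKrr cutKr cutKs
  field_simp
  ring

lemma heatK_two_mul (n : ℕ) (r : ℝ) {σ : ℝ} (hσ : 0 < σ) :
    heatK n r σ = Real.exp (n / 2 * Real.log 2) * Real.exp (-(r / (8 * σ))) *
      heatK n r (2 * σ) := by
  unfold heatK
  rw [Real.log_mul two_ne_zero hσ.ne', ← Real.exp_add, ← Real.exp_add]
  congr 1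
  field_simp
  ring

lemma cutK_heat_defect_nonneg (n : ℕ) {ρ r σ : ℝ} (hρ : 0 < ρ) (hr : 0 ≤ r) (hσ : 0 < σ) :
    0 ≤ 4 * r * cutKrr n ρ r σ + 2 * n * cutKr n ρ r σ - cutKs n ρ r σ := by
  rw [cutK_heat_defect n ρ r hσ]
  have := heatK_pos n r σ
  positivity

lemma cutK_heat_defect_le (n : ℕ) {ρ r σ : ℝ} (hρ : 0 < ρ) (hr : 0 ≤ r) (hσ : 0 < σ) :
    4 * r * cutKrr n ρ r σ + 2 * n * cutKr n ρ r σ - cutKs n ρ r σ ≤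
      72 * Real.exp (n / 2 * Real.log 2) * ρ * heatK n r (2 * σ) := by
  rw [cutK_heat_defect n ρ r hσ]
  have hK := heatK_pos n r (2 * σ)
  set q := max (1 - ρ * (r + 2 * n * σ)) 0 with hq
  have hq0 : 0 ≤ q := le_max_right _ _
  have hnσ : 0 ≤ ρ * (2 * n * σ) := by positivity
  have hρr : 0 ≤ ρ * r := by positivity
  have hq1 : q ≤ 1 := max_le (by nlinarith) zero_le_one
  have hrq : ρ * r * q ≤ 1 := by
    rcases le_total (1 - ρ * (r + 2 * n * σ)) 0 with h | h
    · simp [hq, max_eq_right h]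
    · have : ρ * r ≤ 1 := by nlinarith
      nlinarith
  have hpoly : 6 * ρ * r / σ * q ^ 2 + 24 * r * ρ ^ 2 * q ≤ ρ * (6 * (r / σ) + 24) := by
    have h1 : q ^ 2 ≤ 1 := pow_le_one₀ hq0 hq1
    have h2 : 6 * ρ * r / σ * q ^ 2 ≤ 6 * ρ * r / σ :=
      mul_le_of_le_one_right (by positivity) h1
    have h3 : 24 * r * ρ ^ 2 * q ≤ 24 * ρ := by nlinarith
    calc _ ≤ 6 * ρ * r / σ + 24 * ρ := add_le_add h2 h3
      _ = _ := by ring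
  have hexp : (6 * (r / σ) + 24) * Real.exp (-(r / (8 * σ))) ≤ 72 := by
    have ha : r / (8 * σ) + 1 ≤ Real.exp (r / (8 * σ)) := Real.add_one_le_exp _
    have hb : 0 ≤ r / (8 * σ) := by positivity
    have hc : r / σ = 8 * (r / (8 * σ)) := by field_simp
    rw [Real.exp_neg, ← div_eq_mul_inv, div_le_iff₀ (Real.exp_pos _), hc]
    nlinarith
  calc heatK n r σ * (6 * ρ * r / σ * q ^ 2 + 24 * r * ρ ^ 2 * q)
      ≤ heatK n r σ * (ρ * (6 * (r / σ) + 24)) :=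
        mul_le_mul_of_nonneg_left hpoly (heatK_pos _ _ _).le
    _ = (Real.exp (n / 2 * Real.log 2) * ρ * heatK n r (2 * σ)) *
          ((6 * (r / σ) + 24) * Real.exp (-(r / (8 * σ)))) := by
        rw [heatK_two_mul n r hσ]; ring
    _ ≤ (Real.exp (n / 2 * Real.log 2) * ρ * heatK n r (2 * σ)) * 72 :=
        mul_le_mul_of_nonneg_left hexp (by positivity)
    _ = _ := by ring

lemma hasFDerivAt_norm_sub_sq {n : ℕ} (x y : EuclideanSpace ℝ (Fin n)) :
    HasFDerivAt (fun y => ‖y - x‖ ^ 2) (2 • innerSL ℝ (y - x)) y := by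
  have h := (hasStrictFDerivAt_norm_sq (y - x)).hasFDerivAt.comp y ((hasFDerivAt_id y).sub_const x)
  exact h.congr_fderiv (by ext; simp)

lemma fderiv_radial_single {n : ℕ} {G G' : ℝ → ℝ} (h : ∀ r, HasDerivAt G (G' r) r)
    (x y : EuclideanSpace ℝ (Fin n)) (i : Fin n) :
    fderiv ℝ (fun y => G (‖y - x‖ ^ 2)) y (EuclideanSpace.single i 1) =
      G' (‖y - x‖ ^ 2) * (2 * (y i - x i)) := by
  have h1 := (h (‖y - x‖ ^ 2)).comp_hasFDerivAt y (hasFDerivAt_norm_sub_sq x y)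
  have h2 : (fun y => G (‖y - x‖ ^ 2)) = G ∘ fun y => ‖y - x‖ ^ 2 := rfl
  rw [h2, h1.fderiv]
  simp [EuclideanSpace.inner_single_right]

lemma slap_radial {n : ℕ} {G G' G'' : ℝ → ℝ} (h : ∀ r, HasDerivAt G (G' r) r)
    (h' : ∀ r, HasDerivAt G' (G'' r) r) (x y : EuclideanSpace ℝ (Fin n)) :
    slap (fun y => G (‖y - x‖ ^ 2)) y =
      4 * ‖y - x‖ ^ 2 * G'' (‖y - x‖ ^ 2) + 2 * n * G' (‖y - x‖ ^ 2) := by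
  unfold slap
  have key : ∀ i : Fin n,
      fderiv ℝ (fun y => fderiv ℝ (fun y => G (‖y - x‖ ^ 2)) y (EuclideanSpace.single i 1)) y
        (EuclideanSpace.single i 1) =
      4 * G'' (‖y - x‖ ^ 2) * (y i - x i) ^ 2 + 2 * G' (‖y - x‖ ^ 2) := by
    intro i
    simp_rw [fderiv_radial_single h x _ i]
    have h1 : HasFDerivAt (fun y => G' (‖y - x‖ ^ 2))
        (G'' (‖y - x‖ ^ 2) • (2 • innerSL ℝ (y - x))) y :=
      (h' (‖y - x‖ ^ 2)).comp_hasFDerivAt y (hasFDerivAt_norm_sub_sq x y)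
    have h2 : HasFDerivAt (fun y : EuclideanSpace ℝ (Fin n) => 2 * (y i - x i))
        ((2 : ℝ) • (EuclideanSpace.proj i : EuclideanSpace ℝ (Fin n) →L[ℝ] ℝ)) y :=
      ((((EuclideanSpace.proj i : EuclideanSpace ℝ (Fin n) →L[ℝ] ℝ)).hasFDerivAt).sub_const
        (x i)).const_mul 2
    rw [(h1.fun_mul h2).fderiv]
    simp [EuclideanSpace.inner_single_right]
    ring
  rw [Finset.sum_congr rfl fun i _ => key i, Finset.sum_add_distrib, ← Finset.mul_sum,
    EuclideanSpace.norm_sq_eq]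
  simp
  ring

lemma contDiff_two_of_hasDerivAt {G G' G'' : ℝ → ℝ} (h : ∀ r, HasDerivAt G (G' r) r)
    (h' : ∀ r, HasDerivAt G' (G'' r) r) (hc : Continuous G'') : ContDiff ℝ 2 G := by
  have e : deriv G = G' := funext fun r => (h r).deriv
  have e' : deriv G' = G'' := funext fun r => (h' r).deriv
  rw [show (2 : WithTop ℕ∞) = 1 + 1 by norm_num, contDiff_succ_iff_deriv]
  refine ⟨fun r => (h r).differentiableAt, by simp, ?_⟩
  rw [e, contDiff_one_iff_deriv, e']
  exact ⟨fun r => (h' r).differentiableAt, hc⟩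

lemma contDiff_fderiv_apply {n : ℕ} {f : EuclideanSpace ℝ (Fin n) → ℝ} {k : ℕ}
    (hf : ContDiff ℝ (k + 1) f) (v : EuclideanSpace ℝ (Fin n)) :
    ContDiff ℝ k (fun y => fderiv ℝ f y v) :=
  (hf.fderiv_right le_rfl).clm_apply contDiff_const

lemma integral_mul_fderiv_of_hasCompactSupport {n : ℕ} {f g : EuclideanSpace ℝ (Fin n) → ℝ}
    (hf : ContDiff ℝ 1 f) (hfc : HasCompactSupport f) (hg : ContDiff ℝ 1 g)
    (v : EuclideanSpace ℝ (Fin n)) :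
    ∫ y, f y * fderiv ℝ g y v = -∫ y, fderiv ℝ f y v * g y := by
  have hf' : Continuous fun y => fderiv ℝ f y v :=
    (contDiff_fderiv_apply (k := 0) (by simpa using hf) v).continuous
  have hg' : Continuous fun y => fderiv ℝ g y v :=
    (contDiff_fderiv_apply (k := 0) (by simpa using hg) v).continuous
  refine integral_mul_fderiv_eq_neg_fderiv_mul_of_integrable ?_ ?_ ?_
    (fun y _ => (hf.differentiable one_ne_zero) y) (fun y _ => (hg.differentiable one_ne_zero) y)
  · exact (hf'.mul hg.continuous).integrable_of_hasCompactSupport (hfc.fderiv_apply ℝ v).mul_right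
  · exact (hf.continuous.mul hg').integrable_of_hasCompactSupport hfc.mul_right
  · exact (hf.continuous.mul hg.continuous).integrable_of_hasCompactSupport hfc.mul_right

lemma integral_mul_slap {n : ℕ} {f g : EuclideanSpace ℝ (Fin n) → ℝ}
    (hf : ContDiff ℝ 2 f) (hfc : HasCompactSupport f) (hg : ContDiff ℝ 2 g) :
    ∫ y, f y * slap g y = ∫ y, slap f y * g y := by
  unfold slap
  simp_rw [Finset.mul_sum, Finset.sum_mul]
  have hf1 : ∀ v, ContDiff ℝ 1 fun y => fderiv ℝ f y v := fun v =>
    contDiff_fderiv_apply (k := 1) (by norm_num; exact hf) v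
  have hg1 : ∀ v, ContDiff ℝ 1 fun y => fderiv ℝ g y v := fun v =>
    contDiff_fderiv_apply (k := 1) (by norm_num; exact hg) v
  have hf2 : ∀ v, Continuous fun y => fderiv ℝ (fun y => fderiv ℝ f y v) y v := fun v =>
    (contDiff_fderiv_apply (k := 0) (by simpa using hf1 v) v).continuous
  have hg2 : ∀ v, Continuous fun y => fderiv ℝ (fun y => fderiv ℝ g y v) y v := fun v =>
    (contDiff_fderiv_apply (k := 0) (by simpa using hg1 v) v).continuous
  have hc1 : ∀ v, HasCompactSupport fun y => fderiv ℝ f y v := fun v => hfc.fderiv_apply ℝ v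
  rw [integral_finsetSum, integral_finsetSum]
  · refine Finset.sum_congr rfl fun i _ => ?_
    rw [integral_mul_fderiv_of_hasCompactSupport (hf.of_le one_le_two) hfc (hg1 _),
      integral_mul_fderiv_of_hasCompactSupport (hf1 _) (hc1 _) (hg.of_le one_le_two), neg_neg]
  · exact fun i _ => ((hf2 _).mul hg.continuous).integrable_of_hasCompactSupport
      ((hc1 _).fderiv_apply ℝ _).mul_right
  · exact fun i _ => (hf.continuous.mul (hg2 _)).integrable_of_hasCompactSupport hfc.mul_right

/-- Differentiation under the integral sign for integrands supported in a fixed compact set. -/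
lemma hasDerivAt_integral_of_compact {n : ℕ} {H H' : EuclideanSpace ℝ (Fin n) → ℝ → ℝ}
    {S : Set (EuclideanSpace ℝ (Fin n))} (hS : IsCompact S) {a b τ : ℝ} (haτ : a < τ) (hτb : τ < b)
    (hH : ∀ s ∈ Ioo a b, Continuous fun y => H y s)
    (hH' : ContinuousOn (fun p : EuclideanSpace ℝ (Fin n) × ℝ => H' p.1 p.2) (univ ×ˢ Ioo a b))
    (hHS : ∀ s ∈ Ioo a b, ∀ y ∉ S, H y s = 0) (hHS' : ∀ s ∈ Ioo a b, ∀ y ∉ S, H' y s = 0)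
    (hd : ∀ y, ∀ s ∈ Ioo a b, HasDerivAt (H y) (H' y s) s) :
    Integrable (fun y => H' y τ) ∧
      HasDerivAt (fun s => ∫ y, H y s) (∫ y, H' y τ) τ := by
  obtain ⟨a', ha, ha'⟩ := exists_between haτ
  obtain ⟨b', hb', hb⟩ := exists_between hτb
  have hsub : Icc a' b' ⊆ Ioo a b := fun s hs => ⟨ha.trans_le hs.1, hs.2.trans_lt hb⟩
  have hτ : τ ∈ Ioo a b := ⟨haτ, hτb⟩
  obtain ⟨M, hM⟩ := (hS.prod (isCompact_Icc (a := a') (b := b'))).exists_bound_of_continuousOn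
    (hH'.mono (prod_mono (subset_univ _) hsub))
  have hmem : ∀ s ∈ Ioo a b, HasCompactSupport fun y => H y s := fun s hs =>
    HasCompactSupport.intro hS fun y hy => hHS s hs y hy
  have hc' : Continuous fun y => H' y τ := by
    rw [← continuousOn_univ]
    exact hH'.comp (f := fun y => (y, τ)) (by fun_prop) fun y _ => ⟨mem_univ _, hτ⟩
  refine hasDerivAt_integral_of_dominated_loc_of_deriv_le (F := fun s y => H y s)
    (F' := fun s y => H' y s) (s := Icc a' b') (bound := S.indicator fun _ => M)
    (Icc_mem_nhds ha' hb') ?_ ?_ hc'.aestronglyMeasurable ?_ ?_ ?_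
  · filter_upwards [Ioo_mem_nhds haτ hτb] with s hs using (hH s hs).aestronglyMeasurable
  · exact (hH τ hτ).integrable_of_hasCompactSupport (hmem τ hτ)
  · refine Eventually.of_forall fun y s hs => ?_
    by_cases hy : y ∈ S
    · simpa [hy] using hM (y, s) ⟨hy, hs⟩
    · simp [hy, hHS' s (hsub hs) y hy]
  · rw [integrable_indicator_iff hS.measurableSet]
    exact integrableOn_const hS.measure_lt_top.ne
  · exact Eventually.of_forall fun y s hs => hd y s (hsub hs)


section Solution

variable {n : ℕ} {u : EuclideanSpace ℝ (Fin n) → ℝ → ℝ}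

lemma IsHeatSolutionOn.contDiffAt (hu : IsHeatSolutionOn u (univ ×ˢ Ioi 0))
    (y : EuclideanSpace ℝ (Fin n)) {τ : ℝ} (hτ : 0 < τ) :
    ContDiffAt ℝ (⊤ : ℕ∞) (fun p : EuclideanSpace ℝ (Fin n) × ℝ => u p.1 p.2) (y, τ) :=
  hu.1.contDiffAt ((isOpen_univ.prod isOpen_Ioi).mem_nhds ⟨mem_univ _, hτ⟩)

lemma IsHeatSolutionOn.contDiff_space (hu : IsHeatSolutionOn u (univ ×ˢ Ioi 0)) {τ : ℝ}
    (hτ : 0 < τ) : ContDiff ℝ 2 fun y => u y τ := by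
  rw [contDiff_iff_contDiffAt]
  intro y
  have h : ContDiffAt ℝ (⊤ : ℕ∞) (fun y => u y τ) y :=
    (hu.contDiffAt y hτ).comp y (f := fun y => (y, τ)) (contDiffAt_id.prodMk contDiffAt_const)
  exact h.of_le (WithTop.coe_le_coe.2 (le_top : (2 : ℕ∞) ≤ ⊤))

lemma IsHeatSolutionOn.hasDerivAt_fderiv (hu : IsHeatSolutionOn u (univ ×ˢ Ioi 0))
    (y : EuclideanSpace ℝ (Fin n)) {τ : ℝ} (hτ : 0 < τ) :
    HasDerivAt (fun s => u y s)
      (fderiv ℝ (fun p : EuclideanSpace ℝ (Fin n) × ℝ => u p.1 p.2) (y, τ) (0, 1)) τ := by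
  have h := ((hu.contDiffAt y hτ).differentiableAt (by simp)).hasFDerivAt
  exact h.comp_hasDerivAt τ ((hasDerivAt_const τ y).prodMk (hasDerivAt_id τ))

lemma IsHeatSolutionOn.fderiv_eq_slap (hu : IsHeatSolutionOn u (univ ×ˢ Ioi 0))
    (y : EuclideanSpace ℝ (Fin n)) {τ : ℝ} (hτ : 0 < τ) :
    fderiv ℝ (fun p : EuclideanSpace ℝ (Fin n) × ℝ => u p.1 p.2) (y, τ) (0, 1) =
      slap (fun y => u y τ) y := by
  rw [← (hu.hasDerivAt_fderiv y hτ).deriv]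
  exact hu.2 (y, τ) ⟨mem_univ _, hτ⟩

lemma IsHeatSolutionOn.continuousOn_slap (hu : IsHeatSolutionOn u (univ ×ˢ Ioi 0)) :
    ContinuousOn (fun p : EuclideanSpace ℝ (Fin n) × ℝ => slap (fun y => u y p.2) p.1)
      (univ ×ˢ Ioi 0) := by
  have h := hu.1.continuousOn_fderiv_of_isOpen (isOpen_univ.prod isOpen_Ioi) (by simp)
  refine (h.clm_apply continuousOn_const (g := fun _ => ((0 : EuclideanSpace ℝ (Fin n)), (1 : ℝ)))).congr
    fun p hp => ?_
  exact (hu.fderiv_eq_slap p.1 hp.2).symm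

end Solution

lemma continuousOn_heatK (n : ℕ) :
    ContinuousOn (fun p : ℝ × ℝ => heatK n p.1 p.2) (univ ×ˢ Ioi 0) := by
  unfold heatK
  have h2 : ∀ p ∈ (univ ×ˢ Ioi 0 : Set (ℝ × ℝ)), p.2 ≠ 0 := fun p hp => (mem_Ioi.1 hp.2).ne'
  have h4 : ∀ p ∈ (univ ×ˢ Ioi 0 : Set (ℝ × ℝ)), 4 * p.2 ≠ 0 := fun p hp =>
    mul_ne_zero four_ne_zero (h2 p hp)
  exact ((continuousOn_const.mul (continuousOn_snd.log h2)).sub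
    (continuousOn_fst.div (continuousOn_const.mul continuousOn_snd) h4)).rexp

lemma continuousOn_cutK (n : ℕ) (ρ : ℝ) :
    ContinuousOn (fun p : ℝ × ℝ => cutK n ρ p.1 p.2) (univ ×ˢ Ioi 0) := by
  unfold cutK
  exact (continuousOn_heatK n).mul (by fun_prop)

lemma continuousOn_cutKs (n : ℕ) (ρ : ℝ) :
    ContinuousOn (fun p : ℝ × ℝ => cutKs n ρ p.1 p.2) (univ ×ˢ Ioi 0) := by
  unfold cutKs
  have h2 : ∀ p ∈ (univ ×ˢ Ioi 0 : Set (ℝ × ℝ)), 2 * p.2 ≠ 0 := fun p hp =>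
    mul_ne_zero two_ne_zero (mem_Ioi.1 hp.2).ne'
  have h4 : ∀ p ∈ (univ ×ˢ Ioi 0 : Set (ℝ × ℝ)), 4 * p.2 ^ 2 ≠ 0 := fun p hp =>
    mul_ne_zero four_ne_zero (pow_ne_zero 2 (mem_Ioi.1 hp.2).ne')
  refine (continuousOn_heatK n).mul ((ContinuousOn.mul (ContinuousOn.add
    (ContinuousOn.div (by fun_prop) (by fun_prop) h2).neg
    (ContinuousOn.div (by fun_prop) (by fun_prop) h4)) (by fun_prop)).sub (by fun_prop))

lemma continuous_heatK_r (n : ℕ) (σ : ℝ) : Continuous fun r => heatK n r σ := by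
  unfold heatK
  fun_prop

lemma continuous_cutKrr (n : ℕ) (ρ σ : ℝ) : Continuous fun r => cutKrr n ρ r σ :=
  (continuous_heatK_r n σ).mul (by fun_prop)

lemma contDiff_cutK (n : ℕ) (ρ : ℝ) {σ : ℝ} (hσ : 0 < σ) (x : EuclideanSpace ℝ (Fin n)) :
    ContDiff ℝ 2 fun y => cutK n ρ (‖y - x‖ ^ 2) σ :=
  (contDiff_two_of_hasDerivAt (fun r => hasDerivAt_cutK_r n ρ r σ)
    (fun r => hasDerivAt_cutKr_r n ρ r hσ) (continuous_cutKrr n ρ σ)).comp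
      ((contDiff_id.sub contDiff_const).norm_sq ℝ)

lemma cutoff_eq_zero {n : ℕ} {ρ σ : ℝ} (hρ : 0 < ρ) (hσ : 0 < σ) {x y : EuclideanSpace ℝ (Fin n)}
    (hy : y ∉ closedBall x √(1 / ρ)) : max (1 - ρ * (‖y - x‖ ^ 2 + 2 * n * σ)) 0 = 0 := by
  rw [mem_closedBall, dist_eq_norm, not_le] at hy
  rw [Real.sqrt_lt' ((Real.sqrt_nonneg _).trans_lt hy), div_lt_iff₀ hρ] at hy
  have : 0 ≤ ρ * (2 * n * σ) := by positivity
  exact max_eq_right (by nlinarith)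

lemma cutK_eq_zero {n : ℕ} {ρ σ : ℝ} (hρ : 0 < ρ) (hσ : 0 < σ) {x y : EuclideanSpace ℝ (Fin n)}
    (hy : y ∉ closedBall x √(1 / ρ)) : cutK n ρ (‖y - x‖ ^ 2) σ = 0 := by
  simp [cutK, cutoff_eq_zero hρ hσ hy]

lemma cutKs_eq_zero {n : ℕ} {ρ σ : ℝ} (hρ : 0 < ρ) (hσ : 0 < σ) {x y : EuclideanSpace ℝ (Fin n)}
    (hy : y ∉ closedBall x √(1 / ρ)) : cutKs n ρ (‖y - x‖ ^ 2) σ = 0 := by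
  simp [cutKs, cutoff_eq_zero hρ hσ hy]

lemma hasCompactSupport_cutK {n : ℕ} {ρ σ : ℝ} (hρ : 0 < ρ) (hσ : 0 < σ)
    (x : EuclideanSpace ℝ (Fin n)) : HasCompactSupport fun y => cutK n ρ (‖y - x‖ ^ 2) σ :=
  HasCompactSupport.intro (isCompact_closedBall x √(1 / ρ)) fun _ hy => cutK_eq_zero hρ hσ hy

lemma hasDerivAt_integral_cutK {n : ℕ} {u : EuclideanSpace ℝ (Fin n) → ℝ → ℝ}
    (hu : IsHeatSolutionOn u (univ ×ˢ Ioi 0)) (x : EuclideanSpace ℝ (Fin n)) {ρ t τ : ℝ}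
    (hρ : 0 < ρ) (hτ : 0 < τ) (hτt : τ < t) :
    Integrable (fun y => (4 * ‖y - x‖ ^ 2 * cutKrr n ρ (‖y - x‖ ^ 2) (t - τ)
        + 2 * n * cutKr n ρ (‖y - x‖ ^ 2) (t - τ) - cutKs n ρ (‖y - x‖ ^ 2) (t - τ)) * u y τ) ∧
    HasDerivAt (fun s => ∫ y, cutK n ρ (‖y - x‖ ^ 2) (t - s) * u y s)
      (∫ y, (4 * ‖y - x‖ ^ 2 * cutKrr n ρ (‖y - x‖ ^ 2) (t - τ)
        + 2 * n * cutKr n ρ (‖y - x‖ ^ 2) (t - τ) - cutKs n ρ (‖y - x‖ ^ 2) (t - τ)) * u y τ) τ := by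
  have hpos : ∀ s ∈ Ioo 0 t, 0 < t - s := fun s hs => sub_pos.2 hs.2
  have hmaps : MapsTo (fun p : EuclideanSpace ℝ (Fin n) × ℝ => (‖p.1 - x‖ ^ 2, t - p.2))
      (univ ×ˢ Ioo 0 t) (univ ×ˢ Ioi 0) := fun p hp => ⟨mem_univ _, hpos _ hp.2⟩
  have hsub : (univ ×ˢ Ioo 0 t : Set (EuclideanSpace ℝ (Fin n) × ℝ)) ⊆ univ ×ˢ Ioi 0 :=
    prod_mono subset_rfl fun s hs => hs.1
  have hcut := (continuousOn_cutK n ρ).comp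
    (by fun_prop : ContinuousOn (fun p : EuclideanSpace ℝ (Fin n) × ℝ =>
      (‖p.1 - x‖ ^ 2, t - p.2)) _) hmaps
  have hcuts := (continuousOn_cutKs n ρ).comp
    (by fun_prop : ContinuousOn (fun p : EuclideanSpace ℝ (Fin n) × ℝ =>
      (‖p.1 - x‖ ^ 2, t - p.2)) _) hmaps
  have hmain := hasDerivAt_integral_of_compact
    (H := fun y s => cutK n ρ (‖y - x‖ ^ 2) (t - s) * u y s)
    (H' := fun y s => -cutKs n ρ (‖y - x‖ ^ 2) (t - s) * u y s
      + cutK n ρ (‖y - x‖ ^ 2) (t - s) * slap (fun y => u y s) y)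
    (isCompact_closedBall x √(1 / ρ)) hτ hτt
    (fun s hs => (contDiff_cutK n ρ (hpos s hs) x).continuous.mul
      (hu.contDiff_space hs.1).continuous)
    ((hcuts.neg.mul (hu.1.continuousOn.mono hsub)).add
      (hcut.mul (hu.continuousOn_slap.mono hsub)))
    (fun s hs y hy => by simp [cutK_eq_zero hρ (hpos s hs) hy])
    (fun s hs y hy => by
      simp [cutK_eq_zero hρ (hpos s hs) hy, cutKs_eq_zero hρ (hpos s hs) hy])
    (fun y s hs => by
      have h1 := (hasDerivAt_cutK_s n ρ (‖y - x‖ ^ 2) (hpos s hs)).comp s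
        ((hasDerivAt_id s).const_sub t)
      have h2 := hu.hasDerivAt_fderiv y hs.1
      rw [hu.fderiv_eq_slap y hs.1] at h2
      exact (h1.mul h2).congr_deriv (by simp))
  have hσ : 0 < t - τ := sub_pos.2 hτt
  have hK2 := contDiff_cutK n ρ hσ x
  have hKc := hasCompactSupport_cutK hρ hσ x
  have hu2 := hu.contDiff_space hτ
  have hslapc : Continuous fun y => slap (fun y => u y τ) y := by
    rw [← continuousOn_univ]
    exact hu.continuousOn_slap.comp (f := fun y => (y, τ)) (by fun_prop) fun y _ => ⟨mem_univ _, hτ⟩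
  have hslapK : ∀ y, slap (fun y => cutK n ρ (‖y - x‖ ^ 2) (t - τ)) y =
      4 * ‖y - x‖ ^ 2 * cutKrr n ρ (‖y - x‖ ^ 2) (t - τ)
        + 2 * n * cutKr n ρ (‖y - x‖ ^ 2) (t - τ) := fun y =>
    slap_radial (G := fun r => cutK n ρ r (t - τ)) (G' := fun r => cutKr n ρ r (t - τ))
      (G'' := fun r => cutKrr n ρ r (t - τ)) (fun r => hasDerivAt_cutK_r n ρ r _)
      (fun r => hasDerivAt_cutKr_r n ρ r hσ) x y
  have hcs : Continuous fun y : EuclideanSpace ℝ (Fin n) => cutKs n ρ (‖y - x‖ ^ 2) (t - τ) := by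
    rw [← continuousOn_univ]
    exact (continuousOn_cutKs n ρ).comp (f := fun y : EuclideanSpace ℝ (Fin n) =>
      (‖y - x‖ ^ 2, t - τ)) (by fun_prop) fun y _ => ⟨mem_univ _, hσ⟩
  have hi1 : Integrable fun y => -cutKs n ρ (‖y - x‖ ^ 2) (t - τ) * u y τ := by
    refine (hcs.neg.mul hu2.continuous).integrable_of_hasCompactSupport
      (HasCompactSupport.intro (isCompact_closedBall x √(1 / ρ)) fun y hy => ?_)
    simp [cutKs_eq_zero hρ hσ hy]
  have hi2 : Integrable fun y => cutK n ρ (‖y - x‖ ^ 2) (t - τ) * slap (fun y => u y τ) y :=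
    (hK2.continuous.mul hslapc).integrable_of_hasCompactSupport hKc.mul_right
  have hi3 : Integrable fun y => slap (fun y => cutK n ρ (‖y - x‖ ^ 2) (t - τ)) y * u y τ := by
    have hcr : Continuous fun r => cutKr n ρ r (t - τ) :=
      (continuous_heatK_r n _).mul (by fun_prop)
    simp_rw [hslapK]
    refine Continuous.integrable_of_hasCompactSupport ?_
      (HasCompactSupport.intro (isCompact_closedBall x √(1 / ρ)) fun y hy => ?_)
    · have := continuous_cutKrr n ρ (t - τ)
      have := hu2.continuous
      fun_prop
    · simp [cutKrr, cutKr, cutoff_eq_zero hρ hσ hy]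
  have heq : ∀ y, (4 * ‖y - x‖ ^ 2 * cutKrr n ρ (‖y - x‖ ^ 2) (t - τ)
      + 2 * n * cutKr n ρ (‖y - x‖ ^ 2) (t - τ) - cutKs n ρ (‖y - x‖ ^ 2) (t - τ)) * u y τ =
      -cutKs n ρ (‖y - x‖ ^ 2) (t - τ) * u y τ
        + slap (fun y => cutK n ρ (‖y - x‖ ^ 2) (t - τ)) y * u y τ := fun y => by
    rw [hslapK]; ring
  simp_rw [heq]
  refine ⟨hi1.add hi3, hmain.2.congr_deriv ?_⟩
  rw [integral_add hi1 hi2, integral_add hi1 hi3, integral_mul_slap hK2 hKc hu2]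


lemma integrable_exp_neg_norm_sq (n : ℕ) :
    Integrable fun z : EuclideanSpace ℝ (Fin n) => Real.exp (-(‖z‖ ^ 2 / 4)) := by
  have h := (GaussianFourier.integrable_cexp_neg_mul_sq_norm_add_of_euclideanSpace (ι := Fin n)
    (b := (1 / 4 : ℂ)) (by norm_num) 0 0).re
  refine h.congr (Eventually.of_forall fun z => ?_)
  have : (-(1 / 4 : ℂ) * (‖z‖ : ℂ) ^ 2 + 0 * (inner ℝ (0 : EuclideanSpace ℝ (Fin n)) z : ℂ)) =
      ((-(‖z‖ ^ 2 / 4) : ℝ) : ℂ) := by push_cast; ring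
  simp only [this]
  exact Complex.exp_ofReal_re _

/-- Total mass of the unnormalised heat kernel. -/
noncomputable def heatMass (n : ℕ) : ℝ :=
  ∫ z : EuclideanSpace ℝ (Fin n), Real.exp (-(‖z‖ ^ 2 / 4))

lemma heatMass_pos (n : ℕ) : 0 < heatMass n :=
  integral_exp_pos (integrable_exp_neg_norm_sq n)

lemma heatK_scale (n : ℕ) (r : ℝ) {δ : ℝ} (hδ : 0 < δ) :
    √δ ^ n * heatK n (δ * r) δ = Real.exp (-(r / 4)) := by
  have h : √δ ^ n = Real.exp (n / 2 * Real.log δ) := by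
    rw [← Real.exp_log (Real.sqrt_pos.2 hδ), ← Real.exp_nat_mul, Real.log_sqrt hδ.le]
    congr 1; ring
  rw [h, heatK, ← Real.exp_add]
  congr 1
  field_simp
  ring

lemma integral_cutK_rescale {n : ℕ} (f : EuclideanSpace ℝ (Fin n) → ℝ)
    (x : EuclideanSpace ℝ (Fin n)) (ρ : ℝ) {δ : ℝ} (hδ : 0 < δ) :
    ∫ y, cutK n ρ (‖y - x‖ ^ 2) δ * f y =
      ∫ z, Real.exp (-(‖z‖ ^ 2 / 4)) * max (1 - ρ * (δ * ‖z‖ ^ 2 + 2 * n * δ)) 0 ^ 3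
        * f (√δ • z + x) := by
  have hs : 0 < √δ := Real.sqrt_pos.2 hδ
  have h1 := integral_add_right_eq_self (μ := volume)
    (fun y => cutK n ρ (‖y - x‖ ^ 2) δ * f y) x
  have h2 := Measure.integral_comp_smul_of_nonneg (μ := volume)
    (fun y => cutK n ρ (‖y + x - x‖ ^ 2) δ * f (y + x)) √δ (hR := hs.le)
  rw [← h1]
  simp only [finrank_euclideanSpace, Fintype.card_fin, smul_eq_mul] at h2
  rw [eq_inv_mul_iff_mul_eq₀ (pow_ne_zero _ hs.ne')] at h2
  rw [← h2, ← integral_const_mul]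
  congr 1
  ext z
  have hz : ‖√δ • z + x - x‖ ^ 2 = δ * ‖z‖ ^ 2 := by
    rw [add_sub_cancel_right, norm_smul, mul_pow, Real.norm_eq_abs, sq_abs, Real.sq_sqrt hδ.le]
  rw [hz, cutK, ← heatK_scale n (‖z‖ ^ 2) hδ]
  ring

lemma tendsto_integral_cutK {n : ℕ} {u : EuclideanSpace ℝ (Fin n) → ℝ → ℝ}
    (hu : ContinuousOn (fun p : EuclideanSpace ℝ (Fin n) × ℝ => u p.1 p.2) (univ ×ˢ Ioi 0))
    (x : EuclideanSpace ℝ (Fin n)) {ρ t : ℝ} (hρ : 0 < ρ) (ht : 0 < t) :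
    Tendsto (fun δ => ∫ y, cutK n ρ (‖y - x‖ ^ 2) δ * u y (t - δ)) (𝓝[>] 0)
      (𝓝 (heatMass n * u x t)) := by
  have hcpt := (isCompact_closedBall x √(1 / ρ)).prod (isCompact_Icc (a := t / 2) (b := t))
  obtain ⟨M, hM⟩ := hcpt.exists_bound_of_continuousOn
    (hu.mono (prod_mono (subset_univ _) fun s hs => (half_pos ht).trans_le hs.1))
  have hδ : ∀ᶠ δ in 𝓝[>] (0 : ℝ), δ ∈ Ioo 0 (t / 2) := Ioo_mem_nhdsGT (half_pos ht)
  have hM0 : 0 ≤ M := (norm_nonneg _).trans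
    (hM (x, t) ⟨mem_closedBall_self (Real.sqrt_nonneg _), by linarith, le_rfl⟩)
  rw [heatMass, ← integral_mul_const]
  have hcont : ∀ s, 0 < s → Continuous fun y => u y s := fun s hs => by
    rw [← continuousOn_univ]
    exact hu.comp (f := fun y => (y, s)) (by fun_prop) fun y _ => ⟨mem_univ _, hs⟩
  refine (tendsto_integral_filter_of_dominated_convergence
    (F := fun δ z => Real.exp (-(‖z‖ ^ 2 / 4)) * max (1 - ρ * (δ * ‖z‖ ^ 2 + 2 * n * δ)) 0 ^ 3
        * u (√δ • z + x) (t - δ)) (fun z => Real.exp (-(‖z‖ ^ 2 / 4)) * M) ?_ ?_ ?_ ?_).congr' ?_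
  · filter_upwards [hδ] with δ hδ
    have := hcont (t - δ) (by linarith [hδ.2])
    exact Continuous.aestronglyMeasurable (by fun_prop)
  · filter_upwards [hδ] with δ hδ
    refine Eventually.of_forall fun z => ?_
    have hz : ‖√δ • z + x - x‖ ^ 2 = δ * ‖z‖ ^ 2 := by
      rw [add_sub_cancel_right, norm_smul, mul_pow, Real.norm_eq_abs, sq_abs, Real.sq_sqrt hδ.1.le]
    by_cases hy : √δ • z + x ∈ closedBall x √(1 / ρ)
    · have h1 := hM (√δ • z + x, t - δ) ⟨hy, by linarith [hδ.2], by linarith [hδ.1]⟩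
      have h0 : 0 ≤ ρ * (δ * ‖z‖ ^ 2 + 2 * n * δ) := by have := hδ.1; positivity
      have h2 : max (1 - ρ * (δ * ‖z‖ ^ 2 + 2 * n * δ)) 0 ^ 3 ≤ 1 :=
        pow_le_one₀ (le_max_right _ _) (max_le (by linarith) zero_le_one)
      have h3 : 0 ≤ max (1 - ρ * (δ * ‖z‖ ^ 2 + 2 * n * δ)) 0 ^ 3 := by positivity
      rw [norm_mul, norm_mul, Real.norm_of_nonneg (Real.exp_nonneg _), Real.norm_of_nonneg h3]
      exact mul_le_mul (mul_le_of_le_one_right (Real.exp_nonneg _) h2) h1 (norm_nonneg _)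
        (Real.exp_nonneg _)
    · have h := cutoff_eq_zero hρ hδ.1 hy
      rw [hz] at h
      rw [h]
      simpa using mul_nonneg (Real.exp_nonneg _) hM0
  · exact (integrable_exp_neg_norm_sq n).mul_const M
  · refine Eventually.of_forall fun z => ?_
    have hmax : Tendsto (fun δ : ℝ => max (1 - ρ * (δ * ‖z‖ ^ 2 + 2 * n * δ)) 0 ^ 3) (𝓝[>] 0)
        (𝓝 1) := by
      have : Continuous fun δ : ℝ => max (1 - ρ * (δ * ‖z‖ ^ 2 + 2 * n * δ)) 0 ^ 3 := by fun_prop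
      simpa using (this.tendsto 0).mono_left nhdsWithin_le_nhds
    have hpt : Tendsto (fun δ : ℝ => (√δ • z + x, t - δ)) (𝓝[>] 0) (𝓝 (x, t)) := by
      have : Continuous fun δ : ℝ => (√δ • z + x, t - δ) := by fun_prop
      simpa using (this.tendsto 0).mono_left nhdsWithin_le_nhds
    have hux : Tendsto (fun δ : ℝ => u (√δ • z + x) (t - δ)) (𝓝[>] 0) (𝓝 (u x t)) :=
      (hu.continuousAt (x := (x, t))
        ((isOpen_univ.prod isOpen_Ioi).mem_nhds ⟨mem_univ _, ht⟩)).tendsto.comp hpt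
    simpa using (tendsto_const_nhds.mul hmax).mul hux
  · filter_upwards [hδ] with δ hδ
    exact (integral_cutK_rescale (fun y => u y (t - δ)) x ρ hδ.1).symm

lemma integrable_of_tendsto_of_integral_le {n : ℕ} {f : ℕ → EuclideanSpace ℝ (Fin n) → ℝ}
    {g : EuclideanSpace ℝ (Fin n) → ℝ} {B : ℝ} (hf : ∀ k, Integrable (f k)) (hf0 : ∀ k y, 0 ≤ f k y)
    (hg : Continuous g) (hg0 : ∀ y, 0 ≤ g y) (hfB : ∀ k, ∫ y, f k y ≤ B)
    (hlim : ∀ y, Tendsto (fun k => f k y) atTop (𝓝 (g y))) :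
    Integrable g ∧ ∫ y, g y ≤ B := by
  have hB : 0 ≤ B := (integral_nonneg (hf0 0)).trans (hfB 0)
  have hle : ∫⁻ y, ENNReal.ofReal (g y) ≤ ENNReal.ofReal B := by
    have hl : ∀ y, ENNReal.ofReal (g y) = liminf (fun k => ENNReal.ofReal (f k y)) atTop := fun y =>
      ((ENNReal.continuous_ofReal.tendsto _).comp (hlim y)).liminf_eq.symm
    simp_rw [hl]
    refine (lintegral_liminf_le' fun k => (hf k).aestronglyMeasurable.aemeasurable.ennreal_ofReal).trans ?_
    refine liminf_le_of_le (by isBoundedDefault) fun b hb => ?_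
    obtain ⟨k, hk⟩ := hb.exists
    refine hk.trans ?_
    rw [← ofReal_integral_eq_lintegral_ofReal (hf k) (Eventually.of_forall (hf0 k))]
    exact ENNReal.ofReal_le_ofReal (hfB k)
  have hint : Integrable g := by
    refine ⟨hg.aestronglyMeasurable, ?_⟩
    rw [hasFiniteIntegral_iff_ofReal (Eventually.of_forall hg0)]
    exact hle.trans_lt ENNReal.ofReal_lt_top
  refine ⟨hint, ?_⟩
  rwa [← ofReal_integral_eq_lintegral_ofReal hint (Eventually.of_forall hg0),
    ENNReal.ofReal_le_ofReal_iff hB] at hle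

section Positive

variable {n : ℕ} {u : EuclideanSpace ℝ (Fin n) → ℝ → ℝ}

lemma integrable_cutK_mul (hu : IsHeatSolutionOn u (univ ×ˢ Ioi 0)) (x : EuclideanSpace ℝ (Fin n))
    {ρ s σ : ℝ} (hρ : 0 < ρ) (hs : 0 < s) (hσ : 0 < σ) :
    Integrable fun y => cutK n ρ (‖y - x‖ ^ 2) σ * u y s :=
  ((contDiff_cutK n ρ hσ x).continuous.mul
    (hu.contDiff_space hs).continuous).integrable_of_hasCompactSupport
      (hasCompactSupport_cutK hρ hσ x).mul_right

lemma integral_cutK_le (hu : IsHeatSolutionOn u (univ ×ˢ Ioi 0))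
    (hpos : ∀ x, ∀ t ∈ Ioi (0 : ℝ), 0 < u x t) (x : EuclideanSpace ℝ (Fin n)) {ρ s t : ℝ}
    (hρ : 0 < ρ) (hs : 0 < s) (hst : s < t) :
    ∫ y, cutK n ρ (‖y - x‖ ^ 2) (t - s) * u y s ≤ heatMass n * u x t := by
  have hder := fun τ (hτ : τ ∈ Ico s t) =>
    (hasDerivAt_integral_cutK hu x hρ (hs.trans_le hτ.1) hτ.2).2
  have hmono : MonotoneOn (fun τ => ∫ y, cutK n ρ (‖y - x‖ ^ 2) (t - τ) * u y τ) (Ico s t) := by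
    refine monotoneOn_of_deriv_nonneg (convex_Ico s t)
      (fun τ hτ => (hder τ hτ).continuousAt.continuousWithinAt)
      (fun τ hτ => (hder τ (interior_subset hτ)).differentiableAt.differentiableWithinAt)
      fun τ hτ => ?_
    have hτ' := interior_subset hτ
    rw [(hder τ hτ').deriv]
    exact integral_nonneg fun y => mul_nonneg
      (cutK_heat_defect_nonneg n hρ (sq_nonneg _) (sub_pos.2 hτ'.2))
      (hpos y τ (hs.trans_le hτ'.1)).le
  refine ge_of_tendsto (tendsto_integral_cutK hu.1.continuousOn x hρ (hs.trans hst)) ?_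
  filter_upwards [Ioo_mem_nhdsGT (sub_pos.2 hst)] with δ hδ
  have := hmono (left_mem_Ico.2 hst) (show t - δ ∈ Ico s t from
    ⟨by linarith [hδ.2], by linarith [hδ.1]⟩) (by linarith [hδ.2])
  simpa using this

lemma cutK_le_heatK (n : ℕ) {ρ r σ : ℝ} (hρ : 0 < ρ) (hr : 0 ≤ r) (hσ : 0 < σ) :
    cutK n ρ r σ ≤ heatK n r σ := by
  have h0 : 0 ≤ ρ * (r + 2 * n * σ) := by positivity
  exact mul_le_of_le_one_right (heatK_pos _ _ _).le
    (pow_le_one₀ (le_max_right _ _) (max_le (by linarith) zero_le_one))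

lemma integral_heatK_le (hu : IsHeatSolutionOn u (univ ×ˢ Ioi 0))
    (hpos : ∀ x, ∀ t ∈ Ioi (0 : ℝ), 0 < u x t) (x : EuclideanSpace ℝ (Fin n)) {s t : ℝ}
    (hs : 0 < s) (hst : s < t) :
    Integrable (fun y => heatK n (‖y - x‖ ^ 2) (t - s) * u y s) ∧
      ∫ y, heatK n (‖y - x‖ ^ 2) (t - s) * u y s ≤ heatMass n * u x t := by
  have hσ := sub_pos.2 hst
  refine integrable_of_tendsto_of_integral_le
    (f := fun k y => cutK n (1 / ((k : ℝ) + 1)) (‖y - x‖ ^ 2) (t - s) * u y s)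
    (fun k => integrable_cutK_mul hu x (by positivity) hs hσ) (fun k y => ?_) ?_ (fun y => ?_)
    (fun k => integral_cutK_le hu hpos x (by positivity) hs hst) fun y => ?_
  · exact mul_nonneg (mul_nonneg (heatK_pos _ _ _).le (by positivity)) (hpos y s hs).le
  · have h1 := continuous_heatK_r n (t - s)
    have h2 := (hu.contDiff_space hs).continuous
    fun_prop
  · exact mul_nonneg (heatK_pos _ _ _).le (hpos y s hs).le
  · have h1 : Continuous fun ρ => cutK n ρ (‖y - x‖ ^ 2) (t - s) := by
      unfold cutK
      fun_prop
    have h2 := ((h1.tendsto 0).comp tendsto_one_div_add_atTop_nhds_zero_nat).mul_const (u y s)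
    simpa [cutK] using h2

lemma le_integral_heatK (hu : IsHeatSolutionOn u (univ ×ˢ Ioi 0))
    (hpos : ∀ x, ∀ t ∈ Ioi (0 : ℝ), 0 < u x t) (x : EuclideanSpace ℝ (Fin n)) {s t : ℝ}
    (hs : 0 < s) (hst : s < t) :
    heatMass n * u x t ≤ ∫ y, heatK n (‖y - x‖ ^ 2) (t - s) * u y s := by
  have hcu : ContinuousOn (fun τ => u x (2 * t - τ)) (Icc s t) :=
    hu.1.continuousOn.comp (f := fun τ => (x, 2 * t - τ)) (by fun_prop) fun τ hτ =>
      ⟨mem_univ _, by simp only [mem_Ioi]; linarith [hτ.2]⟩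
  obtain ⟨M, hM⟩ := isCompact_Icc.exists_bound_of_continuousOn hcu
  have hm := heatMass_pos n
  set C := 72 * Real.exp (n / 2 * Real.log 2) * (heatMass n * M) with hC
  have hbound : ∀ ρ : ℝ, 0 < ρ →
      heatMass n * u x t ≤ (∫ y, heatK n (‖y - x‖ ^ 2) (t - s) * u y s) + ρ * C * (t - s) := by
    intro ρ hρ
    have hder := fun τ (hτ : τ ∈ Ico s t) =>
      hasDerivAt_integral_cutK hu x hρ (hs.trans_le hτ.1) hτ.2
    have hle : ∀ τ ∈ interior (Ico s t),
        deriv (fun τ => ∫ y, cutK n ρ (‖y - x‖ ^ 2) (t - τ) * u y τ) τ ≤ ρ * C := by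
      intro τ hτ
      have hτ' := interior_subset hτ
      have hτ0 := hs.trans_le hτ'.1
      rw [(hder τ hτ').2.deriv]
      obtain ⟨hint, hKle⟩ := integral_heatK_le hu hpos x hτ0
        (show τ < 2 * t - τ by linarith [hτ'.2])
      rw [show 2 * t - τ - τ = 2 * (t - τ) by ring] at hint hKle
      calc _ ≤ ∫ y, 72 * Real.exp (n / 2 * Real.log 2) * ρ *
              (heatK n (‖y - x‖ ^ 2) (2 * (t - τ)) * u y τ) := by
            refine integral_mono (hder τ hτ').1 (hint.const_mul _) fun y => ?_
            have := mul_le_mul_of_nonneg_right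
              (cutK_heat_defect_le n hρ (sq_nonneg ‖y - x‖) (sub_pos.2 hτ'.2)) (hpos y τ hτ0).le
            simpa only [mul_assoc] using this
        _ ≤ 72 * Real.exp (n / 2 * Real.log 2) * ρ * (heatMass n * M) := by
            rw [integral_const_mul]
            refine mul_le_mul_of_nonneg_left (hKle.trans ?_) (by positivity)
            exact mul_le_mul_of_nonneg_left
              ((le_abs_self _).trans (hM τ ⟨hτ'.1, hτ'.2.le⟩)) hm.le
        _ = ρ * C := by rw [hC]; ring
    have hC0 : 0 ≤ ρ * C := by
      have : 0 ≤ M := (norm_nonneg _).trans (hM s ⟨le_rfl, hst.le⟩)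
      positivity
    refine le_of_tendsto (tendsto_integral_cutK hu.1.continuousOn x hρ (hs.trans hst)) ?_
    filter_upwards [Ioo_mem_nhdsGT (sub_pos.2 hst)] with δ hδ
    have h1 := (convex_Ico s t).image_sub_le_mul_sub_of_deriv_le
      (fun τ hτ => (hder τ hτ).2.continuousAt.continuousWithinAt)
      (fun τ hτ => (hder τ (interior_subset hτ)).2.differentiableAt.differentiableWithinAt)
      hle s (left_mem_Ico.2 hst) (t - δ) ⟨by linarith [hδ.2], by linarith [hδ.1]⟩
      (by linarith [hδ.2])
    simp only [sub_sub_cancel] at h1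
    have h2 : ∫ y, cutK n ρ (‖y - x‖ ^ 2) (t - s) * u y s ≤
        ∫ y, heatK n (‖y - x‖ ^ 2) (t - s) * u y s :=
      integral_mono (integrable_cutK_mul hu x hρ hs (sub_pos.2 hst))
        (integral_heatK_le hu hpos x hs hst).1 fun y => mul_le_mul_of_nonneg_right
          (cutK_le_heatK n hρ (sq_nonneg _) (sub_pos.2 hst)) (hpos y s hs).le
    have h3 : ρ * C * (t - δ - s) ≤ ρ * C * (t - s) :=
      mul_le_mul_of_nonneg_left (by linarith [hδ.1]) hC0
    linarith
  have hlim : Tendsto (fun ρ : ℝ => (∫ y, heatK n (‖y - x‖ ^ 2) (t - s) * u y s)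
      + ρ * C * (t - s)) (𝓝[>] 0) (𝓝 (∫ y, heatK n (‖y - x‖ ^ 2) (t - s) * u y s)) := by
    have : Continuous fun ρ : ℝ => (∫ y, heatK n (‖y - x‖ ^ 2) (t - s) * u y s)
      + ρ * C * (t - s) := by fun_prop
    simpa using (this.tendsto 0).mono_left nhdsWithin_le_nhds
  exact ge_of_tendsto hlim (by filter_upwards [self_mem_nhdsWithin] with ρ hρ using hbound ρ hρ)

end Positive

lemma norm_gradient_le_of_lower_bound {n : ℕ} {f : EuclideanSpace ℝ (Fin n) → ℝ}
    {x : EuclideanSpace ℝ (Fin n)} {A B : ℝ} (hf : DifferentiableAt ℝ f x) (hB : 0 ≤ B)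
    (h : ∀ z, f x - B * ‖z‖ - A * ‖z‖ ^ 2 ≤ f (x + z)) : ‖gradient f x‖ ≤ B := by
  set a := gradient f x with ha
  have hfd : HasFDerivAt f (fderiv ℝ f x) (x + (0 : ℝ) • -a) := by simpa using hf.hasFDerivAt
  have hd : HasDerivAt (fun h : ℝ => f (x + h • -a)) (-‖a‖ ^ 2) 0 := by
    have h1 := hfd.comp_hasDerivAt (0 : ℝ)
      (((hasDerivAt_id (0 : ℝ)).smul_const (-a)).const_add x)
    refine h1.congr_deriv ?_
    have h2 : fderiv ℝ f x a = ‖a‖ ^ 2 := by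
      rw [← real_inner_self_eq_norm_sq, ha, gradient, InnerProductSpace.toDual_symm_apply]
    simp [h2]
  have hd2 : HasDerivAt (fun h : ℝ => f x - B * (h * ‖a‖) - A * (h * ‖a‖) ^ 2) (-(B * ‖a‖)) 0 := by
    have h1 := (hasDerivAt_id (0 : ℝ)).mul_const ‖a‖
    exact (((h1.const_mul B).const_sub (f x)).sub ((h1.pow 2).const_mul A)).congr_deriv (by simp)
  have hs1 := hd.tendsto_slope_zero_right
  have hs2 := hd2.tendsto_slope_zero_right
  have hle : -(B * ‖a‖) ≤ -‖a‖ ^ 2 := by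
    refine le_of_tendsto_of_tendsto hs2 hs1 ?_
    filter_upwards [self_mem_nhdsWithin] with k hk
    have hk0 : 0 < k := hk
    have h1 := h (k • -a)
    rw [norm_smul, norm_neg, Real.norm_of_nonneg hk0.le] at h1
    simp only [zero_add, zero_smul, add_zero, zero_mul, mul_zero, smul_eq_mul]
    refine mul_le_mul_of_nonneg_left ?_ (inv_nonneg.2 hk0.le)
    simpa using h1
  by_contra hcon
  push Not at hcon
  nlinarith

lemma heatK_three_mul (n : ℕ) (r : ℝ) {σ : ℝ} (hσ : 0 < σ) :
    heatK n r (3 * σ) = Real.exp (-(n / 2 * Real.log 3)) * (Real.exp (r / (6 * σ)) *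
      heatK n r σ) := by
  unfold heatK
  rw [Real.log_mul three_ne_zero hσ.ne', ← Real.exp_add, ← Real.exp_add]
  congr 1
  field_simp
  ring

lemma heatK_translate_ge {n : ℕ} (x y z : EuclideanSpace ℝ (Fin n)) {σ : ℝ} (hσ : 0 < σ) :
    (1 - (‖z‖ * √σ + ‖z‖ ^ 2) / (4 * σ)) * heatK n (‖y - x‖ ^ 2) σ
      - ‖z‖ / √σ / (4 * σ) * (‖y - x‖ ^ 2 * heatK n (‖y - x‖ ^ 2) σ) ≤
      heatK n (‖y - (x + z)‖ ^ 2) σ := by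
  have hs : 0 < √σ := Real.sqrt_pos.2 hσ
  have htri : ‖y - (x + z)‖ ≤ ‖y - x‖ + ‖z‖ := by
    rw [← sub_sub]; exact norm_sub_le _ _
  have hsq_le : ‖y - (x + z)‖ ^ 2 ≤ (‖y - x‖ + ‖z‖) ^ 2 :=
    pow_le_pow_left₀ (norm_nonneg _) htri 2
  have hyoung : 2 * ‖y - x‖ ≤ √σ + ‖y - x‖ ^ 2 / √σ := by
    rw [← sub_nonneg]
    have : √σ + ‖y - x‖ ^ 2 / √σ - 2 * ‖y - x‖ = (√σ - ‖y - x‖) ^ 2 / √σ := by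
      field_simp; ring
    rw [this]; positivity
  have hz := mul_le_mul_of_nonneg_left hyoung (norm_nonneg z)
  have hK : heatK n (‖y - (x + z)‖ ^ 2) σ =
      Real.exp ((‖y - x‖ ^ 2 - ‖y - (x + z)‖ ^ 2) / (4 * σ)) * heatK n (‖y - x‖ ^ 2) σ := by
    unfold heatK
    rw [← Real.exp_add]
    congr 1
    ring
  have hlow : 1 - (‖z‖ * √σ + ‖z‖ ^ 2) / (4 * σ) - ‖z‖ / √σ / (4 * σ) * ‖y - x‖ ^ 2 ≤
      Real.exp ((‖y - x‖ ^ 2 - ‖y - (x + z)‖ ^ 2) / (4 * σ)) := by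
    refine le_trans ?_ (Real.add_one_le_exp _)
    have : -(‖z‖ * (√σ + ‖y - x‖ ^ 2 / √σ) + ‖z‖ ^ 2) / (4 * σ) ≤
        (‖y - x‖ ^ 2 - ‖y - (x + z)‖ ^ 2) / (4 * σ) :=
      div_le_div_of_nonneg_right (by nlinarith) (by positivity)
    calc _ = -(‖z‖ * (√σ + ‖y - x‖ ^ 2 / √σ) + ‖z‖ ^ 2) / (4 * σ) + 1 := by ring
      _ ≤ _ := by linarith
  rw [hK]
  have := mul_le_mul_of_nonneg_right hlow (heatK_pos n (‖y - x‖ ^ 2) σ).le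
  linarith

lemma norm_gradient_div_le {n : ℕ} {u : EuclideanSpace ℝ (Fin n) → ℝ → ℝ}
    (hu : IsHeatSolutionOn u (univ ×ˢ Ioi 0)) (hpos : ∀ x, ∀ t ∈ Ioi (0 : ℝ), 0 < u x t)
    (x : EuclideanSpace ℝ (Fin n)) {s : ℝ} (hs : 0 < s) :
    ‖gradient (fun y => u y (2 * s)) x‖ / u x (2 * s) ≤
      (1 + 6 * (n / 2 * Real.log 3 + Real.log (u x (4 * s) / u x (2 * s)))) / (4 * √s) := by
  have hm := heatMass_pos n
  have h2s : 0 < 2 * s := by linarith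
  have hu2 : 0 < u x (2 * s) := hpos x _ h2s
  have hu4 : 0 < u x (4 * s) := hpos x _ (by simp only [mem_Ioi]; linarith)
  have hrs : 0 < √s := Real.sqrt_pos.2 hs
  have e1 : 2 * s - s = s := by ring
  have e3 : 4 * s - s = 3 * s := by ring
  obtain ⟨hint, hle⟩ := integral_heatK_le hu hpos x hs (show s < 2 * s by linarith)
  have hge := le_integral_heatK hu hpos x hs (show s < 2 * s by linarith)
  obtain ⟨hint3, hle3⟩ := integral_heatK_le hu hpos x hs (show s < 4 * s by linarith)
  rw [e1] at hint hle hge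
  rw [e3] at hint3 hle3
  have hN := le_antisymm hle hge
  set w : EuclideanSpace ℝ (Fin n) → ℝ := fun y => heatK n (‖y - x‖ ^ 2) s * u y s with hw
  have hw0 : ∀ y, 0 < w y := fun y => mul_pos (heatK_pos _ _ _) (hpos y s hs)
  have hwc : Continuous w := by
    have h1 := continuous_heatK_r n s
    have h2 := (hu.contDiff_space hs).continuous
    fun_prop
  have e3w : ∀ y, heatK n (‖y - x‖ ^ 2) (3 * s) * u y s =
      Real.exp (-(n / 2 * Real.log 3)) * (Real.exp (‖y - x‖ ^ 2 / (6 * s)) * w y) := fun y => by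
    rw [heatK_three_mul n _ hs, hw]; ring
  simp_rw [e3w] at hint3 hle3
  have hintE : Integrable fun y => Real.exp (‖y - x‖ ^ 2 / (6 * s)) * w y :=
    (integrable_const_mul_iff (Real.exp_pos _).ne'.isUnit _).1 hint3
  rw [integral_const_mul] at hle3
  have hintR : Integrable fun y => ‖y - x‖ ^ 2 * w y := by
    refine (hintE.const_mul (6 * s)).mono' (Continuous.aestronglyMeasurable (by fun_prop))
      (Eventually.of_forall fun y => ?_)
    rw [Real.norm_of_nonneg (mul_nonneg (sq_nonneg _) (hw0 y).le), ← mul_assoc (6 * s)]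
    refine mul_le_mul_of_nonneg_right ?_ (hw0 y).le
    have h1 := Real.add_one_le_exp (‖y - x‖ ^ 2 / (6 * s))
    have h2 : ‖y - x‖ ^ 2 = 6 * s * (‖y - x‖ ^ 2 / (6 * s)) := by field_simp
    calc ‖y - x‖ ^ 2 = 6 * s * (‖y - x‖ ^ 2 / (6 * s)) := h2
      _ ≤ _ := mul_le_mul_of_nonneg_left (by linarith) (by positivity)
  set N := heatMass n * u x (2 * s) with hNdef
  have hN0 : 0 < N := mul_pos hm hu2
  set R := ∫ y, ‖y - x‖ ^ 2 * w y with hR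
  have hR0 : 0 ≤ R := integral_nonneg fun y => mul_nonneg (sq_nonneg _) (hw0 y).le
  set b := R / (6 * s * N) with hb
  have hb0 : 0 ≤ b := by positivity
  have hRb : R = 6 * s * N * b := by rw [hb]; field_simp
  -- Jensen inequality for the exponential, through its tangent line at `b`
  have hjensen : Real.exp b * N ≤ ∫ y, Real.exp (‖y - x‖ ^ 2 / (6 * s)) * w y := by
    have h1 : ∫ y, Real.exp b * ((1 - b) * w y + 1 / (6 * s) * (‖y - x‖ ^ 2 * w y)) =
        Real.exp b * N := by
      rw [integral_const_mul, integral_add (hint.const_mul _) (hintR.const_mul _),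
        integral_const_mul, integral_const_mul, hN, ← hR, hRb]
      field_simp
      ring
    rw [← h1]
    refine integral_mono (((hint.const_mul _).add (hintR.const_mul _)).const_mul _) hintE
      fun y => ?_
    have h2 := Real.add_one_le_exp (‖y - x‖ ^ 2 / (6 * s) - b)
    have h3 : Real.exp (‖y - x‖ ^ 2 / (6 * s)) =
        Real.exp b * Real.exp (‖y - x‖ ^ 2 / (6 * s) - b) := by
      rw [← Real.exp_add]; congr 1; ring
    simp only
    rw [h3, mul_assoc]
    refine mul_le_mul_of_nonneg_left ?_ (Real.exp_nonneg _)
    have h4 := mul_le_mul_of_nonneg_right h2 (hw0 y).le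
    calc _ = (‖y - x‖ ^ 2 / (6 * s) - b + 1) * w y := by ring
      _ ≤ _ := h4
  have hblog : b ≤ n / 2 * Real.log 3 + Real.log (u x (4 * s) / u x (2 * s)) := by
    have h1 : Real.exp (-(n / 2 * Real.log 3)) * (Real.exp b * N) ≤ heatMass n * u x (4 * s) :=
      (mul_le_mul_of_nonneg_left hjensen (Real.exp_nonneg _)).trans hle3
    have h2 : Real.exp (b - n / 2 * Real.log 3) ≤ u x (4 * s) / u x (2 * s) := by
      rw [le_div_iff₀ hu2]
      refine le_of_mul_le_mul_left ?_ hm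
      calc _ = Real.exp (-(n / 2 * Real.log 3)) * (Real.exp b * N) := by
            rw [sub_eq_add_neg, Real.exp_add, hNdef]; ring
        _ ≤ _ := h1
    have h3 := (Real.le_log_iff_exp_le (div_pos hu4 hu2)).2 h2
    linarith
  have hgrad : ‖gradient (fun y => u y (2 * s)) x‖ ≤ u x (2 * s) * ((1 + 6 * b) / (4 * √s)) := by
    refine norm_gradient_le_of_lower_bound (A := u x (2 * s) / (4 * s))
      ((hu.contDiff_space h2s).differentiable two_ne_zero x) (by positivity) fun z => ?_
    obtain ⟨hintz, hlez⟩ := integral_heatK_le hu hpos (x + z) hs (show s < 2 * s by linarith)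
    rw [e1] at hintz hlez
    refine le_of_mul_le_mul_left (le_trans ?_ hlez) hm
    have h1 : ∫ y, ((1 - (‖z‖ * √s + ‖z‖ ^ 2) / (4 * s)) * w y
        - ‖z‖ / √s / (4 * s) * (‖y - x‖ ^ 2 * w y)) =
        heatMass n * (u x (2 * s) - u x (2 * s) * ((1 + 6 * b) / (4 * √s)) * ‖z‖
          - u x (2 * s) / (4 * s) * ‖z‖ ^ 2) := by
      rw [integral_sub (hint.const_mul _) (hintR.const_mul _), integral_const_mul,
        integral_const_mul, hN, ← hR, hRb, hNdef]
      have hss : √s ^ 2 = s := Real.sq_sqrt hs.le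
      rw [← hss, Real.sqrt_sq hrs.le]
      field_simp
      ring
    rw [← h1]
    refine integral_mono ((hint.const_mul _).sub (hintR.const_mul _)) hintz fun y => ?_
    have h2 := mul_le_mul_of_nonneg_right (heatK_translate_ge x y z hs) (hpos y s hs).le
    simp only [hw]
    linarith
  rw [div_le_iff₀ hu2]
  refine hgrad.trans ?_
  rw [mul_comm]
  gcongr

/-- Euclidean case of estimate (1.5) of Theorem 1.1 (no boundedness assumed). -/
theorem gradient_estimate_unbounded (n : ℕ) (hn : 1 ≤ n) :
    ∃ c₁ c₂ : ℝ, 0 < c₁ ∧ 0 < c₂ ∧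
      ∀ u : EuclideanSpace ℝ (Fin n) → ℝ → ℝ,
        IsHeatSolutionOn u (univ ×ˢ Ioi 0) →
        (∀ (x : EuclideanSpace ℝ (Fin n)), ∀ t ∈ Ioi (0:ℝ), 0 < u x t) →
        ∀ (x : EuclideanSpace ℝ (Fin n)), ∀ t ∈ Ioi (0:ℝ),
          ‖sgrad (fun y => u y t) x‖ / u x t ≤
            c₁ / Real.sqrt t * (c₂ + Real.log (u x (2 * t) / u x t)) := by
  refine ⟨6 / (4 * √(1 / 2)), 1 / 6 + n / 2 * Real.log 3, by positivity, ?_, ?_⟩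
  · have := Real.log_pos (show (1 : ℝ) < 3 by norm_num)
    positivity
  · intro u hu hpos x t ht
    have ht0 : 0 < t := ht
    have h := norm_gradient_div_le hu hpos x (half_pos ht0)
    rw [show 2 * (t / 2) = t by ring, show 4 * (t / 2) = 2 * t by ring,
      show t / 2 = 1 / 2 * t by ring, Real.sqrt_mul (by norm_num : (0 : ℝ) ≤ 1 / 2)] at h
    unfold sgrad
    refine h.trans (le_of_eq ?_)
    have hrt : 0 < √t := Real.sqrt_pos.2 ht0
    field_simp
    ring
end

section
/- Let u be a smooth positive solution of the heat equation on all of ℝⁿ × ℝ (a positive eternal solution) such that ln u(x,t) = o(|x| + √|t|) near infinity; precisely, for every ε > 0 there exists K > 0 such that u(x,t) ≤ exp(ε(|x| + √|t|)) whenever |x| + √|t| ≥ K. Then u is constant. (Euclidean case of Theorem 1.2(a); Yau-type Liouville theorem for the heat equation.) -/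
open Metric Set

open MeasureTheory Filter Topology

/-- The unnormalised Gaussian `exp (-‖z‖² / 4)`, i.e. the heat kernel at time one up to a factor. -/
noncomputable def gaussianWeight {n : ℕ} (z : EuclideanSpace ℝ (Fin n)) : ℝ :=
  Real.exp (-‖z‖ ^ 2 / 4)

section Gaussian

variable {n : ℕ}

theorem gaussianWeight_pos (z : EuclideanSpace ℝ (Fin n)) : 0 < gaussianWeight z :=
  Real.exp_pos _

theorem contDiff_gaussianWeight {k : WithTop ℕ∞} :
    ContDiff ℝ k (gaussianWeight : EuclideanSpace ℝ (Fin n) → ℝ) := by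
  unfold gaussianWeight
  exact (((contDiff_norm_sq ℝ).neg).div_const 4).exp

theorem fderiv_gaussianWeight_single (z : EuclideanSpace ℝ (Fin n)) (i : Fin n) :
    fderiv ℝ gaussianWeight z (EuclideanSpace.single i 1) = -(z i / 2) * gaussianWeight z := by
  have h : HasFDerivAt (gaussianWeight : EuclideanSpace ℝ (Fin n) → ℝ) _ z :=
    (((hasStrictFDerivAt_norm_sq z).hasFDerivAt.neg).mul_const (4 : ℝ)⁻¹).exp
  rw [h.fderiv]
  simp [gaussianWeight, EuclideanSpace.inner_single_right, div_eq_mul_inv]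
  ring

/-- Gaussians times exponentials of linear functions of the norm are integrable. -/
theorem integrable_exp_mul_norm_sub_sq (a : ℝ) {b : ℝ} (hb : 0 < b) :
    Integrable (fun z : EuclideanSpace ℝ (Fin n) => Real.exp (a * ‖z‖ - b * ‖z‖ ^ 2)) := by
  have hint : Integrable (fun z : EuclideanSpace ℝ (Fin n) => Real.exp (-(b / 2) * ‖z‖ ^ 2)) := by
    apply Integrable.of_integral_ne_zero
    rw [GaussianFourier.integral_rexp_neg_mul_sq_norm (by positivity)]
    positivity
  refine (hint.const_mul (Real.exp (a ^ 2 / (2 * b)))).mono' (by fun_prop) (ae_of_all _ fun z => ?_)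
  rw [Real.norm_eq_abs, Real.abs_exp, ← Real.exp_add, Real.exp_le_exp]
  have h : a ^ 2 / (2 * b) + -(b / 2) * ‖z‖ ^ 2 - (a * ‖z‖ - b * ‖z‖ ^ 2)
      = (a - b * ‖z‖) ^ 2 / (2 * b) := by
    field_simp
    ring
  have : 0 ≤ (a - b * ‖z‖) ^ 2 / (2 * b) := by positivity
  linarith

theorem integrable_gaussianWeight :
    Integrable (gaussianWeight : EuclideanSpace ℝ (Fin n) → ℝ) := by
  refine (integrable_exp_mul_norm_sub_sq (n := n) 0 (b := 1 / 4) (by norm_num)).congr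
    (ae_of_all _ fun z => ?_)
  simp only [gaussianWeight]
  congr 1
  ring

theorem integral_gaussianWeight_pos :
    0 < ∫ z : EuclideanSpace ℝ (Fin n), gaussianWeight z :=
  integral_exp_pos integrable_gaussianWeight

/-- Integration by parts, moving `z i ∂ᵢ - 2 ∂ᵢ²` onto a compactly supported cutoff in the space
weighted by the Gaussian. -/
theorem integral_cutoff_mul_gaussianWeight_mul {χ W : EuclideanSpace ℝ (Fin n) → ℝ}
    (hχ : ContDiff ℝ 2 χ) (hc : HasCompactSupport χ) (hW : ContDiff ℝ 2 W) (i : Fin n) :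
    ∫ z, χ z * gaussianWeight z * (z i * fderiv ℝ W z (EuclideanSpace.single i 1)
        - 2 * fderiv ℝ (fun y => fderiv ℝ W y (EuclideanSpace.single i 1)) z
            (EuclideanSpace.single i 1))
      = -2 * ∫ z, W z * (gaussianWeight z *
          (fderiv ℝ (fun y => fderiv ℝ χ y (EuclideanSpace.single i 1)) z
            (EuclideanSpace.single i 1) - z i / 2 * fderiv ℝ χ z (EuclideanSpace.single i 1))) := by
  set e : EuclideanSpace ℝ (Fin n) := EuclideanSpace.single i 1 with he
  have hg : ContDiff ℝ 1 (gaussianWeight : EuclideanSpace ℝ (Fin n) → ℝ) := contDiff_gaussianWeight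
  have hχ1 : ContDiff ℝ 1 fun y => fderiv ℝ χ y e :=
    (hχ.fderiv_right (m := 1) (by norm_num)).clm_apply contDiff_const
  have hW1 : ContDiff ℝ 1 fun y => fderiv ℝ W y e :=
    (hW.fderiv_right (m := 1) (by norm_num)).clm_apply contDiff_const
  have hgχ : ContDiff ℝ 1 fun y => gaussianWeight y * fderiv ℝ χ y e := hg.mul hχ1
  have hgW : ContDiff ℝ 1 fun y => gaussianWeight y * fderiv ℝ W y e := hg.mul hW1
  have hχc : HasCompactSupport fun y => fderiv ℝ χ y e := hc.fderiv_apply ℝ e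
  have hgχc : HasCompactSupport fun y => gaussianWeight y * fderiv ℝ χ y e := hχc.mul_left
  have cont {f : EuclideanSpace ℝ (Fin n) → ℝ} (hf : ContDiff ℝ 1 f) :
      Continuous fun y => fderiv ℝ f y e :=
    (hf.continuous_fderiv one_ne_zero).clm_apply continuous_const
  have prod {f : EuclideanSpace ℝ (Fin n) → ℝ} (hf : ContDiff ℝ 1 f)
      (z : EuclideanSpace ℝ (Fin n)) : fderiv ℝ (fun y => gaussianWeight y * f y) z e
        = gaussianWeight z * (fderiv ℝ f z e - z i / 2 * f z) := by
    rw [fderiv_fun_mul (hg.differentiable one_ne_zero z) (hf.differentiable one_ne_zero z)]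
    simp only [add_apply, smul_apply, smul_eq_mul]
    rw [fderiv_gaussianWeight_single]
    ring
  have first : ∫ z, χ z * fderiv ℝ (fun y => gaussianWeight y * fderiv ℝ W y e) z e
      = -∫ z, fderiv ℝ χ z e * (gaussianWeight z * fderiv ℝ W z e) := by
    refine integral_mul_fderiv_eq_neg_fderiv_mul_of_integrable ?_ ?_ ?_
      (fun x _ => hχ.differentiable two_ne_zero x) fun x _ => hgW.differentiable one_ne_zero x
    · exact (hχ1.continuous.mul hgW.continuous).integrable_of_hasCompactSupport hχc.mul_right
    · exact (hχ.continuous.mul (cont hgW)).integrable_of_hasCompactSupport hc.mul_right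
    · exact (hχ.continuous.mul hgW.continuous).integrable_of_hasCompactSupport hc.mul_right
  have second : ∫ z, W z * fderiv ℝ (fun y => gaussianWeight y * fderiv ℝ χ y e) z e
      = -∫ z, fderiv ℝ W z e * (gaussianWeight z * fderiv ℝ χ z e) := by
    refine integral_mul_fderiv_eq_neg_fderiv_mul_of_integrable ?_ ?_ ?_
      (fun x _ => hW.differentiable two_ne_zero x) fun x _ => hgχ.differentiable one_ne_zero x
    · exact (hW1.continuous.mul hgχ.continuous).integrable_of_hasCompactSupport hgχc.mul_left
    · exact (hW.continuous.mul (cont hgχ)).integrable_of_hasCompactSupport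
        (hgχc.fderiv_apply ℝ e).mul_left
    · exact (hW.continuous.mul hgχ.continuous).integrable_of_hasCompactSupport hgχc.mul_left
  simp only [prod hW1] at first
  simp only [prod hχ1] at second
  rw [second]
  have hL : ∀ z, χ z * gaussianWeight z * (z i * fderiv ℝ W z e
        - 2 * fderiv ℝ (fun y => fderiv ℝ W y e) z e)
      = -2 * (χ z * (gaussianWeight z * (fderiv ℝ (fun y => fderiv ℝ W y e) z e
        - z i / 2 * fderiv ℝ W z e))) := fun z => by ring
  simp only [hL]
  rw [integral_const_mul, first]
  congr 3
  funext z
  ring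

/-- Differentiation under the integral sign against a continuous compactly supported weight. -/
theorem hasDerivAt_integral_mul_of_hasCompactSupport {φ : EuclideanSpace ℝ (Fin n) → ℝ}
    (hφ : Continuous φ) (hc : HasCompactSupport φ) {U : EuclideanSpace ℝ (Fin n) → ℝ → ℝ}
    (hU : ContDiff ℝ 1 fun p : EuclideanSpace ℝ (Fin n) × ℝ => U p.1 p.2) (r : ℝ) :
    HasDerivAt (fun s => ∫ z, φ z * U z s) (∫ z, φ z * deriv (U z) r) r := by
  have hd (z : EuclideanSpace ℝ (Fin n)) (s : ℝ) : HasDerivAt (U z)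
      (fderiv ℝ (fun p : EuclideanSpace ℝ (Fin n) × ℝ => U p.1 p.2) (z, s) (0, 1)) s :=
    HasFDerivAt.comp_hasDerivAt s (hU.differentiable one_ne_zero (z, s)).hasFDerivAt
      ((hasDerivAt_const s z).prodMk (hasDerivAt_id s))
  have hcont : Continuous fun p : EuclideanSpace ℝ (Fin n) × ℝ => deriv (U p.1) p.2 := by
    simp only [fun p : EuclideanSpace ℝ (Fin n) × ℝ => (hd p.1 p.2).deriv]
    exact (hU.continuous_fderiv one_ne_zero).clm_apply continuous_const
  obtain ⟨C, hC⟩ := (hc.isCompact.prod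
    (isCompact_Icc (a := r - 1) (b := r + 1))).exists_bound_of_continuousOn hcont.continuousOn
  have hUz (s : ℝ) : Continuous fun z => U z s :=
    hU.continuous.comp (continuous_id.prodMk continuous_const)
  have hUz' (s : ℝ) : Continuous fun z => deriv (U z) s :=
    hcont.comp (continuous_id.prodMk continuous_const)
  refine (hasDerivAt_integral_of_dominated_loc_of_deriv_le (bound := fun z => ‖φ z‖ * C)
    (F' := fun s z => φ z * deriv (U z) s)
    (Icc_mem_nhds (a := r - 1) (b := r + 1) (by linarith) (by linarith))
    (Eventually.of_forall fun s => (hφ.mul (hUz s)).aestronglyMeasurable)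
    ((hφ.mul (hUz r)).integrable_of_hasCompactSupport hc.mul_right)
    (hφ.mul (hUz' r)).aestronglyMeasurable (ae_of_all _ fun z s hs => ?_)
    ((hφ.norm.integrable_of_hasCompactSupport hc.norm).mul_const C)
    (ae_of_all _ fun z s _ => (hd z s).differentiableAt.hasDerivAt.const_mul (φ z))).2
  rw [norm_mul]
  by_cases hz : z ∈ tsupport φ
  · exact mul_le_mul_of_nonneg_left (hC (z, s) ⟨hz, hs⟩) (norm_nonneg _)
  · simp [image_eq_zero_of_notMem_tsupport hz]

end Gaussian

section Heat

variable {n : ℕ}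

theorem fderiv_comp_sub_smul {f : EuclideanSpace ℝ (Fin n) → ℝ} (hf : Differentiable ℝ f)
    (x : EuclideanSpace ℝ (Fin n)) (r : ℝ) (z e : EuclideanSpace ℝ (Fin n)) :
    fderiv ℝ (fun y => f (x - r • y)) z e = -r * fderiv ℝ f (x - r • z) e := by
  have h := (hf (x - r • z)).hasFDerivAt.comp z (((hasFDerivAt_id z).const_smul r).const_sub x)
  have h' : fderiv ℝ (fun y => f (x - r • y)) z = _ := h.fderiv
  rw [h']
  simp

theorem fderiv_fderiv_comp_sub_smul {f : EuclideanSpace ℝ (Fin n) → ℝ} (hf : ContDiff ℝ 2 f)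
    (x : EuclideanSpace ℝ (Fin n)) (r : ℝ) (z e : EuclideanSpace ℝ (Fin n)) :
    fderiv ℝ (fun y => fderiv ℝ (fun w => f (x - r • w)) y e) z e
      = r ^ 2 * fderiv ℝ (fun y => fderiv ℝ f y e) (x - r • z) e := by
  have hd : Differentiable ℝ fun y => fderiv ℝ f y e :=
    ((hf.fderiv_right (m := 1) (by norm_num)).clm_apply contDiff_const).differentiable one_ne_zero
  simp only [fderiv_comp_sub_smul (hf.differentiable two_ne_zero)]
  have hd' : DifferentiableAt ℝ (fun y => fderiv ℝ f (x - r • y) e) z :=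
    hd.comp (g := fun y => fderiv ℝ f y e) (f := fun y => x - r • y) (by fun_prop) z
  rw [fderiv_const_mul hd']
  simp only [smul_apply, smul_eq_mul]
  rw [fderiv_comp_sub_smul hd x r z e]
  ring

theorem contDiff_parabolic_rescaling {u : EuclideanSpace ℝ (Fin n) → ℝ → ℝ}
    (hu : ContDiff ℝ 2 fun p : EuclideanSpace ℝ (Fin n) × ℝ => u p.1 p.2)
    (x : EuclideanSpace ℝ (Fin n)) (t : ℝ) :
    ContDiff ℝ 2 fun p : EuclideanSpace ℝ (Fin n) × ℝ => u (x - p.2 • p.1) (t - p.2 ^ 2) := by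
  have h : ContDiff ℝ 2 fun p : EuclideanSpace ℝ (Fin n) × ℝ => (x - p.2 • p.1, t - p.2 ^ 2) := by
    fun_prop
  exact hu.comp h

/-- In the variables of the parabolic rescaling, the heat equation reads
`r ∂ᵣ = z · ∇ - 2 Δ`. -/
theorem mul_deriv_parabolic_rescaling {u : EuclideanSpace ℝ (Fin n) → ℝ → ℝ}
    (hu : ContDiff ℝ 2 fun p : EuclideanSpace ℝ (Fin n) × ℝ => u p.1 p.2)
    (heat : ∀ x t, deriv (fun s => u x s) t = slap (fun y => u y t) x)
    (x z : EuclideanSpace ℝ (Fin n)) (t r : ℝ) :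
    r * deriv (fun s => u (x - s • z) (t - s ^ 2)) r
      = ∑ i, (z i * fderiv ℝ (fun y => u (x - r • y) (t - r ^ 2)) z (EuclideanSpace.single i 1)
        - 2 * fderiv ℝ (fun y => fderiv ℝ (fun y => u (x - r • y) (t - r ^ 2)) y
            (EuclideanSpace.single i 1)) z (EuclideanSpace.single i 1)) := by
  set v : EuclideanSpace ℝ (Fin n) × ℝ → ℝ := fun p => u p.1 p.2 with hv
  set p : EuclideanSpace ℝ (Fin n) × ℝ := (x - r • z, t - r ^ 2) with hp
  have hvp : HasFDerivAt v (fderiv ℝ v p) p := (hu.differentiable two_ne_zero p).hasFDerivAt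
  have hslice : ContDiff ℝ 2 fun y => u y (t - r ^ 2) :=
    hu.comp (contDiff_id.prodMk contDiff_const)
  have hspace (w : EuclideanSpace ℝ (Fin n)) :
      fderiv ℝ (fun y => u y (t - r ^ 2)) (x - r • z) w = fderiv ℝ v p (w, 0) := by
    have h := HasFDerivAt.comp (g := v) (f := fun y => (y, t - r ^ 2)) (x - r • z) hvp
      ((hasFDerivAt_id (x - r • z)).prodMk (hasFDerivAt_const (t - r ^ 2) (x - r • z)))
    have h' : fderiv ℝ (fun y => u y (t - r ^ 2)) (x - r • z) = _ := h.fderiv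
    rw [h']
    simp
  have htime : deriv (fun s => u (x - r • z) s) (t - r ^ 2) = fderiv ℝ v p (0, 1) := by
    have h := HasFDerivAt.comp_hasDerivAt (l := v) (f := fun s => (x - r • z, s)) (t - r ^ 2) hvp
      ((hasDerivAt_const (t - r ^ 2) (x - r • z)).prodMk (hasDerivAt_id (t - r ^ 2)))
    exact h.deriv
  have hcurve : deriv (fun s => u (x - s • z) (t - s ^ 2)) r = fderiv ℝ v p (-z, -(2 * r)) := by
    have h := HasFDerivAt.comp_hasDerivAt (l := v) (f := fun s => (x - s • z, t - s ^ 2)) r hvp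
      ((((hasDerivAt_id r).smul_const z).const_sub x).prodMk ((hasDerivAt_pow 2 r).const_sub t))
    have h' : deriv (fun s => u (x - s • z) (t - s ^ 2)) r = _ := h.deriv
    rw [h']
    simp
  have hsplit : ((-z, -(2 * r)) : EuclideanSpace ℝ (Fin n) × ℝ)
      = -(z, 0) - (2 * r) • ((0 : EuclideanSpace ℝ (Fin n)), (1 : ℝ)) := by
    ext <;> simp
  have hcoord : fderiv ℝ v p (z, 0)
      = ∑ i, z i * fderiv ℝ (fun y => u y (t - r ^ 2)) (x - r • z) (EuclideanSpace.single i 1) := by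
    have hz : z = ∑ i, z i • EuclideanSpace.single i (1 : ℝ) := by
      ext j
      simp [Finset.sum_apply, Pi.single_apply]
    rw [← hspace]
    conv_lhs => arg 2; rw [hz]
    rw [map_sum]
    simp only [map_smul, smul_eq_mul]
  rw [hcurve, hsplit, map_sub, map_neg, map_smul, ← htime, heat, hcoord, slap]
  simp only [fderiv_fderiv_comp_sub_smul hslice]
  simp only [fderiv_comp_sub_smul (hslice.differentiable two_ne_zero), Finset.sum_sub_distrib, smul_eq_mul, mul_sub, mul_neg,
    Finset.mul_sum]
  rw [← Finset.sum_neg_distrib]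
  congr 1
  · exact Finset.sum_congr rfl fun i _ => by ring
  · exact Finset.sum_congr rfl fun i _ => by ring

/-- A cutoff function with bounded first and second derivatives. -/
theorem exists_cutoff : ∃ (χ : EuclideanSpace ℝ (Fin n) → ℝ) (B : ℝ), ContDiff ℝ 2 χ ∧
    HasCompactSupport χ ∧ χ 0 = 1 ∧ (∀ z, |χ z| ≤ 1) ∧ 0 ≤ B ∧
    ∀ i z, |fderiv ℝ χ z (EuclideanSpace.single i 1)| ≤ B ∧
      |fderiv ℝ (fun y => fderiv ℝ χ y (EuclideanSpace.single i 1)) z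
        (EuclideanSpace.single i 1)| ≤ B := by
  let χ : ContDiffBump (0 : EuclideanSpace ℝ (Fin n)) := ⟨1, 2, one_pos, one_lt_two⟩
  have hχ : ContDiff ℝ 2 χ := χ.contDiff
  have hχ1 (i : Fin n) : ContDiff ℝ 1 fun y => fderiv ℝ χ y (EuclideanSpace.single i 1) :=
    (hχ.fderiv_right (m := 1) (by norm_num)).clm_apply contDiff_const
  have hχc (i : Fin n) : HasCompactSupport fun y => fderiv ℝ χ y (EuclideanSpace.single i 1) :=
    χ.hasCompactSupport.fderiv_apply ℝ _
  choose B₁ hB₁ using fun i => (hχ1 i).continuous.bounded_above_of_compact_support (hχc i)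
  choose B₂ hB₂ using fun i =>
    (((hχ1 i).continuous_fderiv one_ne_zero).clm_apply
      (continuous_const (y := EuclideanSpace.single i (1 : ℝ)))).bounded_above_of_compact_support
      ((hχc i).fderiv_apply ℝ _)
  have hle (i : Fin n) : |B₁ i| + |B₂ i| ≤ ∑ i, (|B₁ i| + |B₂ i|) :=
    Finset.single_le_sum (f := fun i => |B₁ i| + |B₂ i|) (fun i _ => by positivity)
      (Finset.mem_univ i)
  refine ⟨χ, ∑ i, (|B₁ i| + |B₂ i|), hχ, χ.hasCompactSupport,
    χ.one_of_mem_closedBall (by simp [χ]), fun z => ?_, by positivity, fun i z => ⟨?_, ?_⟩⟩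
  · rw [abs_of_nonneg χ.nonneg]
    exact χ.le_one
  · have := hB₁ i z
    rw [Real.norm_eq_abs] at this
    linarith [hle i, le_abs_self (B₁ i), abs_nonneg (B₂ i)]
  · have := hB₂ i z
    rw [Real.norm_eq_abs] at this
    linarith [hle i, le_abs_self (B₂ i), abs_nonneg (B₁ i)]

theorem norm_add_sqrt_parabolic_le (x z : EuclideanSpace ℝ (Fin n)) (t : ℝ) {r : ℝ} (hr : 0 ≤ r) :
    ‖x - r • z‖ + √|t - r ^ 2| ≤ ‖x‖ + √|t| + r + r * ‖z‖ := by
  have h₁ : ‖x - r • z‖ ≤ ‖x‖ + r * ‖z‖ := by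
    refine (norm_sub_le _ _).trans_eq ?_
    rw [norm_smul, Real.norm_of_nonneg hr]
  have h₂ : √|t - r ^ 2| ≤ √|t| + r := by
    refine Real.sqrt_le_iff.2 ⟨by positivity, ?_⟩
    have h₃ : |t - r ^ 2| ≤ |t| + r ^ 2 := by
      refine (abs_sub _ _).trans_eq ?_
      rw [abs_of_nonneg (sq_nonneg r)]
    nlinarith [Real.sq_sqrt (abs_nonneg t), mul_nonneg (Real.sqrt_nonneg |t|) hr]
  linarith

/-- A function of at most exponential growth in `‖x‖ + √|t|` stays, on parabolic rescalings
of bounded size, below an exponential of the norm. -/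
theorem abs_parabolic_rescaling_le {u : EuclideanSpace ℝ (Fin n) → ℝ → ℝ} {M : ℝ} (hM0 : 0 ≤ M)
    (hM : ∀ x t, |u x t| ≤ M * Real.exp (‖x‖ + √|t|))
    (x z : EuclideanSpace ℝ (Fin n)) (t : ℝ) {r a : ℝ} (hr : 0 ≤ r) (hra : r ≤ a) :
    |u (x - r • z) (t - r ^ 2)| ≤ M * Real.exp (‖x‖ + √|t| + a) * Real.exp (a * ‖z‖) := by
  refine (hM _ _).trans ?_
  rw [mul_assoc, ← Real.exp_add]
  refine mul_le_mul_of_nonneg_left (Real.exp_le_exp.2 ?_) hM0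
  have := norm_add_sqrt_parabolic_le x z t hr
  have : r * ‖z‖ ≤ a * ‖z‖ := by gcongr
  linarith

theorem integrable_exp_mul_norm_mul_gaussianWeight (a : ℝ) :
    Integrable fun z : EuclideanSpace ℝ (Fin n) => Real.exp (a * ‖z‖) * gaussianWeight z := by
  refine (integrable_exp_mul_norm_sub_sq a (b := 1 / 4) (by norm_num)).congr
    (ae_of_all _ fun z => ?_)
  simp only [gaussianWeight, ← Real.exp_add]
  congr 1
  ring

/-- Almost conservation of the Gaussian average with cutoff `χ (ρ z)` as `ρ → 0`. -/
theorem abs_deriv_cutoff_average_le {u : EuclideanSpace ℝ (Fin n) → ℝ → ℝ}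
    (hu : ContDiff ℝ 2 fun p : EuclideanSpace ℝ (Fin n) × ℝ => u p.1 p.2)
    (heat : ∀ x t, deriv (fun s => u x s) t = slap (fun y => u y t) x)
    {M : ℝ} (hM0 : 0 ≤ M) (hM : ∀ x t, |u x t| ≤ M * Real.exp (‖x‖ + √|t|))
    {χ : EuclideanSpace ℝ (Fin n) → ℝ} (hχ : ContDiff ℝ 2 χ) (hc : HasCompactSupport χ)
    {B : ℝ} (hB0 : 0 ≤ B)
    (hB : ∀ i z, |fderiv ℝ χ z (EuclideanSpace.single i 1)| ≤ B ∧
      |fderiv ℝ (fun y => fderiv ℝ χ y (EuclideanSpace.single i 1)) z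
        (EuclideanSpace.single i 1)| ≤ B)
    (x : EuclideanSpace ℝ (Fin n)) (t : ℝ) {r a ρ : ℝ} (hr : 0 < r) (hra : r ≤ a)
    (hρ : 0 < ρ) (hρ1 : ρ ≤ 1) :
    ∃ D, HasDerivAt
      (fun s => ∫ z, χ (ρ • z) * gaussianWeight z * u (x - s • z) (t - s ^ 2)) D r ∧
      |r * D| ≤ ρ * (n * (2 * (B * (M * Real.exp (‖x‖ + √|t| + a)) *
        ∫ z : EuclideanSpace ℝ (Fin n), Real.exp ((a + 1) * ‖z‖) * gaussianWeight z))) := by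
  set χρ : EuclideanSpace ℝ (Fin n) → ℝ := fun z => χ (ρ • z) with hχρ
  have hχρ_eq : χρ = fun z => χ (0 - (-ρ) • z) := by
    funext z
    simp [hχρ]
  have hχρ2 : ContDiff ℝ 2 χρ := hχ.comp (contDiff_const_smul ρ)
  have hχρc : HasCompactSupport χρ := hc.comp_smul hρ.ne'
  have hgc : Continuous (gaussianWeight : EuclideanSpace ℝ (Fin n) → ℝ) :=
    (contDiff_gaussianWeight (k := 0)).continuous
  have hresc := contDiff_parabolic_rescaling hu x t
  have hder := hasDerivAt_integral_mul_of_hasCompactSupport (φ := fun z => χρ z * gaussianWeight z)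
    (hχρ2.continuous.mul hgc) hχρc.mul_right (U := fun z s => u (x - s • z) (t - s ^ 2))
    (hresc.of_le one_le_two) r
  refine ⟨_, hder, ?_⟩
  set W : EuclideanSpace ℝ (Fin n) → ℝ := fun z => u (x - r • z) (t - r ^ 2) with hW
  have hW2 : ContDiff ℝ 2 W := hresc.comp (contDiff_id.prodMk contDiff_const)
  have hterm (i : Fin n) : Integrable fun z => χρ z * gaussianWeight z *
      (z i * fderiv ℝ W z (EuclideanSpace.single i 1)
        - 2 * fderiv ℝ (fun y => fderiv ℝ W y (EuclideanSpace.single i 1)) z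
            (EuclideanSpace.single i 1)) := by
    have hW1 : ContDiff ℝ 1 fun y => fderiv ℝ W y (EuclideanSpace.single i 1) :=
      (hW2.fderiv_right (m := 1) (by norm_num)).clm_apply contDiff_const
    have hW1' := (hW1.continuous_fderiv one_ne_zero).clm_apply
      (continuous_const (y := EuclideanSpace.single i (1 : ℝ)))
    refine Continuous.integrable_of_hasCompactSupport ?_ hχρc.mul_right.mul_right
    refine (hχρ2.continuous.mul hgc).mul (Continuous.sub ?_ (continuous_const.mul hW1'))
    exact Continuous.mul (by fun_prop) hW1.continuous
  have hsum : r * ∫ z, χρ z * gaussianWeight z * deriv (fun s => u (x - s • z) (t - s ^ 2)) r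
      = ∑ i, -2 * ∫ z, W z * (gaussianWeight z *
          (fderiv ℝ (fun y => fderiv ℝ χρ y (EuclideanSpace.single i 1)) z
            (EuclideanSpace.single i 1)
            - z i / 2 * fderiv ℝ χρ z (EuclideanSpace.single i 1))) := by
    simp only [← integral_cutoff_mul_gaussianWeight_mul hχρ2 hχρc hW2]
    rw [← integral_const_mul, ← integral_finsetSum _ fun i _ => hterm i]
    refine integral_congr_ae (ae_of_all _ fun z => ?_)
    simp only [← Finset.mul_sum]
    rw [hW, ← mul_deriv_parabolic_rescaling hu heat x z t r]
    ring
  have hpt (i : Fin n) (z : EuclideanSpace ℝ (Fin n)) : ‖W z * (gaussianWeight z *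
          (fderiv ℝ (fun y => fderiv ℝ χρ y (EuclideanSpace.single i 1)) z
            (EuclideanSpace.single i 1)
            - z i / 2 * fderiv ℝ χρ z (EuclideanSpace.single i 1)))‖
      ≤ ρ * (B * (M * Real.exp (‖x‖ + √|t| + a))) *
        (Real.exp ((a + 1) * ‖z‖) * gaussianWeight z) := by
    have h₁ : |fderiv ℝ χρ z (EuclideanSpace.single i 1)| ≤ ρ * B := by
      rw [hχρ_eq, fderiv_comp_sub_smul (hχ.differentiable two_ne_zero), abs_mul, neg_neg,
        abs_of_pos hρ]
      gcongr
      exact (hB i _).1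
    have h₂ : |fderiv ℝ (fun y => fderiv ℝ χρ y (EuclideanSpace.single i 1)) z
            (EuclideanSpace.single i 1)| ≤ ρ * B := by
      rw [hχρ_eq, fderiv_fderiv_comp_sub_smul hχ, abs_mul, neg_sq, abs_of_pos (by positivity)]
      have := (hB i (0 - (-ρ) • z)).2
      gcongr
      nlinarith
    have h₃ : |z i| ≤ ‖z‖ := PiLp.norm_apply_le z i
    have h₄ : |fderiv ℝ (fun y => fderiv ℝ χρ y (EuclideanSpace.single i 1)) z
            (EuclideanSpace.single i 1)
            - z i / 2 * fderiv ℝ χρ z (EuclideanSpace.single i 1)| ≤ ρ * B * Real.exp ‖z‖ := by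
      have h₅ : |z i / 2 * fderiv ℝ χρ z (EuclideanSpace.single i 1)| ≤ ‖z‖ * (ρ * B) := by
        rw [abs_mul]
        gcongr
        rw [abs_div, abs_two]
        linarith [abs_nonneg (z i)]
      have h₆ : ρ * B * (‖z‖ + 1) ≤ ρ * B * Real.exp ‖z‖ := by
        gcongr
        exact Real.add_one_le_exp _
      refine (abs_sub _ _).trans ?_
      linarith
    have h₇ := abs_parabolic_rescaling_le hM0 hM x z t hr.le hra
    rw [Real.norm_eq_abs, abs_mul, abs_mul, abs_of_pos (gaussianWeight_pos z)]
    calc |W z| * (gaussianWeight z * |_|)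
        ≤ (M * Real.exp (‖x‖ + √|t| + a) * Real.exp (a * ‖z‖)) *
          (gaussianWeight z * (ρ * B * Real.exp ‖z‖)) := by
          have := (gaussianWeight_pos z).le
          gcongr
      _ = _ := by
          rw [add_mul, one_mul, Real.exp_add (a * ‖z‖)]
          ring
  rw [hsum]
  refine (Finset.abs_sum_le_sum_abs _ _).trans ?_
  refine (Finset.sum_le_card_nsmul _ _ (2 * (ρ * (B * (M * Real.exp (‖x‖ + √|t| + a))) *
    ∫ z : EuclideanSpace ℝ (Fin n), Real.exp ((a + 1) * ‖z‖) * gaussianWeight z))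
    fun i _ => ?_).trans_eq ?_
  · rw [abs_mul, abs_neg, abs_two, ← integral_const_mul]
    gcongr
    exact norm_integral_le_of_norm_le
      ((integrable_exp_mul_norm_mul_gaussianWeight (a + 1)).const_mul _) (ae_of_all _ (hpt i))
  · simp only [Finset.card_univ, Fintype.card_fin, nsmul_eq_mul]
    ring

/-- Representation of a solution of the heat equation of exponential growth by Gaussian averages
over earlier times. -/
theorem integral_gaussianWeight_mul_parabolic_rescaling {u : EuclideanSpace ℝ (Fin n) → ℝ → ℝ}
    (hu : ContDiff ℝ 2 fun p : EuclideanSpace ℝ (Fin n) × ℝ => u p.1 p.2)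
    (heat : ∀ x t, deriv (fun s => u x s) t = slap (fun y => u y t) x)
    {M : ℝ} (hM0 : 0 ≤ M) (hM : ∀ x t, |u x t| ≤ M * Real.exp (‖x‖ + √|t|))
    (x : EuclideanSpace ℝ (Fin n)) (t : ℝ) {a : ℝ} (ha : 0 < a) :
    ∫ z, gaussianWeight z * u (x - a • z) (t - a ^ 2)
      = (∫ z : EuclideanSpace ℝ (Fin n), gaussianWeight z) * u x t := by
  obtain ⟨χ, B, hχ, hc, hχ0, hχ1, hB0, hB⟩ := exists_cutoff (n := n)
  have hgc : Continuous (gaussianWeight : EuclideanSpace ℝ (Fin n) → ℝ) :=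
    (contDiff_gaussianWeight (k := 0)).continuous
  have hresc := (contDiff_parabolic_rescaling hu x t).continuous
  have hcont (r : ℝ) : Continuous fun z => u (x - r • z) (t - r ^ 2) :=
    hresc.comp (continuous_id.prodMk continuous_const)
  have hdom := (integrable_exp_mul_norm_mul_gaussianWeight (n := n) a).const_mul
    (M * Real.exp (‖x‖ + √|t| + a))
  have hbound {r : ℝ} (hr : 0 ≤ r) (hra : r ≤ a) (z : EuclideanSpace ℝ (Fin n)) :
      |gaussianWeight z * u (x - r • z) (t - r ^ 2)|
        ≤ M * Real.exp (‖x‖ + √|t| + a) * (Real.exp (a * ‖z‖) * gaussianWeight z) := by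
    rw [abs_mul, abs_of_pos (gaussianWeight_pos z), mul_comm, ← mul_assoc]
    exact mul_le_mul_of_nonneg_right (abs_parabolic_rescaling_le hM0 hM x z t hr hra)
      (gaussianWeight_pos z).le
  have hlim {r : ℝ} (hr : 0 ≤ r) (hra : r ≤ a) : Tendsto
      (fun ρ : ℝ => ∫ z, χ (ρ • z) * gaussianWeight z * u (x - r • z) (t - r ^ 2)) (𝓝[>] 0)
      (𝓝 (∫ z, gaussianWeight z * u (x - r • z) (t - r ^ 2))) := by
    refine tendsto_integral_filter_of_dominated_convergence _ (Eventually.of_forall fun ρ => ?_)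
      (Eventually.of_forall fun ρ => ae_of_all _ fun z => ?_) hdom (ae_of_all _ fun z => ?_)
    · exact (((hχ.continuous.comp (continuous_const_smul ρ)).mul hgc).mul
        (hcont r)).aestronglyMeasurable
    · rw [Real.norm_eq_abs, mul_assoc, abs_mul]
      refine (mul_le_of_le_one_left (abs_nonneg _) (hχ1 _)).trans (hbound hr hra z)
    · have h : Tendsto (fun ρ : ℝ => χ (ρ • z)) (𝓝[>] 0) (𝓝 1) := by
        have h' : Continuous fun ρ : ℝ => χ (ρ • z) := hχ.continuous.comp (by fun_prop)
        have := (h'.tendsto 0).mono_left (nhdsWithin_le_nhds (s := Ioi 0))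
        simpa [hχ0] using this
      simpa [mul_assoc] using h.mul_const (gaussianWeight z * u (x - r • z) (t - r ^ 2))
  have hconst {r : ℝ} (hr : 0 < r) (hra : r ≤ a) :
      ∫ z, gaussianWeight z * u (x - a • z) (t - a ^ 2)
        = ∫ z, gaussianWeight z * u (x - r • z) (t - r ^ 2) := by
    set C : ℝ := n * (2 * (B * (M * Real.exp (‖x‖ + √|t| + a)) *
        ∫ z : EuclideanSpace ℝ (Fin n), Real.exp ((a + 1) * ‖z‖) * gaussianWeight z)) with hC
    have hmv : ∀ᶠ ρ : ℝ in 𝓝[>] 0,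
        ‖(∫ z, χ (ρ • z) * gaussianWeight z * u (x - a • z) (t - a ^ 2))
          - ∫ z, χ (ρ • z) * gaussianWeight z * u (x - r • z) (t - r ^ 2)‖
          ≤ ρ * C / r * (a - r) := by
      filter_upwards [Ioc_mem_nhdsGT (zero_lt_one (α := ℝ))] with ρ hρ
      choose! D hD hDle using fun (s : ℝ) (hs : s ∈ Icc r a) =>
        abs_deriv_cutoff_average_le hu heat hM0 hM hχ hc hB0 hB x t (hr.trans_le hs.1) hs.2
          hρ.1 hρ.2
      refine norm_image_sub_le_of_norm_deriv_le_segment' (f' := D)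
        (f := fun s => ∫ z, χ (ρ • z) * gaussianWeight z * u (x - s • z) (t - s ^ 2))
        (fun s hs => (hD s hs).hasDerivWithinAt) (fun s hs => ?_) a ⟨hra, le_rfl⟩
      have h := hDle s ⟨hs.1, hs.2.le⟩
      rw [abs_mul, abs_of_pos (hr.trans_le hs.1)] at h
      rw [Real.norm_eq_abs, le_div_iff₀ hr, mul_comm]
      exact (mul_le_mul_of_nonneg_right hs.1 (abs_nonneg _)).trans h
    have hzero : Tendsto (fun ρ : ℝ => ρ * C / r * (a - r)) (𝓝[>] 0) (𝓝 0) := by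
      have h' : Continuous fun ρ : ℝ => ρ * C / r * (a - r) := by fun_prop
      simpa using (h'.tendsto 0).mono_left (nhdsWithin_le_nhds (s := Ioi 0))
    have := le_of_tendsto_of_tendsto ((hlim ha.le le_rfl).sub (hlim hr.le hra)).norm hzero hmv
    exact sub_eq_zero.1 (norm_le_zero_iff.1 this)
  have hsmall : Tendsto (fun r : ℝ => ∫ z, gaussianWeight z * u (x - r • z) (t - r ^ 2)) (𝓝[>] 0)
      (𝓝 (∫ z : EuclideanSpace ℝ (Fin n), gaussianWeight z * u x t)) := by
    refine tendsto_integral_filter_of_dominated_convergence _ (Eventually.of_forall fun r => ?_)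
      ?_ hdom (ae_of_all _ fun z => ?_)
    · exact (hgc.mul (hcont r)).aestronglyMeasurable
    · filter_upwards [Ioc_mem_nhdsGT ha] with r hr
      exact ae_of_all _ fun z => hbound hr.1.le hr.2 z
    · have h' : Continuous fun r : ℝ => gaussianWeight z * u (x - r • z) (t - r ^ 2) :=
        continuous_const.mul (hresc.comp (continuous_const.prodMk continuous_id))
      simpa using (h'.tendsto 0).mono_left (nhdsWithin_le_nhds (s := Ioi 0))
  rw [← integral_mul_const]
  refine tendsto_nhds_unique (tendsto_const_nhds.congr' ?_) hsmall
  filter_upwards [Ioc_mem_nhdsGT ha] with r hr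
  exact hconst hr.1 hr.2

theorem exists_le_mul_exp_of_subexponential {u : EuclideanSpace ℝ (Fin n) → ℝ → ℝ}
    (hu : Continuous fun p : EuclideanSpace ℝ (Fin n) × ℝ => u p.1 p.2)
    (hgrowth : ∀ ε : ℝ, 0 < ε → ∃ K : ℝ, 0 < K ∧
      ∀ (x : EuclideanSpace ℝ (Fin n)) (t : ℝ), K ≤ ‖x‖ + √|t| →
        u x t ≤ Real.exp (ε * (‖x‖ + √|t|)))
    (ε : ℝ) (hε : 0 < ε) :
    ∃ M : ℝ, 0 ≤ M ∧ ∀ x t, u x t ≤ M * Real.exp (ε * (‖x‖ + √|t|)) := by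
  obtain ⟨K, hK, hgr⟩ := hgrowth ε hε
  obtain ⟨C, hC⟩ := ((isCompact_closedBall (0 : EuclideanSpace ℝ (Fin n)) K).prod
    (isCompact_Icc (a := -K ^ 2) (b := K ^ 2))).exists_bound_of_continuousOn hu.continuousOn
  refine ⟨max C 1, by positivity, fun x t => ?_⟩
  rcases le_or_gt K (‖x‖ + √|t|) with h | h
  · exact (hgr x t h).trans (le_mul_of_one_le_left (Real.exp_pos _).le (le_max_right _ _))
  · have hx : ‖x‖ ≤ K := by linarith [Real.sqrt_nonneg |t|]
    have ht : |t| ≤ K ^ 2 := (Real.sqrt_le_left hK.le).1 (by linarith [norm_nonneg x])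
    have hxt := hC (x, t) ⟨by simpa using hx, abs_le.1 ht⟩
    calc u x t ≤ max C 1 := (le_abs_self _).trans (hxt.trans (le_max_left _ _))
      _ ≤ _ := le_mul_of_one_le_right (by positivity) (Real.one_le_exp (by positivity))

/-- The Gaussian translated by `r⁻¹ • h` is controlled by the Gaussian itself where `‖z‖ ≤ δ r`,
and beats the subexponential growth elsewhere. -/
theorem gaussianWeight_add_mul_le {v M ε δ r N : ℝ} (hv0 : 0 ≤ v) (hM : 0 ≤ M) (hδ : 0 < δ)
    (hε : ε = δ / 16) (hr : 1 ≤ r) (z h : EuclideanSpace ℝ (Fin n))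
    (hv : v ≤ M * Real.exp (ε * (N + r + r * ‖z‖))) :
    gaussianWeight (z + r⁻¹ • h) * v ≤ Real.exp (δ * ‖h‖ / 2) * (gaussianWeight z * v)
      + M * Real.exp (ε * N) * Real.exp (ε * r - δ ^ 2 * r ^ 2 / 16) *
        Real.exp (‖h‖ / 2 * ‖z‖ - 1 / 8 * ‖z‖ ^ 2) := by
  have hr0 : 0 < r := by linarith
  have hw : ‖z‖ ^ 2 - 2 * (‖z‖ * (‖h‖ / r)) ≤ ‖z + r⁻¹ • h‖ ^ 2 := by
    have h₁ := norm_add_sq_real z (r⁻¹ • h)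
    have h₂ := abs_le.1 (abs_real_inner_le_norm z (r⁻¹ • h))
    rw [norm_smul, Real.norm_of_nonneg (by positivity : 0 ≤ r⁻¹), ← div_eq_inv_mul] at h₁ h₂
    nlinarith [sq_nonneg (‖h‖ / r)]
  rcases le_or_gt ‖z‖ (δ * r) with hz | hz
  · have h₁ : gaussianWeight (z + r⁻¹ • h) ≤ Real.exp (δ * ‖h‖ / 2) * gaussianWeight z := by
      simp only [gaussianWeight, ← Real.exp_add, Real.exp_le_exp]
      have : ‖z‖ * (‖h‖ / r) ≤ δ * ‖h‖ := by
        calc ‖z‖ * (‖h‖ / r) ≤ δ * r * (‖h‖ / r) := by gcongr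
          _ = δ * ‖h‖ := by field_simp
      linarith
    have h₂ := mul_le_mul_of_nonneg_right h₁ hv0
    have : 0 ≤ M * Real.exp (ε * N) * Real.exp (ε * r - δ ^ 2 * r ^ 2 / 16) *
        Real.exp (‖h‖ / 2 * ‖z‖ - 1 / 8 * ‖z‖ ^ 2) := by positivity
    linarith
  · have h₁ : gaussianWeight (z + r⁻¹ • h) * v
        ≤ M * Real.exp (ε * N) * Real.exp (ε * r - δ ^ 2 * r ^ 2 / 16) *
          Real.exp (‖h‖ / 2 * ‖z‖ - 1 / 8 * ‖z‖ ^ 2) := by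
      calc gaussianWeight (z + r⁻¹ • h) * v
          ≤ gaussianWeight (z + r⁻¹ • h) * (M * Real.exp (ε * (N + r + r * ‖z‖))) :=
            mul_le_mul_of_nonneg_left hv (gaussianWeight_pos _).le
        _ = M * Real.exp (-‖z + r⁻¹ • h‖ ^ 2 / 4 + ε * (N + r + r * ‖z‖)) := by
            rw [gaussianWeight, Real.exp_add]
            ring
        _ ≤ M * Real.exp (ε * N + (ε * r - δ ^ 2 * r ^ 2 / 16)
              + (‖h‖ / 2 * ‖z‖ - 1 / 8 * ‖z‖ ^ 2)) := by
            refine mul_le_mul_of_nonneg_left (Real.exp_le_exp.2 ?_) hM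
            have h₂ : ‖z‖ * (‖h‖ / r) ≤ ‖z‖ * ‖h‖ := by
              gcongr
              exact div_le_self (norm_nonneg h) hr
            subst hε
            nlinarith [mul_pos (sub_pos.2 hz) (mul_pos hδ hr0),
              mul_nonneg (norm_nonneg z) (sub_pos.2 hz).le]
        _ = _ := by
            rw [Real.exp_add, Real.exp_add]
            ring
    have : 0 ≤ Real.exp (δ * ‖h‖ / 2) * (gaussianWeight z * v) :=
      mul_nonneg (Real.exp_pos _).le (mul_nonneg (gaussianWeight_pos z).le hv0)
    linarith

/-- A positive eternal solution of the heat equation of subexponential growth takes, at a given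
time, at most the same value at any point as at any other point. -/
theorem le_of_subexponential {u : EuclideanSpace ℝ (Fin n) → ℝ → ℝ}
    (hu : ContDiff ℝ 2 fun p : EuclideanSpace ℝ (Fin n) × ℝ => u p.1 p.2)
    (heat : ∀ x t, deriv (fun s => u x s) t = slap (fun y => u y t) x)
    (hpos : ∀ x t, 0 < u x t)
    (hsub : ∀ ε : ℝ, 0 < ε → ∃ M : ℝ, 0 ≤ M ∧
      ∀ x t, u x t ≤ M * Real.exp (ε * (‖x‖ + √|t|)))
    (y x : EuclideanSpace ℝ (Fin n)) (t : ℝ) : u y t ≤ u x t := by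
  obtain ⟨M₁, hM₁0, hM₁⟩ := hsub 1 one_pos
  have hM₁' (x : EuclideanSpace ℝ (Fin n)) (t : ℝ) :
      |u x t| ≤ M₁ * Real.exp (‖x‖ + √|t|) := by
    rw [abs_of_pos (hpos x t)]
    simpa using hM₁ x t
  have hmean := fun (x : EuclideanSpace ℝ (Fin n)) {r : ℝ} (hr : 0 < r) =>
    integral_gaussianWeight_mul_parabolic_rescaling hu heat hM₁0 hM₁' x t hr
  have hcpos := integral_gaussianWeight_pos (n := n)
  set c := ∫ z : EuclideanSpace ℝ (Fin n), gaussianWeight z with hc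
  set h := y - x with hh
  have hint (x : EuclideanSpace ℝ (Fin n)) {r : ℝ} (hr : 0 < r) :
      Integrable fun z => gaussianWeight z * u (x - r • z) (t - r ^ 2) := by
    refine Integrable.of_integral_ne_zero ?_
    rw [hmean x hr]
    exact (mul_pos hcpos (hpos x t)).ne'
  have hδ {δ : ℝ} (hδ : 0 < δ) : u y t ≤ Real.exp (δ * ‖h‖ / 2) * u x t := by
    obtain ⟨M, hM0, hM⟩ := hsub (δ / 16) (by positivity)
    have hgauss := integrable_exp_mul_norm_sub_sq (n := n) (‖h‖ / 2) (b := 1 / 8) (by norm_num)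
    set I := ∫ z : EuclideanSpace ℝ (Fin n), Real.exp (‖h‖ / 2 * ‖z‖ - 1 / 8 * ‖z‖ ^ 2) with hI
    have hstep : ∀ᶠ r : ℝ in atTop, c * u y t ≤ Real.exp (δ * ‖h‖ / 2) * (c * u x t)
        + M * Real.exp (δ / 16 * (‖x‖ + √|t|)) *
          Real.exp (δ / 16 * r - δ ^ 2 * r ^ 2 / 16) * I := by
      filter_upwards [eventually_ge_atTop 1] with r hr
      have hr0 : 0 < r := by linarith
      have htrans (z : EuclideanSpace ℝ (Fin n)) : y - r • (z + r⁻¹ • h) = x - r • z := by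
        rw [smul_add, smul_inv_smul₀ hr0.ne', hh]
        abel
      have hshift := integral_add_right_eq_self (μ := volume)
        (fun z => gaussianWeight z * u (y - r • z) (t - r ^ 2)) (r⁻¹ • h)
      have hshift_int := (hint y hr0).comp_add_right (r⁻¹ • h)
      simp only [htrans] at hshift hshift_int
      rw [← hmean y hr0, ← hmean x hr0, ← hshift, hI, ← integral_const_mul, ← integral_const_mul,
        ← integral_add ((hint x hr0).const_mul _) (hgauss.const_mul _)]
      refine integral_mono hshift_int
        (((hint x hr0).const_mul _).add (hgauss.const_mul _)) fun z => ?_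
      refine gaussianWeight_add_mul_le (hpos _ _).le hM0 hδ rfl hr z h ((hM _ _).trans ?_)
      refine mul_le_mul_of_nonneg_left (Real.exp_le_exp.2 ?_) hM0
      exact mul_le_mul_of_nonneg_left (norm_add_sqrt_parabolic_le x z t hr0.le) (by positivity)
    have hexp : Tendsto (fun r : ℝ => Real.exp (δ / 16 * r - δ ^ 2 * r ^ 2 / 16)) atTop (𝓝 0) := by
      refine Real.tendsto_exp_atBot.comp ?_
      have h₁ : Tendsto (fun r : ℝ => r * (δ / 16 - δ ^ 2 / 16 * r)) atTop atBot := by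
        refine tendsto_id.atTop_mul_atBot₀ ?_
        exact tendsto_atBot_add_const_left _ (δ / 16) (tendsto_neg_atTop_atBot.comp
          (tendsto_id.const_mul_atTop (by positivity : 0 < δ ^ 2 / 16)))
      refine h₁.congr fun r => ?_
      ring
    have hle := ge_of_tendsto (((hexp.const_mul (M * Real.exp (δ / 16 * (‖x‖ + √|t|)))).mul_const
      I).const_add (Real.exp (δ * ‖h‖ / 2) * (c * u x t))) hstep
    rw [mul_zero, zero_mul, add_zero, mul_left_comm] at hle
    exact le_of_mul_le_mul_left hle hcpos
  have hlim : Tendsto (fun δ : ℝ => Real.exp (δ * ‖h‖ / 2) * u x t) (𝓝[>] 0) (𝓝 (u x t)) := by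
    have h' : Continuous fun δ : ℝ => Real.exp (δ * ‖h‖ / 2) * u x t := by fun_prop
    simpa using (h'.tendsto 0).mono_left (nhdsWithin_le_nhds (s := Ioi 0))
  refine ge_of_tendsto hlim ?_
  filter_upwards [self_mem_nhdsWithin] with δ hδ'
  exact hδ hδ'

end Heat

/-- Euclidean case of Theorem 1.2(a): Yau-type Liouville theorem for the heat equation. -/
theorem liouville_heat_subexponential (n : ℕ) (hn : 1 ≤ n)
    (u : EuclideanSpace ℝ (Fin n) → ℝ → ℝ)
    (hsol : IsHeatSolutionOn u univ)
    (hpos : ∀ (x : EuclideanSpace ℝ (Fin n)) (t : ℝ), 0 < u x t)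
    (hgrowth : ∀ ε : ℝ, 0 < ε → ∃ K : ℝ, 0 < K ∧
      ∀ (x : EuclideanSpace ℝ (Fin n)) (t : ℝ), K ≤ ‖x‖ + Real.sqrt |t| →
        u x t ≤ Real.exp (ε * (‖x‖ + Real.sqrt |t|))) :
    ∃ C : ℝ, ∀ (x : EuclideanSpace ℝ (Fin n)) (t : ℝ), u x t = C := by
  have hu : ContDiff ℝ 2 fun p : EuclideanSpace ℝ (Fin n) × ℝ => u p.1 p.2 :=
    contDiff_infty.1 (contDiffOn_univ.1 hsol.1) 2
  have heat (x : EuclideanSpace ℝ (Fin n)) (t : ℝ) :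
      deriv (fun s => u x s) t = slap (fun y => u y t) x := hsol.2 (x, t) (mem_univ _)
  have hsub := exists_le_mul_exp_of_subexponential hu.continuous hgrowth
  have hspace (x y : EuclideanSpace ℝ (Fin n)) (t : ℝ) : u x t = u y t :=
    le_antisymm (le_of_subexponential hu heat hpos hsub x y t)
      (le_of_subexponential hu heat hpos hsub y x t)
  refine ⟨u 0 0, fun x t => (hspace x 0 t).trans ?_⟩
  refine is_const_of_deriv_eq_zero (f := fun s => u 0 s) ?_ (fun s => ?_) t 0
  · exact (hu.comp (contDiff_const.prodMk contDiff_id)).differentiable two_ne_zero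
  · have hslice : (fun y => u y s) = fun _ => u 0 s := funext fun y => hspace y 0 s
    rw [heat, hslice]
    simp [slap]
end

section
/- Let u be a smooth solution (not assumed positive) of the heat equation on all of ℝⁿ × ℝ such that u(x,t) = o(|x| + √|t|) near infinity; precisely, for every ε > 0 there exists K > 0 such that |u(x,t)| ≤ ε(|x| + √|t|) whenever |x| + √|t| ≥ K. Then u is constant. (Euclidean case of Theorem 1.2(b).) -/
open Metric Set

theorem ContDiff.fderiv_apply_const {E : Type*} [NormedAddCommGroup E]
    [NormedSpace ℝ E] {f : E → ℝ} (hf : ContDiff ℝ 2 f) (e : E) :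
    ContDiff ℝ 1 (fun y => fderiv ℝ f y e) :=
  (hf.fderiv_right (m := 1) (by norm_num)).clm_apply contDiff_const

theorem fderiv_fderiv_apply_nonpos_of_isLocalMax {E : Type*} [NormedAddCommGroup E]
    [NormedSpace ℝ E] {f : E → ℝ} (hf : ContDiff ℝ 2 f) {x : E} (hx : IsLocalMax f x) (e : E) :
    fderiv ℝ (fun y => fderiv ℝ f y e) x e ≤ 0 := by
  have hline : ∀ s : ℝ, HasDerivAt (fun r : ℝ => x + r • e) e s := fun s => by
    simpa using ((hasDerivAt_id s).smul_const e).const_add x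
  have hdf : ContDiff ℝ 1 (fun y => fderiv ℝ f y e) := hf.fderiv_apply_const e
  have h1 : deriv (fun r : ℝ => f (x + r • e)) = fun s => fderiv ℝ f (x + s • e) e := by
    funext s
    exact ((hf.differentiable (by norm_num) _).hasFDerivAt.comp_hasDerivAt s (hline s)).deriv
  have h2 : deriv (fun s : ℝ => fderiv ℝ f (x + s • e) e) 0
      = fderiv ℝ (fun y => fderiv ℝ f y e) x e := by
    have := ((hdf.differentiable (by norm_num) (x + (0 : ℝ) • e)).hasFDerivAt.comp_hasDerivAt
      (0 : ℝ) (hline 0)).deriv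
    simpa [Function.comp_def] using this
  have hcont : Continuous (fun r : ℝ => x + r • e) := by fun_prop
  have hmax : IsLocalMax (fun r : ℝ => f (x + r • e)) 0 := by
    have : Filter.Tendsto (fun r : ℝ => x + r • e) (nhds 0) (nhds x) := by
      simpa using hcont.tendsto 0
    simpa [IsLocalMax, IsMaxFilter] using this.eventually hx
  by_contra! hpos
  have hmin : IsLocalMin (fun r : ℝ => f (x + r • e)) 0 := by
    refine isLocalMin_of_deriv_deriv_pos ?_ hmax.deriv_eq_zero
      (hf.continuous.comp hcont).continuousAt
    rw [h1, h2]; exact hpos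
  have hconst : (fun r : ℝ => f (x + r • e)) =ᶠ[nhds 0] fun _ => f (x + (0 : ℝ) • e) := by
    filter_upwards [hmin, hmax] with r hr hr'
    exact le_antisymm hr' hr
  have := hconst.deriv.deriv_eq
  rw [h1, h2] at this
  simp at this
  linarith

theorem slap_nonpos_of_isLocalMax {n : ℕ} {f : EuclideanSpace ℝ (Fin n) → ℝ}
    (hf : ContDiff ℝ 2 f) {x : EuclideanSpace ℝ (Fin n)} (hx : IsLocalMax f x) :
    slap f x ≤ 0 :=
  Finset.sum_nonpos fun _ _ => fderiv_fderiv_apply_nonpos_of_isLocalMax hf hx _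

theorem deriv_nonneg_of_eventually_le_left {g : ℝ → ℝ} {t : ℝ} (hg : DifferentiableAt ℝ g t)
    (h : ∀ᶠ s in nhdsWithin t (Iio t), g s ≤ g t) : 0 ≤ deriv g t := by
  have hlim : Filter.Tendsto (slope g t) (nhdsWithin t (Iio t)) (nhds (deriv g t)) :=
    (hasDerivAt_iff_tendsto_slope.1 hg.hasDerivAt).mono_left
      (nhdsWithin_mono _ fun s hs => ne_of_lt hs)
  refine ge_of_tendsto hlim ?_
  filter_upwards [h, self_mem_nhdsWithin] with s hs hst
  rw [slope_def_field]
  exact div_nonneg_of_nonpos (by linarith) (by linarith [mem_Iio.1 hst])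

theorem slap_sub {n : ℕ} {f g : EuclideanSpace ℝ (Fin n) → ℝ}
    (hf : ContDiff ℝ 2 f) (hg : ContDiff ℝ 2 g) (x : EuclideanSpace ℝ (Fin n)) :
    slap (fun y => f y - g y) x = slap f x - slap g x := by
  unfold slap
  rw [← Finset.sum_sub_distrib]
  refine Finset.sum_congr rfl fun i _ => ?_
  have h1 : (fun y => fderiv ℝ (fun y => f y - g y) y (EuclideanSpace.single i 1))
      = fun y => fderiv ℝ f y (EuclideanSpace.single i 1)
        - fderiv ℝ g y (EuclideanSpace.single i 1) := by
    funext y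
    rw [fderiv_fun_sub (hf.differentiable (by norm_num) y) (hg.differentiable (by norm_num) y)]
    rfl
  rw [h1, fderiv_fun_sub ((hf.fderiv_apply_const _).differentiable (by norm_num) x)
    ((hg.fderiv_apply_const _).differentiable (by norm_num) x)]
  rfl

/-- The second directional derivative of a precomposition with an affine map. -/
theorem fderiv_fderiv_comp_affine_apply {E : Type*} [NormedAddCommGroup E]
    [NormedSpace ℝ E] {f : E → ℝ} (hf : ContDiff ℝ 2 f) (L : E →L[ℝ] E) (a x e : E) :
    fderiv ℝ (fun y => fderiv ℝ (fun z => f (a + L z)) y e) x e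
      = fderiv ℝ (fun y => fderiv ℝ f y (L e)) (a + L x) (L e) := by
  have hA : ∀ y, HasFDerivAt (fun z => a + L z) L y := fun y => L.hasFDerivAt.const_add a
  have h1 : (fun y => fderiv ℝ (fun z => f (a + L z)) y e)
      = fun y => fderiv ℝ f (a + L y) (L e) := by
    funext y
    have := ((hf.differentiable (by norm_num) (a + L y)).hasFDerivAt.comp y (hA y)).fderiv
    simpa [Function.comp_def] using congrArg (fun T : E →L[ℝ] ℝ => T e) this
  rw [h1]
  have := (((hf.fderiv_apply_const (L e)).differentiable (by norm_num)
    (a + L x)).hasFDerivAt.comp x (hA x)).fderiv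
  simpa [Function.comp_def] using congrArg (fun T : E →L[ℝ] ℝ => T e) this

theorem fderiv_fderiv_apply_neg {E : Type*} [NormedAddCommGroup E]
    [NormedSpace ℝ E] (f : E → ℝ) (x e : E) :
    fderiv ℝ (fun y => fderiv ℝ f y (-e)) x (-e) = fderiv ℝ (fun y => fderiv ℝ f y e) x e := by
  simp [fderiv_fun_neg]

/-- Reflection of Euclidean space in the hyperplane `x i = 0`. -/
noncomputable def coordReflection {n : ℕ} (i : Fin n) :
    EuclideanSpace ℝ (Fin n) →L[ℝ] EuclideanSpace ℝ (Fin n) :=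
  ContinuousLinearMap.id ℝ _
    - (2 : ℝ) • (EuclideanSpace.proj i).smulRight (EuclideanSpace.single i 1)

theorem coordReflection_apply {n : ℕ} (i : Fin n) (x : EuclideanSpace ℝ (Fin n)) :
    coordReflection i x = x - (2 * x i) • EuclideanSpace.single i 1 := by
  simp [coordReflection, mul_smul]

theorem coordReflection_single_self {n : ℕ} (i : Fin n) :
    coordReflection i (EuclideanSpace.single i 1) = -EuclideanSpace.single i 1 := by
  rw [coordReflection_apply]
  ext j
  by_cases h : j = i <;> simp [h]
  norm_num

theorem coordReflection_single_of_ne {n : ℕ} {i j : Fin n} (h : j ≠ i) :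
    coordReflection i (EuclideanSpace.single j 1) = EuclideanSpace.single j 1 := by
  rw [coordReflection_apply]
  simp [h.symm]

theorem norm_coordReflection {n : ℕ} (i : Fin n) (x : EuclideanSpace ℝ (Fin n)) :
    ‖coordReflection i x‖ = ‖x‖ := by
  simp only [EuclideanSpace.norm_eq, coordReflection_apply]
  congr 1
  refine Finset.sum_congr rfl fun j _ => ?_
  by_cases h : j = i
  · subst h
    simp
    ring
  · simp [h]

theorem slap_comp_add_left {n : ℕ} {f : EuclideanSpace ℝ (Fin n) → ℝ} (hf : ContDiff ℝ 2 f)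
    (a x : EuclideanSpace ℝ (Fin n)) : slap (fun y => f (a + y)) x = slap f (a + x) :=
  Finset.sum_congr rfl fun _ _ =>
    fderiv_fderiv_comp_affine_apply hf (ContinuousLinearMap.id ℝ _) a x _

theorem slap_comp_add_coordReflection {n : ℕ} {f : EuclideanSpace ℝ (Fin n) → ℝ}
    (hf : ContDiff ℝ 2 f) (i : Fin n) (a x : EuclideanSpace ℝ (Fin n)) :
    slap (fun y => f (a + coordReflection i y)) x = slap f (a + coordReflection i x) := by
  refine Finset.sum_congr rfl fun j _ => ?_
  rw [fderiv_fderiv_comp_affine_apply hf]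
  by_cases h : j = i
  · subst h
    rw [coordReflection_single_self, fderiv_fderiv_apply_neg]
  · rw [coordReflection_single_of_ne h]

/-- Spatial part of the barrier function on a half-ball of radius `R`. -/
noncomputable def barrier {n : ℕ} (i : Fin n) (R : ℝ) (x : EuclideanSpace ℝ (Fin n)) : ℝ :=
  ‖x‖ ^ 2 + (n + 1) * (R * x i - x i ^ 2)

theorem contDiff_barrier {n : ℕ} (i : Fin n) (R : ℝ) : ContDiff ℝ 2 (barrier i R) := by
  have : ContDiff ℝ 2 (fun x : EuclideanSpace ℝ (Fin n) => x i) :=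
    (EuclideanSpace.proj (𝕜 := ℝ) i).contDiff
  exact (contDiff_norm_sq ℝ).add (contDiff_const.mul ((contDiff_const.mul this).sub (this.pow 2)))

theorem slap_const_mul_barrier_sub {n : ℕ} (i : Fin n) (R a t : ℝ)
    (x : EuclideanSpace ℝ (Fin n)) :
    slap (fun y => a * (barrier i R y - t)) x = -(2 * a) := by
  have hp : ∀ (j : Fin n) (y : EuclideanSpace ℝ (Fin n)),
      HasFDerivAt (fun x : EuclideanSpace ℝ (Fin n) => x j)
        (EuclideanSpace.proj j : EuclideanSpace ℝ (Fin n) →L[ℝ] ℝ) y :=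
    fun j y => (EuclideanSpace.proj (𝕜 := ℝ) j).hasFDerivAt
  have h1 : ∀ (j : Fin n), (fun y => fderiv ℝ (fun y => a * (barrier i R y - t)) y
      (EuclideanSpace.single j 1)) = fun y : EuclideanSpace ℝ (Fin n) =>
        a * (2 * y j + (n + 1) * (R - 2 * y i) * (if i = j then 1 else 0)) := by
    intro j
    funext y
    have := (((((hasStrictFDerivAt_norm_sq y).hasFDerivAt).add
      ((((hp i y).const_mul R).sub ((hp i y).pow 2)).const_mul ((n : ℝ) + 1))).sub_const
        t).const_mul a).fderiv
    have := congrArg (fun T : EuclideanSpace ℝ (Fin n) →L[ℝ] ℝ =>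
      T (EuclideanSpace.single j 1)) this
    refine Eq.trans this ?_
    by_cases h : i = j
    · subst h
      simp [EuclideanSpace.inner_single_right]
      ring
    · simp [EuclideanSpace.inner_single_right, h]
  have h2 : ∀ j : Fin n, fderiv ℝ (fun y : EuclideanSpace ℝ (Fin n) =>
      a * (2 * y j + (n + 1) * (R - 2 * y i) * (if i = j then 1 else 0))) x
      (EuclideanSpace.single j 1) = a * (2 - if i = j then 2 * ((n : ℝ) + 1) else 0) := by
    intro j
    have := ((((hp j x).const_mul 2).add (((((hp i x).const_mul 2).const_sub R).const_mul
      ((n : ℝ) + 1)).mul_const (if i = j then (1 : ℝ) else 0))).const_mul a).fderiv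
    have := congrArg (fun T : EuclideanSpace ℝ (Fin n) →L[ℝ] ℝ =>
      T (EuclideanSpace.single j 1)) this
    refine Eq.trans this ?_
    by_cases h : i = j
    · subst h
      simp
      ring
    · simp [h]
  unfold slap
  simp only [h1, h2]
  rw [← Finset.mul_sum, Finset.sum_sub_distrib]
  simp
  ring

/-- Comparison with the barrier on the half-cylinder `{‖x‖ ≤ R, 0 ≤ x i, -R² ≤ t ≤ 0}`. -/
theorem le_barrier_of_heat {n : ℕ} {w : EuclideanSpace ℝ (Fin n) → ℝ → ℝ}
    (hw : ContDiff ℝ 2 (fun p : EuclideanSpace ℝ (Fin n) × ℝ => w p.1 p.2))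
    (hheat : ∀ x t, deriv (w x) t = slap (fun y => w y t) x) (i : Fin n)
    (hzero : ∀ x t, x i = 0 → w x t = 0) {R M : ℝ} (hR : 0 < R) (hM : 0 < M)
    (hbound : ∀ x t, ‖x‖ ≤ R → -R ^ 2 ≤ t → t ≤ 0 → w x t ≤ M)
    {x : EuclideanSpace ℝ (Fin n)} (hxR : ‖x‖ ≤ R) (hxi : 0 ≤ x i) :
    w x 0 ≤ M / R ^ 2 * barrier i R x := by
  set a := M / R ^ 2 with ha
  have ha0 : 0 < a := by positivity
  have haR : a * R ^ 2 = M := by rw [ha]; field_simp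
  by_contra! hlt
  set g : EuclideanSpace ℝ (Fin n) × ℝ → ℝ :=
    fun p => w p.1 p.2 - a * (barrier i R p.1 - p.2) with hg
  have hgc : Continuous g :=
    hw.continuous.sub (continuous_const.mul
      (((contDiff_barrier i R).continuous.comp continuous_fst).sub continuous_snd))
  have hcoord : Continuous (fun y : EuclideanSpace ℝ (Fin n) => y i) := by fun_prop
  have hD : IsCompact ((closedBall (0 : EuclideanSpace ℝ (Fin n)) R ∩ {y | 0 ≤ y i})
      ×ˢ Icc (-R ^ 2) 0) :=
    ((isCompact_closedBall _ _).inter_right (isClosed_le continuous_const hcoord)).prod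
      isCompact_Icc
  have hxD : (x, (0 : ℝ)) ∈ (closedBall (0 : EuclideanSpace ℝ (Fin n)) R ∩ {y | 0 ≤ y i})
      ×ˢ Icc (-R ^ 2) 0 :=
    ⟨⟨by simpa using hxR, hxi⟩, by simp; positivity, le_rfl⟩
  obtain ⟨⟨y, t⟩, ⟨⟨hyR, hyi⟩, htR, ht0⟩, hmax⟩ := hD.exists_isMaxOn ⟨_, hxD⟩ hgc.continuousOn
  replace hyR : ‖y‖ ≤ R := by simpa using hyR
  replace hyi : 0 ≤ y i := hyi
  simp only at htR ht0
  have hmax' : ∀ z s, ‖z‖ ≤ R → 0 ≤ z i → -R ^ 2 ≤ s → s ≤ 0 → g (z, s) ≤ g (y, t) :=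
    fun z s hz hzi hs hs0 => isMaxOn_iff.1 hmax (z, s)
      (mk_mem_prod ⟨mem_closedBall_zero_iff.2 hz, hzi⟩ ⟨hs, hs0⟩)
  have hpos : 0 < g (y, t) := lt_of_lt_of_le (by simp only [hg]; linarith)
    (hmax' x 0 hxR hxi (by simp; positivity) le_rfl)
  have hyi' : y i ≤ R := (le_abs_self _).trans ((PiLp.norm_apply_le y i).trans hyR)
  have hn0 : (0 : ℝ) ≤ (n : ℝ) + 1 := by positivity
  have hq : 0 ≤ ((n : ℝ) + 1) * (R * y i - y i ^ 2) :=
    mul_nonneg hn0 (by nlinarith)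
  have hwM := hbound y t hyR htR ht0
  have hyR' : ‖y‖ < R := by
    refine lt_of_le_of_ne hyR fun h => ?_
    have : R ^ 2 ≤ barrier i R y - t := by rw [barrier, h]; linarith
    have := mul_le_mul_of_nonneg_left this ha0.le
    simp only [hg] at hpos
    linarith
  have htR' : -R ^ 2 < t := by
    refine lt_of_le_of_ne htR fun h => ?_
    have : R ^ 2 ≤ barrier i R y - t := by rw [barrier, ← h]; nlinarith [sq_nonneg ‖y‖]
    have := mul_le_mul_of_nonneg_left this ha0.le
    simp only [hg] at hpos
    linarith
  have hyi0 : 0 < y i := by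
    refine lt_of_le_of_ne hyi fun h => ?_
    have : 0 ≤ barrier i R y - t := by rw [barrier]; nlinarith [sq_nonneg ‖y‖]
    have := mul_nonneg ha0.le this
    simp only [hg, hzero y t h.symm] at hpos
    linarith
  have hws : ContDiff ℝ 2 (fun z => w z t) := hw.comp (contDiff_id.prodMk contDiff_const)
  have hbs : ContDiff ℝ 2 (fun z => a * (barrier i R z - t)) :=
    contDiff_const.mul ((contDiff_barrier i R).sub contDiff_const)
  have hspace : slap (fun z => g (z, t)) y ≤ 0 := by
    refine slap_nonpos_of_isLocalMax (hws.sub hbs) ?_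
    have h1 : ∀ᶠ z in nhds y, ‖z‖ < R := continuous_norm.continuousAt.eventually_lt_const hyR'
    have h2 : ∀ᶠ z : EuclideanSpace ℝ (Fin n) in nhds y, 0 < z i :=
      hcoord.continuousAt.eventually_const_lt hyi0
    filter_upwards [h1, h2] with z hz hzi
    exact hmax' z t hz.le hzi.le htR ht0
  have hwt : DifferentiableAt ℝ (w y) t :=
    (hw.comp (contDiff_const.prodMk contDiff_id)).differentiable (by norm_num) t
  have hbt : HasDerivAt (fun s => a * (barrier i R y - s)) (a * -1) t :=
    ((hasDerivAt_id t).const_sub _).const_mul a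
  have htime : 0 ≤ deriv (fun s => g (y, s)) t := by
    refine deriv_nonneg_of_eventually_le_left (hwt.sub hbt.differentiableAt) ?_
    filter_upwards [Ioo_mem_nhdsLT htR'] with s hs
    exact hmax' y s hyR hyi hs.1.le (hs.2.le.trans ht0)
  have hd : deriv (fun s => g (y, s)) t = deriv (w y) t - a * -1 :=
    (hwt.hasDerivAt.sub hbt).deriv
  have hs : slap (fun z => g (z, t)) y = slap (fun z => w z t) y - -(2 * a) := by
    rw [← slap_const_mul_barrier_sub i R a t y]
    exact slap_sub hws hbs y
  rw [hd, hheat] at htime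
  rw [hs] at hspace
  linarith

/-- Sublinear parabolic growth is uniform on large cylinders about an arbitrary centre. -/
theorem exists_forall_abs_le_of_sublinear {E : Type*} [NormedAddCommGroup E] [ProperSpace E]
    {u : E → ℝ → ℝ} (hu : Continuous (fun p : E × ℝ => u p.1 p.2))
    (hgrowth : ∀ ε : ℝ, 0 < ε → ∃ K : ℝ, 0 < K ∧
      ∀ (x : E) (t : ℝ), K ≤ ‖x‖ + Real.sqrt |t| → |u x t| ≤ ε * (‖x‖ + Real.sqrt |t|))
    (x₀ : E) (t₀ : ℝ) {ε : ℝ} (hε : 0 < ε) :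
    ∃ R₀ : ℝ, ∀ R : ℝ, R₀ ≤ R → 0 < R → ∀ (x : E) (t : ℝ), ‖x‖ ≤ R → |t| ≤ R ^ 2 →
      |u (x₀ + x) (t₀ + t)| ≤ ε * R := by
  obtain ⟨K, hK, hKu⟩ := hgrowth (ε / 3) (by positivity)
  obtain ⟨C, hC⟩ := ((isCompact_closedBall (0 : E) K).prod
    (isCompact_Icc (a := -K ^ 2) (b := K ^ 2))).exists_bound_of_continuousOn hu.continuousOn
  refine ⟨max (C / ε) (‖x₀‖ + √|t₀|), fun R hR hR0 x t hx ht => ?_⟩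
  have hR1 : C ≤ ε * R := by
    have := (le_max_left _ _).trans hR
    rw [div_le_iff₀ hε] at this
    linarith
  have hR2 : ‖x₀‖ + √|t₀| ≤ R := (le_max_right _ _).trans hR
  rcases le_or_gt K (‖x₀ + x‖ + √|t₀ + t|) with h | h
  · refine (hKu _ _ h).trans ?_
    have h1 := norm_add_le x₀ x
    have h2 : √|t₀ + t| ≤ √|t₀| + R := by
      refine Real.sqrt_le_iff.2 ⟨by positivity, (abs_add_le _ _).trans ?_⟩
      nlinarith [Real.sq_sqrt (abs_nonneg t₀), Real.sqrt_nonneg |t₀|]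
    have : ‖x₀ + x‖ + √|t₀ + t| ≤ 3 * R := by linarith
    nlinarith
  · refine le_trans ?_ hR1
    have h1 : √|t₀ + t| ≤ K := by linarith [norm_nonneg (x₀ + x)]
    have h2 : |t₀ + t| ≤ K ^ 2 := (Real.sqrt_le_left hK.le).1 h1
    exact hC (x₀ + x, t₀ + t)
      ⟨by simpa using (by linarith [Real.sqrt_nonneg |t₀ + t|] : ‖x₀ + x‖ ≤ K), abs_le.1 h2⟩

theorem le_coordReflection_of_heat_sublinear {n : ℕ} {u : EuclideanSpace ℝ (Fin n) → ℝ → ℝ}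
    (hu : ContDiff ℝ 2 (fun p : EuclideanSpace ℝ (Fin n) × ℝ => u p.1 p.2))
    (hheat : ∀ x t, deriv (u x) t = slap (fun y => u y t) x)
    (hgrowth : ∀ ε : ℝ, 0 < ε → ∃ K : ℝ, 0 < K ∧
      ∀ (x : EuclideanSpace ℝ (Fin n)) (t : ℝ), K ≤ ‖x‖ + Real.sqrt |t| →
        |u x t| ≤ ε * (‖x‖ + Real.sqrt |t|))
    (i : Fin n) (x₀ : EuclideanSpace ℝ (Fin n)) (t₀ : ℝ) {x : EuclideanSpace ℝ (Fin n)}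
    (hx : 0 ≤ x i) : u (x₀ + x) t₀ ≤ u (x₀ + coordReflection i x) t₀ := by
  set w : EuclideanSpace ℝ (Fin n) → ℝ → ℝ :=
    fun y t => u (x₀ + y) (t₀ + t) - u (x₀ + coordReflection i y) (t₀ + t) with hw
  have hut : ∀ t, ContDiff ℝ 2 (fun y => u y t) := fun t =>
    hu.comp (contDiff_id.prodMk contDiff_const)
  have hux : ∀ y, ContDiff ℝ 2 (u y) := fun y => hu.comp (contDiff_const.prodMk contDiff_id)
  have hρ : ContDiff ℝ 2 (fun y => x₀ + coordReflection i y) :=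
    contDiff_const.add (coordReflection i).contDiff
  have hwc : ContDiff ℝ 2 (fun p : EuclideanSpace ℝ (Fin n) × ℝ => w p.1 p.2) :=
    (hu.comp ((contDiff_const.add contDiff_fst).prodMk (contDiff_const.add contDiff_snd))).sub
      (hu.comp ((hρ.comp contDiff_fst).prodMk (contDiff_const.add contDiff_snd)))
  have hshift : ∀ y t, HasDerivAt (fun s => u y (t₀ + s)) (slap (fun z => u z (t₀ + t)) y) t := by
    intro y t
    rw [← hheat]
    exact ((hux y).differentiable (by norm_num) (t₀ + t)).hasDerivAt.comp_const_add t₀ t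
  have hwheat : ∀ y t, deriv (w y) t = slap (fun z => w z t) y := by
    intro y t
    refine ((hshift _ t).sub (hshift _ t)).deriv.trans ?_
    refine Eq.trans ?_ (slap_sub ((hut (t₀ + t)).comp (contDiff_const.add contDiff_id))
      ((hut (t₀ + t)).comp hρ) y).symm
    exact congrArg₂ _ (slap_comp_add_left (hut _) _ _).symm
      (slap_comp_add_coordReflection (hut _) _ _ _).symm
  have hwzero : ∀ y t, y i = 0 → w y t = 0 := by
    intro y t hy
    simp [hw, coordReflection_apply, hy]
  have key : ∀ ε : ℝ, 0 < ε → w x 0 ≤ 2 * ε * ((n + 2) * ‖x‖) := by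
    intro ε hε
    obtain ⟨R₀, hR₀⟩ := exists_forall_abs_le_of_sublinear hu.continuous hgrowth x₀ t₀ hε
    obtain ⟨R, hR⟩ : ∃ R, R = max (max R₀ 1) ‖x‖ := ⟨_, rfl⟩
    have hR1 : R₀ ≤ R := hR ▸ (le_max_left _ _).trans (le_max_left _ _)
    have hR2 : 1 ≤ R := hR ▸ (le_max_right _ _).trans (le_max_left _ _)
    have hR3 : ‖x‖ ≤ R := hR ▸ le_max_right _ _
    have hR0 : 0 < R := by linarith
    have hle := le_barrier_of_heat hwc hwheat i hwzero hR0 (M := 2 * ε * R) (by positivity)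
      (fun y t hy ht ht0 => by
        have ht' : |t| ≤ R ^ 2 := abs_le.2 ⟨ht, ht0.trans (by positivity)⟩
        have h1 := abs_le.1 (hR₀ R hR1 hR0 y t hy ht')
        have h2 := abs_le.1 (hR₀ R hR1 hR0 (coordReflection i y) t
          (by rwa [norm_coordReflection]) ht')
        simp only [hw]
        linarith [h1.2, h2.1]) hR3 hx
    refine hle.trans ?_
    have hxi : x i ≤ ‖x‖ := (le_abs_self _).trans (PiLp.norm_apply_le x i)
    have hb : barrier i R x ≤ R * ((n + 2) * ‖x‖) := by
      have h1 : R * x i - x i ^ 2 ≤ R * ‖x‖ := by nlinarith [sq_nonneg (x i)]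
      have h2 := mul_le_mul_of_nonneg_left h1 (by positivity : (0 : ℝ) ≤ (n : ℝ) + 1)
      have h3 : ‖x‖ ^ 2 ≤ R * ‖x‖ := by nlinarith [norm_nonneg x]
      rw [barrier]
      linarith
    calc 2 * ε * R / R ^ 2 * barrier i R x
        ≤ 2 * ε * R / R ^ 2 * (R * ((n + 2) * ‖x‖)) := by gcongr
      _ = 2 * ε * ((n + 2) * ‖x‖) := by field_simp
  have hlim : Filter.Tendsto (fun ε : ℝ => 2 * ε * ((n + 2) * ‖x‖)) (nhdsWithin 0 (Ioi 0))
      (nhds 0) := by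
    have : Continuous (fun ε : ℝ => 2 * ε * ((n + 2) * ‖x‖)) := by fun_prop
    simpa using (this.tendsto 0).mono_left nhdsWithin_le_nhds
  have hfin : w x 0 ≤ 0 :=
    ge_of_tendsto hlim (by filter_upwards [self_mem_nhdsWithin] with ε hε using key ε hε)
  simpa [hw] using hfin

theorem slap_neg {n : ℕ} (f : EuclideanSpace ℝ (Fin n) → ℝ) (x : EuclideanSpace ℝ (Fin n)) :
    slap (fun y => -f y) x = -slap f x := by
  simp [slap, fderiv_fun_neg]

/-- Euclidean case of Theorem 1.2(b). -/
theorem liouville_heat_sublinear (n : ℕ) (hn : 1 ≤ n)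
    (u : EuclideanSpace ℝ (Fin n) → ℝ → ℝ)
    (hsol : IsHeatSolutionOn u univ)
    (hgrowth : ∀ ε : ℝ, 0 < ε → ∃ K : ℝ, 0 < K ∧
      ∀ (x : EuclideanSpace ℝ (Fin n)) (t : ℝ), K ≤ ‖x‖ + Real.sqrt |t| →
        |u x t| ≤ ε * (‖x‖ + Real.sqrt |t|)) :
    ∃ C : ℝ, ∀ (x : EuclideanSpace ℝ (Fin n)) (t : ℝ), u x t = C := by
  have hu : ContDiff ℝ 2 (fun p : EuclideanSpace ℝ (Fin n) × ℝ => u p.1 p.2) :=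
    (contDiffOn_univ.1 hsol.1).of_le (WithTop.coe_le_coe.2 (le_top : (2 : ℕ∞) ≤ ⊤))
  have hheat : ∀ x t, deriv (u x) t = slap (fun y => u y t) x :=
    fun x t => hsol.2 (x, t) (mem_univ _)
  have hrefl : ∀ (i : Fin n) (x₀ : EuclideanSpace ℝ (Fin n)) (t : ℝ)
      (x : EuclideanSpace ℝ (Fin n)), 0 ≤ x i →
      u (x₀ + x) t = u (x₀ + coordReflection i x) t := by
    intro i x₀ t x hx
    refine le_antisymm (le_coordReflection_of_heat_sublinear hu hheat hgrowth i x₀ t hx) ?_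
    have := le_coordReflection_of_heat_sublinear (u := fun y s => -u y s) hu.neg
      (fun y s => by rw [slap_neg, ← hheat]; exact deriv.fun_neg)
      (by simpa only [abs_neg] using hgrowth) i x₀ t hx
    linarith
  have htrans : ∀ (i : Fin n) (x : EuclideanSpace ℝ (Fin n)) (t s : ℝ), 0 ≤ s →
      u (x + s • EuclideanSpace.single i 1) t = u x t := by
    intro i x t s hs
    have := hrefl i (x + (s / 2) • EuclideanSpace.single i 1) t
      ((s / 2) • EuclideanSpace.single i 1) (by simpa using div_nonneg hs zero_le_two)
    rw [map_smul, coordReflection_single_self, smul_neg, add_neg_cancel_right, add_assoc,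
      ← add_smul, add_halves] at this
    exact this
  have hut : ∀ t, Differentiable ℝ (fun y => u y t) := fun t =>
    (hu.comp (contDiff_id.prodMk contDiff_const)).differentiable (by norm_num)
  have hspace : ∀ x t, u x t = u 0 t := by
    intro x t
    refine is_const_of_fderiv_eq_zero (𝕜 := ℝ) (hut t) (fun y => ?_) x 0
    have hdir : ∀ i : Fin n, fderiv ℝ (fun y => u y t) y (EuclideanSpace.single i 1) = 0 := by
      intro i
      have h1 : HasDerivAt (fun s : ℝ => u (y + s • EuclideanSpace.single i 1) t)
          (fderiv ℝ (fun y => u y t) y (EuclideanSpace.single i 1)) 0 :=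
        (hut t y).hasFDerivAt.hasLineDerivAt _
      have h2 : HasDerivWithinAt (fun s : ℝ => u (y + s • EuclideanSpace.single i 1) t) 0
          (Ici 0) 0 :=
        (hasDerivWithinAt_const (0 : ℝ) (Ici 0) (u y t)).congr
          (fun s hs => htrans i y t s hs) (htrans i y t 0 le_rfl)
      exact (uniqueDiffOn_Ici (0 : ℝ) 0 self_mem_Ici).eq_deriv _ h1.hasDerivWithinAt h2
    refine ContinuousLinearMap.coe_injective ((EuclideanSpace.basisFun (Fin n) ℝ).toBasis.ext ?_)
    intro i
    simpa using hdir i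
  have htime : ∀ t, u 0 t = u 0 0 := by
    intro t
    refine is_const_of_deriv_eq_zero (f := u 0)
      ((hu.comp (contDiff_const.prodMk contDiff_id)).differentiable (by norm_num)) (fun s => ?_) t 0
    rw [hheat, funext fun y => hspace y s]
    simp [slap]
  exact ⟨u 0 0, fun x t => (hspace x t).trans (htime t)⟩
end
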